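/- A function u ∈ C²(Ω̄) ∩ C₀(Ω̄) with u > 0 in Ω is a solution to (P) (in the very weak sense) if and only if u satisfies the iterated Green's representation u(x) = ∫_Ω G(x,y) ( ∫_Ω G(y,z) K(z) u^{-α}(z) dz ) dy for all x ∈ Ω, where G is the positive Green's function of −Δ in Ω with Dirichlet boundary conditions. -/

import Mathlib

open MeasureTheory Metric Set Filter Topology
open scoped ENNReal NNReal

noncomputable section

/-- Euclidean space `ℝ^N`. -/
abbrev Euc (N : ℕ) := EuclideanSpace ℝ (Fin N)

/-- The Laplacian of `u`, computed with derivatives within `closure Ω`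
(so that it is also meaningful on the boundary for `u ∈ C²(closure Ω)`). -/
noncomputable def lapOn {N : ℕ} (Ω : Set (Euc N)) (u : Euc N → ℝ) (x : Euc N) : ℝ :=
  ∑ i : Fin N, iteratedFDerivWithin ℝ 2 u (closure Ω) x
    ![EuclideanSpace.single i 1, EuclideanSpace.single i 1]

/-- `ρ(x) = dist(x, ∂Ω)`. -/
noncomputable def bdist {N : ℕ} (Ω : Set (Euc N)) (x : Euc N) : ℝ :=
  Metric.infDist x (frontier Ω)

/-- `u` is a very weak solution of the Navier problem `Δ²u = rhs` in `Ω`,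
`u = Δu = 0` on `∂Ω`: `u ∈ C²(closure Ω)`, the boundary conditions hold, and the
integral identity `∫ Δu Δψ = ∫ rhs·ψ` holds for all test functions
`ψ ∈ C²(closure Ω) ∩ C₀(closure Ω)`. -/
def IsNavierSol {N : ℕ} (Ω : Set (Euc N)) (rhs u : Euc N → ℝ) : Prop :=
  ContDiffOn ℝ 2 u (closure Ω) ∧
  (∀ x ∈ frontier Ω, u x = 0) ∧
  (∀ x ∈ frontier Ω, lapOn Ω u x = 0) ∧
  ∀ ψ : Euc N → ℝ, ContDiffOn ℝ 2 ψ (closure Ω) → (∀ x ∈ frontier Ω, ψ x = 0) →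
    ∫ x in Ω, lapOn Ω u x * lapOn Ω ψ x = ∫ x in Ω, rhs x * ψ x

/-- `u` is a (very weak) solution of problem `(P)`: `Δ²u = K·u^{-α}`, `u > 0` in `Ω`,
`u = Δu = 0` on `∂Ω`. -/
def IsSolP {N : ℕ} (Ω : Set (Euc N)) (K : Euc N → ℝ) (α : ℝ) (u : Euc N → ℝ) : Prop :=
  (∀ x ∈ Ω, 0 < u x) ∧ IsNavierSol Ω (fun x => K x * u x ^ (-α)) u

/-- local `ν`-Hölder continuity on `Ω` (i.e. membership in `C^ν_loc(Ω)`). -/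
def LocHolder {N : ℕ} (Ω : Set (Euc N)) (ν : ℝ) (K : Euc N → ℝ) : Prop :=
  ∀ x ∈ Ω, ∃ s ∈ nhdsWithin x Ω, ∃ C : ℝ≥0, HolderOnWith C ν.toNNReal K s

open scoped ContDiff

section

variable {N : ℕ}

/-- The partial derivative in the `i`-th coordinate direction. -/
def pd (i : Fin N) (f : Euc N → ℝ) (x : Euc N) : ℝ :=
  fderiv ℝ f x (EuclideanSpace.single i 1)

/-- The Laplacian as the sum of the pure second partial derivatives. -/
def lap (f : Euc N → ℝ) (x : Euc N) : ℝ := ∑ i, pd i (pd i f) x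

theorem pd_congr {i : Fin N} {f g : Euc N → ℝ} {x : Euc N} (h : f =ᶠ[𝓝 x] g) :
    pd i f =ᶠ[𝓝 x] pd i g :=
  (h.fderiv (𝕜 := ℝ)).mono fun _ hy => by simp only [pd, hy]

theorem lap_congr {f g : Euc N → ℝ} {x : Euc N} (h : f =ᶠ[𝓝 x] g) : lap f x = lap g x :=
  Finset.sum_congr rfl fun _ _ => (pd_congr (pd_congr h)).eq_of_nhds

theorem contDiffAt_pd {i : Fin N} {f : Euc N → ℝ} {x : Euc N} {m n : WithTop ℕ∞}
    (hf : ContDiffAt ℝ n f x) (hmn : m + 1 ≤ n) : ContDiffAt ℝ m (pd i f) x :=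
  (hf.fderiv_right hmn).clm_apply contDiffAt_const

theorem ContDiff.pd {i : Fin N} {f : Euc N → ℝ} {m n : WithTop ℕ∞}
    (hf : ContDiff ℝ n f) (hmn : m + 1 ≤ n) : ContDiff ℝ m (pd i f) :=
  contDiff_iff_contDiffAt.2 fun _ => contDiffAt_pd hf.contDiffAt hmn

theorem ContDiff.lap {f : Euc N → ℝ} (hf : ContDiff ℝ ∞ f) : ContDiff ℝ ∞ (lap f) :=
  ContDiff.sum fun _ _ => (hf.pd (m := ∞) (by simp)).pd (m := ∞) (by simp)

theorem ContDiffAt.continuousAt_lap {f : Euc N → ℝ} {x : Euc N} (hf : ContDiffAt ℝ 2 f x) :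
    ContinuousAt (lap f) x := by
  have : ContDiffAt ℝ 0 (_root_.lap f) x :=
    ContDiffAt.sum fun i _ => contDiffAt_pd (m := 0) (n := 1)
      (contDiffAt_pd (m := 1) hf (by norm_num)) (by norm_num)
  exact this.continuousAt

theorem pd_tsupport (i : Fin N) (f : Euc N → ℝ) : tsupport (pd i f) ⊆ tsupport f :=
  tsupport_fderiv_apply_subset ℝ _

theorem lap_eq_zero_of_notMem_tsupport {f : Euc N → ℝ} {x : Euc N} (hx : x ∉ tsupport f) :
    lap f x = 0 :=
  Finset.sum_eq_zero fun i _ => image_eq_zero_of_notMem_tsupport fun h =>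
    hx (pd_tsupport i f (pd_tsupport i _ h))

theorem lap_tsupport (f : Euc N → ℝ) : tsupport (lap f) ⊆ tsupport f :=
  closure_minimal (fun _ hx => by_contra fun h => hx (lap_eq_zero_of_notMem_tsupport h))
    (isClosed_tsupport f)

theorem pd_add {i : Fin N} {f g : Euc N → ℝ} {x : Euc N} (hf : DifferentiableAt ℝ f x)
    (hg : DifferentiableAt ℝ g x) : pd i (fun y => f y + g y) x = pd i f x + pd i g x := by
  simp only [pd]
  rw [fderiv_fun_add hf hg]; rfl

theorem pd_const_mul {i : Fin N} {f : Euc N → ℝ} {x : Euc N} (c : ℝ)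
    (hf : DifferentiableAt ℝ f x) : pd i (fun y => c * f y) x = c * pd i f x := by
  simp only [pd]
  rw [fderiv_const_mul hf]; rfl

theorem eventually_differentiableAt {f : Euc N → ℝ} {x : Euc N} (hf : ContDiffAt ℝ 2 f x) :
    ∀ᶠ y in 𝓝 x, DifferentiableAt ℝ f y :=
  (hf.eventually (by simp)).mono fun _ hy => hy.differentiableAt (by simp)

theorem differentiableAt_pd {i : Fin N} {f : Euc N → ℝ} {x : Euc N} (hf : ContDiffAt ℝ 2 f x) :
    DifferentiableAt ℝ (pd i f) x :=
  (contDiffAt_pd (m := 1) hf (by norm_num)).differentiableAt (by simp)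

theorem lap_add {f g : Euc N → ℝ} {x : Euc N} (hf : ContDiffAt ℝ 2 f x)
    (hg : ContDiffAt ℝ 2 g x) : lap (fun y => f y + g y) x = lap f x + lap g x := by
  simp only [lap, ← Finset.sum_add_distrib]
  refine Finset.sum_congr rfl fun i _ => ?_
  rw [← pd_add (differentiableAt_pd hf) (differentiableAt_pd hg)]
  refine (pd_congr ?_).eq_of_nhds
  filter_upwards [eventually_differentiableAt hf, eventually_differentiableAt hg] with y h1 h2
  exact pd_add h1 h2

theorem lap_const_mul {f : Euc N → ℝ} {x : Euc N} (c : ℝ) (hf : ContDiffAt ℝ 2 f x) :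
    lap (fun y => c * f y) x = c * lap f x := by
  simp only [lap, Finset.mul_sum]
  refine Finset.sum_congr rfl fun i _ => ?_
  rw [← pd_const_mul c (differentiableAt_pd hf)]
  refine (pd_congr ?_).eq_of_nhds
  filter_upwards [eventually_differentiableAt hf] with y h1
  exact pd_const_mul c h1

theorem lap_sub {f g : Euc N → ℝ} {x : Euc N} (hf : ContDiffAt ℝ 2 f x)
    (hg : ContDiffAt ℝ 2 g x) : lap (fun y => f y - g y) x = lap f x - lap g x := by
  have h := lap_add hf (g := fun y => -1 * g y) (contDiffAt_const.mul hg)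
  rw [lap_const_mul _ hg] at h
  simpa [sub_eq_add_neg] using h

theorem lap_const (c : ℝ) (x : Euc N) : lap (fun _ => c) x = 0 := by
  have : ∀ i : Fin N, pd i (fun _ : Euc N => c) = fun _ => 0 := fun i => by
    funext y; simp [pd]
  have h0 : ∀ i : Fin N, pd i (fun _ : Euc N => (0:ℝ)) = fun _ => 0 := fun i => by
    funext y; simp [pd]
  simp [lap, this, h0]

theorem pd_comp {i : Fin N} {f : Euc N → ℝ} {p : ℝ → ℝ} {x : Euc N}
    (hp : DifferentiableAt ℝ p (f x)) (hf : DifferentiableAt ℝ f x) :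
    pd i (fun y => p (f y)) x = deriv p (f x) * pd i f x := by
  have := (hp.hasDerivAt.comp_hasFDerivAt x hf.hasFDerivAt).fderiv
  simp only [pd]
  change fderiv ℝ (p ∘ f) x _ = _
  rw [this]; rfl

theorem pd_mul {i : Fin N} {f g : Euc N → ℝ} {x : Euc N}
    (hf : DifferentiableAt ℝ f x) (hg : DifferentiableAt ℝ g x) :
    pd i (fun y => f y * g y) x = f x * pd i g x + pd i f x * g x := by
  simp only [pd]
  rw [fderiv_fun_mul hf hg]
  simp [mul_comm]

theorem lap_comp {f : Euc N → ℝ} {p : ℝ → ℝ} {x : Euc N} (hp : ContDiff ℝ ∞ p)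
    (hf : ContDiffAt ℝ 2 f x) :
    lap (fun y => p (f y)) x =
      deriv p (f x) * lap f x + deriv (deriv p) (f x) * ∑ i, pd i f x ^ 2 := by
  have hp1 : ContDiff ℝ ∞ (deriv p) := by
    have : ContDiff ℝ ((⊤ : ℕ∞) + 1 : WithTop ℕ∞) p := by simpa using hp
    exact (contDiff_succ_iff_deriv.1 this).2.2
  simp only [lap, Finset.mul_sum, ← Finset.sum_add_distrib]
  refine Finset.sum_congr rfl fun i _ => ?_
  have e : pd i (fun y => p (f y)) =ᶠ[𝓝 x] fun y => deriv p (f y) * pd i f y := by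
    filter_upwards [eventually_differentiableAt hf] with y h1
    exact pd_comp (hp.differentiable (by simp) _) h1
  have hd := hf.differentiableAt (by simp)
  rw [(pd_congr e).eq_of_nhds, pd_mul (f := fun y => deriv p (f y)) ((hp1.differentiable (by simp) _).comp x hd)
    (differentiableAt_pd hf), pd_comp (hp1.differentiable (by simp) _) hd]
  ring

theorem lapOn_eq_lap {Ω : Set (Euc N)} (hΩ : IsOpen Ω) (hΩd : UniqueDiffOn ℝ (closure Ω))
    {f : Euc N → ℝ} (hf : ContDiffOn ℝ 2 f (closure Ω)) {x : Euc N} (hx : x ∈ Ω) :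
    lapOn Ω f x = lap f x := by
  have hn : closure Ω ∈ 𝓝 x := mem_of_superset (hΩ.mem_nhds hx) subset_closure
  have hc : ContDiffAt ℝ 2 f x := hf.contDiffAt hn
  refine Finset.sum_congr rfl fun i _ => ?_
  rw [iteratedFDerivWithin_eq_iteratedFDeriv hΩd (by exact_mod_cast hc) (subset_closure hx),
    iteratedFDeriv_two_apply]
  have h1 : DifferentiableAt ℝ (fderiv ℝ f) x :=
    (hc.fderiv_right (m := 1) (by norm_num)).differentiableAt (by simp)
  change _ = fderiv ℝ (fun y => fderiv ℝ f y (EuclideanSpace.single i 1)) x _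
  rw [fderiv_clm_apply h1 (differentiableAt_const _)]
  simp

theorem continuousOn_lapOn {Ω : Set (Euc N)} (hΩd : UniqueDiffOn ℝ (closure Ω))
    {f : Euc N → ℝ} (hf : ContDiffOn ℝ 2 f (closure Ω)) :
    ContinuousOn (lapOn Ω f) (closure Ω) := by
  refine continuousOn_finsetSum _ fun i _ => ?_
  have h := hf.continuousOn_iteratedFDerivWithin (m := 2) (by norm_num) hΩd
  exact (ContinuousMultilinearMap.apply ℝ (fun _ : Fin 2 => Euc N) ℝ _).continuous.comp_continuousOn h

theorem two_le_infty : (2 : WithTop ℕ∞) ≤ ((⊤ : ℕ∞) : WithTop ℕ∞) :=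
  WithTop.coe_le_coe.2 le_top

/-- Smooth functions with compact support in `Ω`. -/
structure IsTest (Ω : Set (Euc N)) (ψ : Euc N → ℝ) : Prop where
  smooth : ContDiff ℝ ∞ ψ
  compact : HasCompactSupport ψ
  sub : tsupport ψ ⊆ Ω

namespace IsTest

variable {Ω : Set (Euc N)} {ψ θ : Euc N → ℝ}

theorem contDiffAt (h : IsTest Ω ψ) (x : Euc N) : ContDiffAt ℝ 2 ψ x :=
  (h.smooth.of_le two_le_infty).contDiffAt

theorem continuous (h : IsTest Ω ψ) : Continuous ψ := h.smooth.continuous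

theorem eq_zero (h : IsTest Ω ψ) {x : Euc N} (hx : x ∉ Ω) : ψ x = 0 :=
  image_eq_zero_of_notMem_tsupport fun h' => hx (h.sub h')

theorem lap (h : IsTest Ω ψ) : IsTest Ω (lap ψ) where
  smooth := h.smooth.lap
  compact := h.compact.of_isClosed_subset (isClosed_tsupport _) (lap_tsupport ψ)
  sub := (lap_tsupport ψ).trans h.sub

theorem add (h : IsTest Ω ψ) (h' : IsTest Ω θ) : IsTest Ω (fun x => ψ x + θ x) where
  smooth := h.smooth.add h'.smooth
  compact := h.compact.add h'.compact
  sub := (tsupport_add ψ θ).trans (union_subset h.sub h'.sub)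

theorem const_mul (h : IsTest Ω ψ) (c : ℝ) : IsTest Ω (fun x => c * ψ x) where
  smooth := contDiff_const.mul h.smooth
  compact := h.compact.mul_left
  sub := (tsupport_mul_subset_right (f := fun _ => c)).trans h.sub

theorem neg (h : IsTest Ω ψ) : IsTest Ω (fun x => -ψ x) := by
  simpa using h.const_mul (-1)

theorem mul_smooth (h : IsTest Ω ψ) (h' : ContDiff ℝ ∞ θ) : IsTest Ω (fun x => ψ x * θ x) where
  smooth := h.smooth.mul h'
  compact := h.compact.mul_right
  sub := (tsupport_mul_subset_left (f := ψ)).trans h.sub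

theorem zero : IsTest Ω (fun _ => 0) where
  smooth := contDiff_const
  compact := HasCompactSupport.zero
  sub := by simp [tsupport]

theorem integrable (h : IsTest Ω ψ) : Integrable ψ :=
  h.continuous.integrable_of_hasCompactSupport h.compact

theorem bounded (h : IsTest Ω ψ) : ∃ C, 0 ≤ C ∧ ∀ x, |ψ x| ≤ C := by
  obtain ⟨C, hC⟩ := h.continuous.bounded_above_of_compact_support h.compact
  exact ⟨C, (norm_nonneg _).trans (hC 0), hC⟩

end IsTest

theorem exists_cutoff {Ω F : Set (Euc N)} (hΩ : IsOpen Ω) (hF : IsCompact F) (hFΩ : F ⊆ Ω) :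
    ∃ χ : Euc N → ℝ, IsTest Ω χ ∧ (∀ᶠ x in 𝓝ˢ F, χ x = 1) ∧ ∀ x, χ x ∈ Icc (0:ℝ) 1 := by
  obtain ⟨t, ht, hFt, htΩ⟩ := exists_compact_between hF hΩ hFΩ
  obtain ⟨f, h1, h0, hI⟩ := exists_contMDiffMap_one_nhds_of_subset_interior (n := ⊤)
    (modelWithCornersSelf ℝ (Euc N)) hF.isClosed hFt
  have hs : tsupport (f : Euc N → ℝ) ⊆ t :=
    closure_minimal (fun x hx => by_contra fun h => hx (h0 x h)) ht.isClosed
  exact ⟨f, ⟨f.contMDiff.contDiff, ht.of_isClosed_subset (isClosed_tsupport _) hs, hs.trans htΩ⟩,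
    h1, hI⟩

/-- A function with compact support inside the open set `Ω` that is continuous on `Ω`
is continuous. -/
theorem continuous_mul_of_tsupport {Ω : Set (Euc N)} (hΩ : IsOpen Ω) {w ψ : Euc N → ℝ}
    (hw : ContinuousOn w Ω) (hψ : Continuous ψ) (hs : tsupport ψ ⊆ Ω) :
    Continuous fun x => w x * ψ x := by
  rw [continuous_iff_continuousAt]
  intro x
  by_cases hx : x ∈ Ω
  · exact (hw.continuousAt (hΩ.mem_nhds hx)).mul hψ.continuousAt
  · have h0 : (fun x => w x * ψ x) =ᶠ[𝓝 x] fun _ => 0 := by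
      filter_upwards [(isClosed_tsupport ψ).isOpen_compl.mem_nhds fun h => hx (hs h)] with y hy
      simp [image_eq_zero_of_notMem_tsupport hy]
    exact continuousAt_const.congr h0.symm

theorem integrable_mul_test {Ω : Set (Euc N)} (hΩ : IsOpen Ω) {w ψ : Euc N → ℝ}
    (hw : ContinuousOn w Ω) (hψ : IsTest Ω ψ) : Integrable fun x => w x * ψ x :=
  (continuous_mul_of_tsupport hΩ hw hψ.continuous hψ.sub).integrable_of_hasCompactSupport
    hψ.compact.mul_left

theorem integral_mul_pd {f g : Euc N → ℝ} (hf : ContDiff ℝ 1 f) (hg : ContDiff ℝ 1 g)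
    (hc : HasCompactSupport g) (i : Fin N) :
    ∫ x, f x * pd i g x = -∫ x, pd i f x * g x := by
  have hcd : HasCompactSupport (pd i g) :=
    hc.of_isClosed_subset (isClosed_tsupport _) (pd_tsupport i g)
  have cf : Continuous (pd i f) := (hf.pd (m := 0) (by norm_num)).continuous
  have cg : Continuous (pd i g) := (hg.pd (m := 0) (by norm_num)).continuous
  exact integral_mul_fderiv_eq_neg_fderiv_mul_of_integrable
    ((cf.mul hg.continuous).integrable_of_hasCompactSupport hc.mul_left)
    ((hf.continuous.mul cg).integrable_of_hasCompactSupport hcd.mul_left)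
    ((hf.continuous.mul hg.continuous).integrable_of_hasCompactSupport hc.mul_left)
    (fun x _ => hf.differentiable (by simp) x) (fun x _ => hg.differentiable (by simp) x)

theorem integral_mul_lap {f g : Euc N → ℝ} (hf : ContDiff ℝ 2 f) (hg : ContDiff ℝ 2 g)
    (hc : HasCompactSupport g) : ∫ x, f x * lap g x = ∫ x, lap f x * g x := by
  simp only [lap, Finset.mul_sum, Finset.sum_mul]
  have h1 : ∀ i : Fin N, ContDiff ℝ 1 (pd i g) := fun i => hg.pd (by norm_num)
  have h2 : ∀ i : Fin N, ContDiff ℝ 1 (pd i f) := fun i => hf.pd (by norm_num)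
  have hcd : ∀ i, HasCompactSupport (pd i g) := fun i =>
    hc.of_isClosed_subset (isClosed_tsupport _) (pd_tsupport i g)
  have hcdd : ∀ i, HasCompactSupport (pd i (pd i g)) := fun i =>
    (hcd i).of_isClosed_subset (isClosed_tsupport _) (pd_tsupport i _)
  rw [integral_finsetSum, integral_finsetSum]
  · refine Finset.sum_congr rfl fun i _ => ?_
    rw [integral_mul_pd (hf.of_le (by norm_num)) (h1 i) (hcd i),
      integral_mul_pd (h2 i) (hg.of_le (by norm_num)) hc, neg_neg]
  · intro i _
    exact ((((h2 i).pd (m := 0) (by norm_num)).continuous).mul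
      hg.continuous).integrable_of_hasCompactSupport hc.mul_left
  · intro i _
    exact (hf.continuous.mul ((h1 i).pd (m := 0) (by norm_num)).continuous
      ).integrable_of_hasCompactSupport (hcdd i).mul_left

/-- `-Δ w = g` in `Ω` in the sense of distributions. -/
def WeakPair (Ω : Set (Euc N)) (w g : Euc N → ℝ) : Prop :=
  ∀ ψ, IsTest Ω ψ → ∫ x, w x * -lap ψ x = ∫ x, g x * ψ x

theorem ContDiffOn.weakPair {Ω : Set (Euc N)} (hΩ : IsOpen Ω) {w : Euc N → ℝ}
    (hw : ContDiffOn ℝ 2 w Ω) : WeakPair Ω w (fun x => -lap w x) := by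
  intro ψ hψ
  obtain ⟨χ, hχ, h1, -⟩ := exists_cutoff hΩ hψ.compact.isCompact hψ.sub
  have hc : ContDiff ℝ 2 fun x => w x * χ x := by
    rw [contDiff_iff_contDiffAt]
    intro x
    by_cases hx : x ∈ Ω
    · exact (hw.contDiffAt (hΩ.mem_nhds hx)).mul (hχ.contDiffAt x)
    · have h0 : (fun x => w x * χ x) =ᶠ[𝓝 x] fun _ => 0 := by
        filter_upwards [(isClosed_tsupport χ).isOpen_compl.mem_nhds fun h => hx (hχ.sub h)]
          with y hy
        simp [image_eq_zero_of_notMem_tsupport hy]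
      exact contDiffAt_const.congr_of_eventuallyEq h0
  have h := integral_mul_lap hc (hψ.smooth.of_le two_le_infty) hψ.compact
  simp only [mul_neg, neg_mul, integral_neg, neg_inj]
  have hev : ∀ x ∈ tsupport ψ, (fun x => w x * χ x) =ᶠ[𝓝 x] w := fun x hx => by
    filter_upwards [h1.filter_mono (nhds_le_nhdsSet hx)] with y hy
    simp [hy]
  rw [show (fun x => w x * lap ψ x) = fun x => w x * χ x * lap ψ x from ?_, h]
  · refine integral_congr_ae (ae_of_all _ fun x => ?_)
    by_cases hx : x ∈ tsupport ψ
    · simp only [lap_congr (hev x hx)]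
    · simp [image_eq_zero_of_notMem_tsupport hx]
  · funext x
    by_cases hx : x ∈ tsupport ψ
    · rw [(hev x hx).eq_of_nhds]
    · simp [lap_eq_zero_of_notMem_tsupport hx]

namespace WeakPair

variable {Ω : Set (Euc N)} {w g w' g' : Euc N → ℝ}

theorem const_mul (h : WeakPair Ω w g) (c : ℝ) :
    WeakPair Ω (fun x => c * w x) (fun x => c * g x) := fun ψ hψ => by
  simp only [mul_assoc, integral_const_mul, h ψ hψ]

theorem sub (hΩ : IsOpen Ω) (h : WeakPair Ω w g) (h' : WeakPair Ω w' g')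
    (hw : ContinuousOn w Ω) (hg : ContinuousOn g Ω)
    (hw' : ContinuousOn w' Ω) (hg' : ContinuousOn g' Ω) :
    WeakPair Ω (fun x => w x - w' x) (fun x => g x - g' x) := fun ψ hψ => by
  simp only [sub_mul]
  rw [integral_sub (integrable_mul_test hΩ hw hψ.lap.neg) (integrable_mul_test hΩ hw' hψ.lap.neg),
    integral_sub (integrable_mul_test hΩ hg hψ) (integrable_mul_test hΩ hg' hψ), h ψ hψ, h' ψ hψ]

end WeakPair

end

section

variable {N : ℕ}

theorem pd_comp_sub_smul {i : Fin N} {f : Euc N → ℝ} (x : Euc N) (t : ℝ) {z : Euc N}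
    (hf : DifferentiableAt ℝ f (x - t • z)) :
    pd i (fun z => f (x - t • z)) z = -t * pd i f (x - t • z) := by
  have h1 : HasFDerivAt (fun z : Euc N => x - t • z) (-(t • ContinuousLinearMap.id ℝ (Euc N))) z :=
    ((hasFDerivAt_id z).const_smul t).const_sub x
  have := (hf.hasFDerivAt.comp z h1).fderiv
  simp only [pd]
  change fderiv ℝ (f ∘ fun z => x - t • z) z _ = _
  rw [this]
  simp

theorem lap_comp_sub {f : Euc N → ℝ} (hf : ContDiff ℝ 2 f) (x y : Euc N) :
    lap (fun y => f (x - y)) y = lap f (x - y) := by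
  have h : ∀ {g : Euc N → ℝ} (i : Fin N), Differentiable ℝ g →
      pd i (fun y => g (x - y)) = fun y => -pd i g (x - y) := fun i hg => by
    funext y
    simpa using pd_comp_sub_smul (i := i) x 1 (z := y) (hg _)
  refine Finset.sum_congr rfl fun i _ => ?_
  have hp : ContDiff ℝ 1 (pd i f) := hf.pd (by norm_num)
  rw [h i (hf.differentiable (by simp))]
  have e : (fun y => -pd i f (x - y)) = fun y => (fun z => -pd i f z) (x - y) := rfl
  rw [e, h i (hp.neg.differentiable (by simp))]
  have := pd_const_mul (i := i) (f := pd i f) (x := x - y) (-1) (hp.differentiable (by simp) _)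
  simp only [neg_mul, one_mul] at this
  simp [this]

/-- A mollifier `ρ` together with a radial potential `F` satisfying `∇F(z) = -ρ(z) z`. -/
structure IsKern (ρ F : Euc N → ℝ) : Prop where
  smooth : ContDiff ℝ ∞ ρ
  smooth' : ContDiff ℝ ∞ F
  nonneg : ∀ z, 0 ≤ ρ z
  nonneg' : ∀ z, 0 ≤ F z
  supp : ∀ z, 1 ≤ ‖z‖ → ρ z = 0
  supp' : ∀ z, 1 ≤ ‖z‖ → F z = 0
  int_eq : ∫ z, ρ z = 1
  int_pos : 0 < ∫ z, F z
  pd_eq : ∀ i z, pd i F z = -(z i) * ρ z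

theorem hasCompactSupport_of_norm {f : Euc N → ℝ} (h : ∀ z, 1 ≤ ‖z‖ → f z = 0) :
    HasCompactSupport f :=
  HasCompactSupport.of_support_subset_isCompact (isCompact_closedBall 0 1) fun z hz => by
    by_contra h'
    exact hz (h z (by simpa using (not_le.1 (by simpa using h')).le))

theorem deriv_smoothTransition_of_nonpos {t : ℝ} (ht : t ≤ 0) :
    deriv Real.smoothTransition t = 0 := by
  have : IsLocalMin Real.smoothTransition t :=
    Eventually.of_forall fun s => by
      rw [Real.smoothTransition.zero_of_nonpos ht]; exact Real.smoothTransition.nonneg s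
  exact this.deriv_eq_zero

theorem contDiff_deriv_infty {p : ℝ → ℝ} (hp : ContDiff ℝ ∞ p) : ContDiff ℝ ∞ (deriv p) := by
  have : ContDiff ℝ ((⊤ : ℕ∞) + 1 : WithTop ℕ∞) p := by simpa using hp
  exact (contDiff_succ_iff_deriv.1 this).2.2

theorem exists_kern [NeZero N] : ∃ ρ F : Euc N → ℝ, IsKern ρ F := by
  set S := Real.smoothTransition
  have hS : ContDiff ℝ ∞ S := Real.smoothTransition.contDiff
  have hS' : ContDiff ℝ ∞ (deriv S) := contDiff_deriv_infty hS
  have hq : ContDiff ℝ ∞ fun z : Euc N => 1 - ‖z‖ ^ 2 := contDiff_const.sub (contDiff_norm_sq ℝ)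
  set F0 : Euc N → ℝ := fun z => S (1 - ‖z‖ ^ 2)
  set ρ0 : Euc N → ℝ := fun z => 2 * deriv S (1 - ‖z‖ ^ 2)
  have hF0 : ContDiff ℝ ∞ F0 := hS.comp hq
  have hρ0 : ContDiff ℝ ∞ ρ0 := contDiff_const.mul (hS'.comp hq)
  have n0 : ∀ z, 0 ≤ ρ0 z := fun z =>
    mul_nonneg zero_le_two Real.smoothTransition.monotone.deriv_nonneg
  have n0' : ∀ z, 0 ≤ F0 z := fun z => Real.smoothTransition.nonneg _
  have s0 : ∀ z : Euc N, 1 ≤ ‖z‖ → ρ0 z = 0 := fun z hz => by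
    have : 1 - ‖z‖ ^ 2 ≤ 0 := by nlinarith
    simp only [ρ0, S, deriv_smoothTransition_of_nonpos this, mul_zero]
  have s0' : ∀ z : Euc N, 1 ≤ ‖z‖ → F0 z = 0 := fun z hz =>
    Real.smoothTransition.zero_of_nonpos (by nlinarith)
  have c0 := hasCompactSupport_of_norm s0
  have c0' := hasCompactSupport_of_norm s0'
  have p0 : 0 < ∫ z, ρ0 z := by
    obtain ⟨t, ht, hd⟩ := exists_deriv_eq_slope S zero_lt_one hS.continuous.continuousOn
      ((hS.differentiable (by simp)).differentiableOn)
    have h1 : deriv S t = 1 := by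
      rw [hd]
      simp [S, Real.smoothTransition.zero, Real.smoothTransition.one]
    obtain ⟨z, hz⟩ := exists_norm_eq (Euc N) (Real.sqrt_nonneg (1 - t))
    refine hρ0.continuous.integral_pos_of_hasCompactSupport_nonneg_nonzero c0 n0 (x := z) ?_
    simp only [ρ0]
    rw [hz, Real.sq_sqrt (by linarith [ht.2])]
    simp [h1]
  have p0' : 0 < ∫ z, F0 z := by
    refine hF0.continuous.integral_pos_of_hasCompactSupport_nonneg_nonzero c0' n0' (x := 0) ?_
    simp [F0, S, Real.smoothTransition.one]
  have d0 : ∀ i z, pd i F0 z = -(z i) * ρ0 z := fun i z => by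
    have h := pd_comp (i := i) (p := S) (f := fun z : Euc N => 1 - ‖z‖ ^ 2) (x := z)
      (hS.differentiable (by simp) _) (hq.differentiable (by simp) _)
    have h2 : pd i (fun z : Euc N => 1 - ‖z‖ ^ 2) z = -2 * z i := by
      have := ((hasStrictFDerivAt_norm_sq z).hasFDerivAt.const_sub 1).fderiv
      simp only [pd]
      rw [this]
      simp [EuclideanSpace.inner_single_right]
    simp only [F0, ρ0]
    rw [h, h2]
    ring
  refine ⟨fun z => (∫ z, ρ0 z)⁻¹ * ρ0 z, fun z => (∫ z, ρ0 z)⁻¹ * F0 z,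
    contDiff_const.mul hρ0, contDiff_const.mul hF0,
    fun z => mul_nonneg (inv_nonneg.2 p0.le) (n0 z), fun z => mul_nonneg (inv_nonneg.2 p0.le) (n0' z),
    fun z hz => by simp [s0 z hz], fun z hz => by simp [s0' z hz], ?_, ?_, ?_⟩
  · rw [integral_const_mul, inv_mul_cancel₀ p0.ne']
  · rw [integral_const_mul]
    exact mul_pos (inv_pos.2 p0) p0'
  · intro i z
    rw [pd_const_mul _ (hF0.differentiable (by simp) _), d0]
    ring

/-- The rescaled mollifier. -/
def mkern (ρ : Euc N → ℝ) (τ : ℝ) (y : Euc N) : ℝ := (τ ^ N)⁻¹ * ρ (τ⁻¹ • y)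

/-- Mollification at scale `τ`. -/
def moll (ρ : Euc N → ℝ) (τ : ℝ) (f : Euc N → ℝ) (x : Euc N) : ℝ := ∫ y, f y * mkern ρ τ (x - y)

theorem moll_eq (ρ : Euc N → ℝ) {τ : ℝ} (hτ : 0 < τ) (f : Euc N → ℝ) (x : Euc N) :
    moll ρ τ f x = ∫ z, ρ z * f (x - τ • z) := by
  have h1 := integral_sub_left_eq_self (fun y => f y * mkern ρ τ (x - y)) volume x
  have h2 := Measure.integral_comp_smul volume (fun y => f (x - y) * mkern ρ τ y) τ
  simp only [sub_sub_cancel] at h1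
  rw [moll, ← h1]
  have hp : (0:ℝ) < τ ^ N := pow_pos hτ N
  rw [finrank_euclideanSpace, Fintype.card_fin, abs_of_pos (inv_pos.2 hp), smul_eq_mul] at h2
  have h3 : ∫ y, f (x - y) * mkern ρ τ y = τ ^ N * ∫ z, f (x - τ • z) * mkern ρ τ (τ • z) := by
    rw [h2, mul_inv_cancel_left₀ hp.ne']
  rw [h3, ← integral_const_mul]
  refine integral_congr_ae (ae_of_all _ fun z => ?_)
  simp only [mkern, smul_smul, inv_mul_cancel₀ hτ.ne', one_smul]
  field_simp

namespace IsKern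

variable {ρ F : Euc N → ℝ} {τ : ℝ} {f : Euc N → ℝ}

theorem compact (h : IsKern ρ F) : HasCompactSupport ρ := hasCompactSupport_of_norm h.supp

theorem compact' (h : IsKern ρ F) : HasCompactSupport F := hasCompactSupport_of_norm h.supp'

theorem integrable (h : IsKern ρ F) : Integrable ρ :=
  h.smooth.continuous.integrable_of_hasCompactSupport h.compact

theorem integrable' (h : IsKern ρ F) : Integrable F :=
  h.smooth'.continuous.integrable_of_hasCompactSupport h.compact'

theorem mkern_smooth (h : IsKern ρ F) (τ : ℝ) : ContDiff ℝ ∞ (mkern ρ τ) :=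
  contDiff_const.mul (h.smooth.comp (contDiff_const_smul _))

theorem mkern_nonneg (h : IsKern ρ F) (hτ : 0 < τ) (y : Euc N) : 0 ≤ mkern ρ τ y :=
  mul_nonneg (inv_nonneg.2 (pow_nonneg hτ.le _)) (h.nonneg _)

theorem mkern_supp (h : IsKern ρ F) (hτ : 0 < τ) {y : Euc N} (hy : τ ≤ ‖y‖) : mkern ρ τ y = 0 := by
  rw [mkern, h.supp, mul_zero]
  rw [norm_smul, norm_inv, Real.norm_of_nonneg hτ.le, inv_mul_eq_div, le_div_iff₀ hτ]
  simpa using hy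

theorem mkern_tsupport (h : IsKern ρ F) (hτ : 0 < τ) : tsupport (mkern ρ τ) ⊆ closedBall 0 τ :=
  closure_minimal (fun y hy => by
    by_contra h'
    exact hy (h.mkern_supp hτ (not_le.1 (by simpa using h')).le)) isClosed_closedBall

theorem mkern_compact (h : IsKern ρ F) (hτ : 0 < τ) : HasCompactSupport (mkern ρ τ) :=
  (isCompact_closedBall 0 τ).of_isClosed_subset (isClosed_tsupport _) (h.mkern_tsupport hτ)

theorem mkern_integral (h : IsKern ρ F) (hτ : 0 < τ) (x : Euc N) : ∫ y, mkern ρ τ (x - y) = 1 := by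
  have := moll_eq ρ hτ (fun _ => 1) x
  simp only [moll, one_mul, mul_one, h.int_eq] at this
  exact this

theorem mkern_bounded (h : IsKern ρ F) (τ : ℝ) (hτ : 0 < τ) : ∃ C, 0 ≤ C ∧ ∀ y, mkern ρ τ y ≤ C := by
  obtain ⟨C, hC⟩ := (h.mkern_smooth τ).continuous.bounded_above_of_compact_support (h.mkern_compact hτ)
  exact ⟨C, (norm_nonneg _).trans (hC 0), fun y => (le_abs_self _).trans (hC y)⟩

theorem moll_smooth (h : IsKern ρ F) (hτ : 0 < τ) (hf : LocallyIntegrable f) :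
    ContDiff ℝ ∞ (moll ρ τ f) :=
  (h.mkern_compact hτ).contDiff_convolution_right (ContinuousLinearMap.mul ℝ ℝ) hf (h.mkern_smooth τ)

theorem pd_conv {g : Euc N → ℝ} (hf : LocallyIntegrable f) (hg : ContDiff ℝ 1 g)
    (hc : HasCompactSupport g) (i : Fin N) (x : Euc N) :
    pd i (fun x => ∫ y, f y * g (x - y)) x = ∫ y, f y * pd i g (x - y) := by
  have := (hc.hasFDerivAt_convolution_right (ContinuousLinearMap.mul ℝ ℝ) hf hg x).fderiv
  change fderiv ℝ (convolution f g (ContinuousLinearMap.mul ℝ ℝ) volume) x _ = _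
  rw [this, convolution_precompR_apply _ hf (hc.fderiv ℝ) (hg.continuous_fderiv one_ne_zero)]
  rfl

theorem lap_moll (h : IsKern ρ F) (hτ : 0 < τ) (hf : LocallyIntegrable f) (x : Euc N) :
    lap (moll ρ τ f) x = ∫ y, f y * lap (mkern ρ τ) (x - y) := by
  have hs := h.mkern_smooth τ
  have hc := h.mkern_compact hτ
  have h1 : ∀ i : Fin N, ContDiff ℝ ∞ (pd i (mkern ρ τ)) := fun i => hs.pd (by simp)
  have hcd : ∀ i : Fin N, HasCompactSupport (pd i (mkern ρ τ)) := fun i =>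
    hc.of_isClosed_subset (isClosed_tsupport _) (pd_tsupport i _)
  have hcdd : ∀ i : Fin N, HasCompactSupport (pd i (pd i (mkern ρ τ))) := fun i =>
    (hcd i).of_isClosed_subset (isClosed_tsupport _) (pd_tsupport i _)
  simp only [lap, Finset.mul_sum]
  rw [integral_finsetSum]
  · refine Finset.sum_congr rfl fun i _ => ?_
    have e : pd i (moll ρ τ f) = fun x => ∫ y, f y * pd i (mkern ρ τ) (x - y) :=
      funext fun x => pd_conv hf (hs.of_le (by exact_mod_cast le_top)) hc i x
    rw [e, pd_conv hf ((h1 i).of_le (by exact_mod_cast le_top)) (hcd i)]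
  · intro i _
    exact (hcdd i).convolutionExists_right (ContinuousLinearMap.mul ℝ ℝ) hf
      (((h1 i).pd (m := ∞) (by simp)).continuous) x

theorem moll_nonneg (h : IsKern ρ F) (hτ : 0 < τ) (hf : ∀ x, 0 ≤ f x) (x : Euc N) :
    0 ≤ moll ρ τ f x :=
  integral_nonneg fun _ => mul_nonneg (hf _) (h.mkern_nonneg hτ _)

theorem moll_abs_le (h : IsKern ρ F) (hτ : 0 < τ) {C : ℝ} (hf : ∀ x, |f x| ≤ C) (x : Euc N) :
    |moll ρ τ f x| ≤ C := by
  rw [moll_eq ρ hτ]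
  have := norm_integral_le_of_norm_le (f := fun z => ρ z * f (x - τ • z)) (h.integrable.mul_const C)
    (ae_of_all _ fun z => by
      rw [norm_mul, Real.norm_of_nonneg (h.nonneg z)]
      exact mul_le_mul_of_nonneg_left (hf _) (h.nonneg z))
  simpa [integral_mul_const, h.int_eq] using this

theorem moll_eq_zero (h : IsKern ρ F) (hτ : 0 < τ) {T : Set (Euc N)} (hf : ∀ x ∉ T, f x = 0)
    {x : Euc N} (hx : x ∉ cthickening τ T) : moll ρ τ f x = 0 := by
  refine integral_eq_zero_of_ae (ae_of_all _ fun y => ?_)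
  by_cases hy : y ∈ T
  · have : τ ≤ ‖x - y‖ := by
      by_contra hlt
      exact hx (mem_cthickening_of_dist_le x y τ T hy (by rw [dist_eq_norm]; exact (not_le.1 hlt).le))
    simp [h.mkern_supp hτ this]
  · simp [hf y hy]

theorem moll_tsupport (h : IsKern ρ F) (hτ : 0 < τ) {T : Set (Euc N)} (hf : ∀ x ∉ T, f x = 0) :
    tsupport (moll ρ τ f) ⊆ cthickening τ T :=
  closure_minimal (fun _ hx => by_contra fun h' => hx (h.moll_eq_zero hτ hf h'))
    isClosed_cthickening

theorem moll_test (h : IsKern ρ F) (hτ : 0 < τ) {Ω T : Set (Euc N)} (hT : IsCompact T)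
    (hf : ∀ x ∉ T, f x = 0) (hi : LocallyIntegrable f) (hΩ : cthickening τ T ⊆ Ω) :
    IsTest Ω (moll ρ τ f) where
  smooth := h.moll_smooth hτ hi
  compact := hT.cthickening.of_isClosed_subset (isClosed_tsupport _) (h.moll_tsupport hτ hf)
  sub := (h.moll_tsupport hτ hf).trans hΩ

theorem moll_sub_le (h : IsKern ρ F) (hτ : 0 < τ) (hf : Continuous f) {δ : ℝ}
    (x : Euc N) (hd : ∀ y, dist x y ≤ τ → |f y - f x| ≤ δ) : |moll ρ τ f x - f x| ≤ δ := by
  have hi : Integrable fun z => ρ z * f (x - τ • z) :=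
    (h.smooth.continuous.mul (hf.comp (by fun_prop))).integrable_of_hasCompactSupport
      h.compact.mul_right
  have e : moll ρ τ f x - f x = ∫ z, ρ z * (f (x - τ • z) - f x) := by
    simp only [mul_sub]
    rw [integral_sub hi (h.integrable.mul_const _), integral_mul_const, h.int_eq, moll_eq ρ hτ,
      one_mul]
  rw [e]
  have := norm_integral_le_of_norm_le (f := fun z => ρ z * (f (x - τ • z) - f x))
    (h.integrable.mul_const δ) (ae_of_all _ fun z => by
      rw [norm_mul, Real.norm_of_nonneg (h.nonneg z)]
      by_cases hz : 1 ≤ ‖z‖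
      · simp [h.supp z hz]
      · refine mul_le_mul_of_nonneg_left (hd _ ?_) (h.nonneg z)
        rw [dist_eq_norm, sub_sub_cancel, norm_smul, Real.norm_of_nonneg hτ.le]
        exact mul_le_of_le_one_right hτ.le (not_le.1 hz).le)
  simpa [integral_mul_const, h.int_eq] using this

theorem moll_tendsto_ae (h : IsKern ρ F) (hf : LocallyIntegrable f) :
    ∀ᵐ x, Tendsto (fun τ => moll ρ τ f x) (𝓝[>] 0) (𝓝 (f x)) := by
  obtain ⟨C, hC⟩ := h.smooth.continuous.bounded_above_of_compact_support h.compact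
  filter_upwards [(Besicovitch.vitaliFamily volume).ae_tendsto_average_norm_sub hf] with x h0
  have h1 := h0.comp (Besicovitch.tendsto_filterAt volume x)
  have key := tendsto_integral_smul_of_tendsto_average_norm_sub
    (g := fun τ y => mkern ρ τ (x - y)) (C * volume.real (ball (0 : Euc N) 1)) h1
  simp only [smul_eq_mul] at key
  simp only [moll, mul_comm (f _)]
  refine key ?_ ?_ ?_ ?_
  · exact Eventually.of_forall fun i => hf.integrableOn_isCompact (isCompact_closedBall _ _)
  · refine tendsto_const_nhds.congr' ?_
    filter_upwards [self_mem_nhdsWithin] with τ hτ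
    exact (h.mkern_integral hτ x).symm
  · filter_upwards [self_mem_nhdsWithin] with τ hτ
    intro y hy
    by_contra h'
    rw [mem_closedBall, dist_comm, dist_eq_norm, not_le] at h'
    exact hy (h.mkern_supp hτ h'.le)
  · filter_upwards [self_mem_nhdsWithin] with τ hτ
    have hτ : 0 < τ := hτ
    intro y
    rw [Measure.addHaar_real_closedBall _ _ hτ.le, finrank_euclideanSpace, Fintype.card_fin,
      abs_of_nonneg (h.mkern_nonneg hτ _), mkern]
    have hb : 0 < volume.real (ball (0 : Euc N) 1) :=
      ENNReal.toReal_pos (measure_ball_pos _ _ one_pos).ne' measure_ball_lt_top.ne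
    rw [mul_div_mul_right _ _ hb.ne', inv_mul_eq_div]
    exact div_le_div_of_nonneg_right ((le_abs_self _).trans (hC _)) (pow_nonneg hτ.le _)

theorem moll_le (h : IsKern ρ F) (hτ : 0 < τ) :
    ∃ C, 0 ≤ C ∧ ∀ f : Euc N → ℝ, (∀ x, 0 ≤ f x) → Integrable f → ∀ x,
      moll ρ τ f x ≤ C * ∫ y, f y := by
  obtain ⟨C, hC0, hC⟩ := h.mkern_bounded τ hτ
  refine ⟨C, hC0, fun f hf hi x => ?_⟩
  rw [← integral_const_mul]
  refine integral_mono_of_nonneg (ae_of_all _ fun y => mul_nonneg (hf _) (h.mkern_nonneg hτ _))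
    (hi.const_mul C) (ae_of_all _ fun y => ?_)
  simp only [mul_comm C]
  exact mul_le_mul_of_nonneg_left (hC _) (hf y)

end IsKern

end

section

variable {N : ℕ}

theorem fderiv_eq_sum_pd (f : Euc N → ℝ) (x v : Euc N) :
    fderiv ℝ f x v = ∑ i, v i * pd i f x := by
  have hv : v = ∑ i, v i • EuclideanSpace.single i (1:ℝ) := by
    have := (EuclideanSpace.basisFun (Fin N) ℝ).sum_repr v
    simpa using this.symm
  conv_lhs => rw [hv]
  simp [map_sum, pd]

namespace IsKern

variable {ρ F : Euc N → ℝ} {η : ℝ} {ψ : Euc N → ℝ}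

theorem hasDerivAt_mean (h : IsKern ρ F) (hs : ContDiff ℝ ∞ ψ) (hc : HasCompactSupport ψ)
    (x : Euc N) (t : ℝ) :
    HasDerivAt (fun t : ℝ => ∫ z, ρ z * ψ (x - t • z)) (t * ∫ z, F z * lap ψ (x - t • z)) t := by
  have hd : Differentiable ℝ ψ := hs.differentiable (by simp)
  have cfd : Continuous (fderiv ℝ ψ) := hs.continuous_fderiv (by simp)
  obtain ⟨C, hC⟩ := cfd.bounded_above_of_compact_support (hc.fderiv ℝ)
  have cpd : ∀ i, Continuous (pd i ψ) := fun i => (hs.pd (m := ∞) (by simp)).continuous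
  have key := hasDerivAt_integral_of_dominated_loc_of_deriv_le (μ := (volume : Measure (Euc N)))
    (F := fun (t : ℝ) z => ρ z * ψ (x - t • z))
    (F' := fun (t : ℝ) z => ρ z * fderiv ℝ ψ (x - t • z) (-z))
    (bound := fun z => ρ z * C) (x₀ := t) (s := univ) univ_mem ?_ ?_ ?_ ?_ ?_ ?_
  · refine key.2.congr_deriv (Eq.symm ?_)
    have hi : ∀ z, ρ z * fderiv ℝ ψ (x - t • z) (-z) = ∑ i, pd i F z * pd i ψ (x - t • z) := by
      intro z
      rw [fderiv_eq_sum_pd, Finset.mul_sum]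
      refine Finset.sum_congr rfl fun i _ => ?_
      rw [h.pd_eq]
      simp only [PiLp.neg_apply]
      ring
    refine Eq.trans ?_ (integral_congr_ae (ae_of_all _ hi)).symm
    have cF : ∀ i, Continuous (pd i F) := fun i => (h.smooth'.pd (m := ∞) (by simp)).continuous
    have csF : ∀ i, HasCompactSupport (pd i F) := fun i =>
      h.compact'.of_isClosed_subset (isClosed_tsupport _) (pd_tsupport i F)
    have csub : Continuous fun z : Euc N => x - t • z := by fun_prop
    have hInt : ∀ i ∈ Finset.univ, Integrable (fun a => pd i F a * pd i ψ (x - t • a)) :=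
      fun i _ =>
        ((cF i).mul ((cpd i).comp csub)).integrable_of_hasCompactSupport (csF i).mul_right
    rw [integral_finsetSum _ hInt]
    simp only [lap, Finset.mul_sum]
    rw [integral_finsetSum, Finset.mul_sum]
    · refine Finset.sum_congr rfl fun i _ => ?_
      have h1 : ContDiff ℝ 1 (fun z => pd i ψ (x - t • z)) :=
        ((hs.pd (m := ∞) (by simp)).of_le (by exact_mod_cast le_top)).comp (by fun_prop)
      have h2 := integral_mul_pd h1 (h.smooth'.of_le (by exact_mod_cast le_top)) h.compact' i
      simp only [mul_comm (pd i F _)]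
      rw [h2]
      rw [← integral_const_mul, ← integral_neg]
      refine integral_congr_ae (ae_of_all _ fun z => ?_)
      simp only
      rw [pd_comp_sub_smul x t ((hs.pd (m := ∞) (by simp)).differentiable
        (by simp) _)]
      ring
    · intro i _
      exact (h.smooth'.continuous.mul (((hs.pd (m := ∞) (by simp)).pd (m := ∞)
        (by simp)).continuous.comp csub)).integrable_of_hasCompactSupport h.compact'.mul_right
  · refine Eventually.of_forall fun s => Continuous.aestronglyMeasurable ?_
    exact h.smooth.continuous.mul (hs.continuous.comp (by fun_prop))
  · exact (h.smooth.continuous.mul (hs.continuous.comp (by fun_prop))).integrable_of_hasCompactSupport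
      h.compact.mul_right
  · refine Continuous.aestronglyMeasurable ?_
    exact h.smooth.continuous.mul
      ((cfd.comp (by fun_prop : Continuous fun z : Euc N => x - t • z)).clm_apply continuous_neg)
  · refine ae_of_all _ fun z s _ => ?_
    rw [norm_mul, Real.norm_of_nonneg (h.nonneg z)]
    by_cases hz : 1 ≤ ‖z‖
    · simp [h.supp z hz]
    · refine mul_le_mul_of_nonneg_left ?_ (h.nonneg z)
      refine (ContinuousLinearMap.le_opNorm _ _).trans ?_
      rw [norm_neg]
      exact (mul_le_of_le_one_right (norm_nonneg _) (not_le.1 hz).le).trans (hC _)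
  · exact h.integrable.mul_const C
  · refine ae_of_all _ fun z s _ => ?_
    have h1 : HasDerivAt (fun s : ℝ => x - s • z) (-z) s := by
      simpa using ((hasDerivAt_id s).smul_const z).const_sub x
    exact ((hd _).hasFDerivAt.comp_hasDerivAt s h1).const_mul (ρ z)

theorem continuous_mean (h : IsKern ρ F) {g : Euc N → ℝ} (hg : Continuous g) (x : Euc N) :
    Continuous fun t : ℝ => t * ∫ z, F z * g (x - t • z) := by
  have e : ∀ t : ℝ, ∫ z, F z * g (x - t • z) = ∫ z in closedBall 0 1, F z * g (x - t • z) :=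
    fun t => (setIntegral_eq_integral_of_forall_compl_eq_zero fun z hz => by
      rw [h.supp' z (not_le.1 (by simpa using hz)).le, zero_mul]).symm
  simp only [e]
  refine continuous_id.mul (continuous_parametric_integral_of_continuous ?_
    (isCompact_closedBall 0 1))
  exact (h.smooth'.continuous.comp continuous_snd).mul (hg.comp (by fun_prop))

theorem sub_moll_eq (h : IsKern ρ F) (hη : 0 < η) (hs : ContDiff ℝ ∞ ψ)
    (hc : HasCompactSupport ψ) (x : Euc N) :
    ψ x - moll ρ η ψ x = ∫ t in (0:ℝ)..η, t * ∫ z, F z * -lap ψ (x - t • z) := by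
  have := intervalIntegral.integral_eq_sub_of_hasDerivAt (a := 0) (b := η)
    (fun t _ => h.hasDerivAt_mean hs hc x t)
    ((h.continuous_mean hs.lap.continuous x).intervalIntegrable _ _)
  simp only [mul_neg, integral_neg, intervalIntegral.integral_neg, this, moll_eq ρ hη]
  simp [integral_mul_const, h.int_eq]

theorem exists_potential (h : IsKern ρ F) (hη : 0 < η) :
    ∃ κ : Measure (Euc N), IsFiniteMeasure κ ∧ 0 < κ.real univ ∧ κ (closedBall 0 η)ᶜ = 0 ∧
      ∀ ψ, ContDiff ℝ ∞ ψ → HasCompactSupport ψ → ∀ x,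
        ψ x - moll ρ η ψ x = ∫ y, -lap ψ (x - y) ∂κ := by
  set ν₁ : Measure ℝ := (volume.restrict (Ioc 0 η)).withDensity fun t => ENNReal.ofReal t
  set ν₂ : Measure (Euc N) := volume.withDensity fun z => ENNReal.ofReal (F z)
  have mF : Measurable fun z => ENNReal.ofReal (F z) :=
    h.smooth'.continuous.measurable.ennreal_ofReal
  have fin1 : IsFiniteMeasure ν₁ := by
    refine isFiniteMeasure_withDensity_ofReal ?_
    exact ((continuous_id.integrableOn_Icc (a := (0:ℝ)) (b := η)).mono_set
      Ioc_subset_Icc_self).2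
  have fin2 : IsFiniteMeasure ν₂ := isFiniteMeasure_withDensity_ofReal h.integrable'.2
  have mm : Measurable fun p : ℝ × Euc N => p.1 • p.2 := by fun_prop
  set κ : Measure (Euc N) := (ν₁.prod ν₂).map fun p => p.1 • p.2
  have n1 : ν₁ univ ≠ 0 := by
    intro h0
    rw [Measure.measure_univ_eq_zero, withDensity_eq_zero_iff (by fun_prop)] at h0
    have h1 : ∀ᵐ t ∂(volume.restrict (Ioc 0 η)), False := by
      filter_upwards [h0, ae_restrict_mem measurableSet_Ioc] with t ht ht'
      simp only [Pi.zero_apply, ENNReal.ofReal_eq_zero] at ht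
      exact absurd ht'.1 (not_lt.2 ht)
    have := ae_iff.1 h1
    simp at this
    linarith
  have n2 : ν₂ univ ≠ 0 := by
    intro h0
    rw [Measure.measure_univ_eq_zero, withDensity_eq_zero_iff mF.aemeasurable] at h0
    have : ∫ z, F z = 0 := integral_eq_zero_of_ae (by
      filter_upwards [h0] with z hz
      simp only [Pi.zero_apply, ENNReal.ofReal_eq_zero] at hz
      exact le_antisymm hz (h.nonneg' z))
    exact h.int_pos.ne' this
  have ku : κ univ = ν₁ univ * ν₂ univ := by
    rw [Measure.map_apply mm MeasurableSet.univ, preimage_univ, ← univ_prod_univ,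
      Measure.prod_prod]
  have fin : IsFiniteMeasure κ := inferInstance
  refine ⟨κ, fin, ENNReal.toReal_pos (by rw [ku]; exact mul_ne_zero n1 n2) (measure_ne_top _ _),
    ?_, ?_⟩
  · rw [Measure.map_apply mm isClosed_closedBall.measurableSet.compl]
    have hsub : (fun p : ℝ × Euc N => p.1 • p.2) ⁻¹' (closedBall 0 η)ᶜ ⊆
        (Ioc 0 η)ᶜ ×ˢ univ ∪ univ ×ˢ (closedBall 0 1)ᶜ := by
      rintro ⟨t, z⟩ hp
      by_contra hn
      simp only [mem_union, mem_prod, mem_compl_iff, mem_univ, and_true, true_and, not_or,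
        not_not, mem_closedBall, dist_zero_right] at hn
      apply hp
      simp only [mem_closedBall, dist_zero_right, norm_smul, Real.norm_of_nonneg hn.1.1.le]
      calc t * ‖z‖ ≤ η * 1 := mul_le_mul hn.1.2 hn.2 (norm_nonneg _) hη.le
        _ = η := mul_one η
    refine measure_mono_null hsub (measure_union_null ?_ ?_)
    · rw [Measure.prod_prod]
      have : ν₁ (Ioc 0 η)ᶜ = 0 :=
        withDensity_absolutelyContinuous _ _ (by
          rw [Measure.restrict_apply measurableSet_Ioc.compl]; simp)
      rw [this, zero_mul]
    · rw [Measure.prod_prod]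
      have : ν₂ (closedBall 0 1)ᶜ = 0 := by
        rw [withDensity_apply _ isClosed_closedBall.measurableSet.compl]
        refine (setLIntegral_congr_fun isClosed_closedBall.measurableSet.compl
          fun z hz => ?_).trans lintegral_zero
        rw [h.supp' z (not_le.1 (by simpa using hz)).le]
        simp
      rw [this, mul_zero]
  · intro ψ hs hc x
    have cl : Continuous (lap ψ) := hs.lap.continuous
    obtain ⟨C, hC⟩ := cl.bounded_above_of_compact_support
      (hc.of_isClosed_subset (isClosed_tsupport _) (lap_tsupport ψ))
    have cg : Continuous fun y => -lap ψ (x - y) := (cl.comp (by fun_prop)).neg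
    rw [h.sub_moll_eq hη hs hc, integral_map mm.aemeasurable cg.aestronglyMeasurable]
    rw [integral_prod]
    · rw [integral_withDensity_eq_integral_toReal_smul (by fun_prop)
        (ae_of_all _ fun _ => ENNReal.ofReal_lt_top), intervalIntegral.integral_of_le hη.le]
      refine setIntegral_congr_fun measurableSet_Ioc fun t ht => ?_
      simp only [smul_eq_mul]
      rw [ENNReal.toReal_ofReal ht.1.le, integral_withDensity_eq_integral_toReal_smul mF
        (ae_of_all _ fun _ => ENNReal.ofReal_lt_top)]
      congr 1
      refine integral_congr_ae (ae_of_all _ fun z => ?_)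
      simp [ENNReal.toReal_ofReal (h.nonneg' z)]
    · refine Integrable.of_bound (C := C) ?_ (ae_of_all _ fun p => ?_)
      · exact (cg.comp (by fun_prop : Continuous fun p : ℝ × Euc N => p.1 • p.2)).aestronglyMeasurable
      · simpa using hC _

end IsKern

/-- Convolution with the measure `κ`. -/
def pot (κ : Measure (Euc N)) (f : Euc N → ℝ) (x : Euc N) : ℝ := ∫ y, f (x - y) ∂κ

theorem pot_tsupport {κ : Measure (Euc N)} {f : Euc N → ℝ} {η : ℝ} (hκ : κ (closedBall 0 η)ᶜ = 0) :
    tsupport (pot κ f) ⊆ cthickening η (tsupport f) := by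
  refine closure_minimal (fun x hx => by_contra fun h' => hx ?_) isClosed_cthickening
  refine integral_eq_zero_of_ae ?_
  have : ∀ᵐ y ∂κ, y ∈ closedBall (0 : Euc N) η := by rwa [ae_iff]
  filter_upwards [this] with y hy
  refine image_eq_zero_of_notMem_tsupport fun hm => h' ?_
  refine mem_cthickening_of_dist_le x (x - y) η _ hm ?_
  rw [dist_eq_norm, sub_sub_cancel]
  simpa using hy

section Pot

variable {κ : Measure (Euc N)} [IsFiniteMeasure κ] {f : Euc N → ℝ}

theorem pd_pot (hf : ContDiff ℝ ∞ f) (hc : HasCompactSupport f) (i : Fin N) :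
    pd i (pot κ f) = pot κ (pd i f) := by
  funext x
  have cfd : Continuous (fderiv ℝ f) := hf.continuous_fderiv (by simp)
  obtain ⟨C, hC⟩ := cfd.bounded_above_of_compact_support (hc.fderiv ℝ)
  obtain ⟨B, hB⟩ := hf.continuous.bounded_above_of_compact_support hc
  have cs : Continuous fun y => f (x - y) := hf.continuous.comp (by fun_prop)
  have cs' : Continuous fun y => fderiv ℝ f (x - y) := cfd.comp (by fun_prop)
  have key := hasFDerivAt_integral_of_dominated_of_fderiv_le (μ := κ)
    (F := fun x y => f (x - y)) (F' := fun x y => fderiv ℝ f (x - y)) (bound := fun _ => C)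
    (x₀ := x) (s := univ) univ_mem
    (Eventually.of_forall fun x => (hf.continuous.comp (by fun_prop)).aestronglyMeasurable)
    (Integrable.of_bound cs.aestronglyMeasurable B (ae_of_all _ fun y => hB _))
    cs'.aestronglyMeasurable (ae_of_all _ fun y z _ => hC _) (integrable_const C)
    (ae_of_all _ fun y z _ => by
      have := ((hf.differentiable (by simp)) (z - y)).hasFDerivAt.comp z
        ((hasFDerivAt_id z).sub_const y)
      rwa [ContinuousLinearMap.comp_id] at this)
  have hi : Integrable (fun y => fderiv ℝ f (x - y)) κ :=
    Integrable.of_bound cs'.aestronglyMeasurable C (ae_of_all _ fun y => hC _)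
  simp only [pd]
  change fderiv ℝ (fun x => ∫ y, f (x - y) ∂κ) x _ = _
  rw [key.fderiv, ContinuousLinearMap.integral_apply hi]
  rfl

theorem pot_smooth (hf : ContDiff ℝ ∞ f) (hc : HasCompactSupport f) :
    ContDiff ℝ ∞ (pot κ f) := by
  have := hc.contDiff_convolution_right (μ := κ) (n := ⊤) (ContinuousLinearMap.mul ℝ ℝ)
    (f := fun _ => (1:ℝ)) ((integrable_const 1).locallyIntegrable) hf
  have e : pot κ f = convolution (fun _ => (1:ℝ)) f (ContinuousLinearMap.mul ℝ ℝ) κ := by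
    funext x
    simp [convolution, pot]
  rwa [e]

theorem lap_pot (hf : ContDiff ℝ ∞ f) (hc : HasCompactSupport f) (x : Euc N) :
    lap (pot κ f) x = pot κ (lap f) x := by
  have h1 : ∀ i : Fin N, ContDiff ℝ ∞ (pd i f) := fun i => hf.pd (by simp)
  have hcd : ∀ i, HasCompactSupport (pd i f) := fun i =>
    hc.of_isClosed_subset (isClosed_tsupport _) (pd_tsupport i _)
  simp only [lap, pd_pot hf hc, pd_pot (h1 _) (hcd _), pot]
  rw [integral_finsetSum]
  intro i _
  have c2 : Continuous (pd i (pd i f)) := ((h1 i).pd (m := ∞) (by simp)).continuous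
  obtain ⟨B, hB⟩ := c2.bounded_above_of_compact_support
    ((hcd i).of_isClosed_subset (isClosed_tsupport _) (pd_tsupport i _))
  exact Integrable.of_bound (c2.comp (by fun_prop)).aestronglyMeasurable B
    (ae_of_all _ fun y => hB _)

theorem integral_pot (hf : Integrable f) : ∫ x, pot κ f x = κ.real univ * ∫ x, f x := by
  have := integral_convolution (μ := (volume : Measure (Euc N))) (ν := κ)
    (ContinuousLinearMap.mul ℝ ℝ) (f := fun _ => (1:ℝ)) (g := f) (integrable_const 1) hf
  simpa [convolution, pot] using this

end Pot

/-- For a mollification at scale `η` there is a positive operator `P` with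
`-Δ (P h) = h - moll ρ η h`. -/
theorem IsKern.exists_inverse {ρ F : Euc N → ℝ} (h : IsKern ρ F) {η : ℝ} (hη : 0 < η) :
    ∃ (m : ℝ) (P : (Euc N → ℝ) → Euc N → ℝ), 0 < m ∧
      ∀ {Ω : Set (Euc N)} {f : Euc N → ℝ}, IsTest Ω f → cthickening η (tsupport f) ⊆ Ω →
        IsTest Ω (P f) ∧ (∀ x, -lap (P f) x = f x - moll ρ η f x) ∧
        ((∀ x, 0 ≤ f x) → ∀ x, 0 ≤ P f x) ∧ ∫ x, P f x = m * ∫ x, f x := by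
  obtain ⟨κ, hfin, hpos, hsupp, hk⟩ := h.exists_potential hη
  refine ⟨κ.real univ, pot κ, hpos, fun {Ω f} hf hΩ => ⟨⟨pot_smooth hf.smooth hf.compact, ?_, ?_⟩,
    fun x => ?_, fun h0 x => integral_nonneg fun _ => h0 _, integral_pot hf.integrable⟩⟩
  · exact hf.compact.isCompact.cthickening.of_isClosed_subset (isClosed_tsupport _)
      (pot_tsupport hsupp)
  · exact (pot_tsupport hsupp).trans hΩ
  · rw [hk f hf.smooth hf.compact, lap_pot hf.smooth hf.compact, pot, integral_neg]

end

section

variable {N : ℕ}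

/-- `φ` is a smooth convex approximation of the positive part at scale `ε`. -/
structure IsTrunc (ε : ℝ) (φ : ℝ → ℝ) : Prop where
  pos : 0 < ε
  smooth : ContDiff ℝ ∞ φ
  zero : ∀ t ≤ ε, φ t = 0
  deriv_zero : ∀ t ≤ ε, deriv φ t = 0
  deriv_nonneg : ∀ t, 0 ≤ deriv φ t
  deriv_le_one : ∀ t, deriv φ t ≤ 1
  deriv_one : ∀ t, 2 * ε ≤ t → deriv φ t = 1
  deriv2_nonneg : ∀ t, 0 ≤ deriv (deriv φ) t
  nonneg : ∀ t, 0 ≤ φ t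
  le_self : ∀ t, 0 ≤ t → φ t ≤ t
  sub_le : ∀ t, t - 2 * ε ≤ φ t

theorem exists_trunc {ε : ℝ} (hε : 0 < ε) : ∃ φ, IsTrunc ε φ := by
  have cS : ContDiff ℝ ∞ fun s : ℝ => Real.smoothTransition ((s - ε) / ε) :=
    (Real.smoothTransition.contDiff (n := ⊤)).comp (by fun_prop)
  have hd : ∀ t, HasDerivAt (fun t => ∫ s in (0:ℝ)..t, Real.smoothTransition ((s - ε) / ε))
      (Real.smoothTransition ((t - ε) / ε)) t := fun t =>
    intervalIntegral.integral_hasDerivAt_right (cS.continuous.intervalIntegrable _ _)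
      (cS.continuous.stronglyMeasurableAtFilter _ _) cS.continuous.continuousAt
  set φ : ℝ → ℝ := fun t => ∫ s in (0:ℝ)..t, Real.smoothTransition ((s - ε) / ε) with hφ
  have hder : deriv φ = fun t => Real.smoothTransition ((t - ε) / ε) := funext fun t => (hd t).deriv
  have hdiff : Differentiable ℝ φ := fun t => (hd t).differentiableAt
  have d0 : ∀ t, 0 ≤ deriv φ t := fun t => by rw [hder]; exact Real.smoothTransition.nonneg _
  have d1 : ∀ t, deriv φ t ≤ 1 := fun t => by rw [hder]; exact Real.smoothTransition.le_one _
  have dz : ∀ t ≤ ε, deriv φ t = 0 := fun t ht => by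
    rw [hder]
    exact Real.smoothTransition.zero_of_nonpos (div_nonpos_of_nonpos_of_nonneg (by linarith) hε.le)
  have done : ∀ t, 2 * ε ≤ t → deriv φ t = 1 := fun t ht => by
    rw [hder]
    exact Real.smoothTransition.one_of_one_le ((one_le_div hε).2 (by linarith))
  have z : ∀ t ≤ ε, φ t = 0 := fun t ht => by
    have : ∀ s ∈ uIcc 0 t, Real.smoothTransition ((s - ε) / ε) = 0 := fun s hs => by
      refine Real.smoothTransition.zero_of_nonpos (div_nonpos_of_nonpos_of_nonneg ?_ hε.le)
      have := hs.2
      have : s ≤ ε := this.trans (max_le hε.le ht)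
      linarith
    rw [hφ]
    simp only
    rw [intervalIntegral.integral_congr this]
    simp
  have mono : Monotone φ := monotone_of_deriv_nonneg hdiff d0
  have nn : ∀ t, 0 ≤ φ t := fun t => by
    rcases le_total t ε with h | h
    · exact (z t h).ge
    · rw [← z ε le_rfl]; exact mono h
  have dsub : ∀ t, HasDerivAt (fun t => t - φ t) (1 - deriv φ t) t := fun t =>
    (hasDerivAt_id t).sub (hdiff t).hasDerivAt
  refine ⟨φ, hε, ?_, z, dz, d0, d1, done, ?_, nn, ?_, ?_⟩
  · rw [contDiff_infty_iff_deriv]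
    exact ⟨hdiff, hder ▸ cS⟩
  · intro t
    have : Monotone (deriv φ) := by
      rw [hder]
      intro a b hab
      refine Real.smoothTransition.monotone ?_
      gcongr
    exact this.deriv_nonneg
  · intro t ht
    have : Monotone fun t => t - φ t := monotone_of_deriv_nonneg
      (fun t => (dsub t).differentiableAt) fun t => by
        rw [(dsub t).deriv]; linarith [d1 t]
    have := this ht
    simp only [z 0 hε.le] at this
    linarith
  · intro t
    rcases le_total t (2 * ε) with h | h
    · linarith [nn t]
    · have : AntitoneOn (fun t => t - φ t) (Ici (2 * ε)) := by
        refine antitoneOn_of_deriv_nonpos (convex_Ici _)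
          (continuous_id.sub hdiff.continuous).continuousOn
          (fun t _ => (dsub t).differentiableAt.differentiableWithinAt) fun t ht => ?_
        rw [interior_Ici] at ht
        rw [(dsub t).deriv, done t (le_of_lt ht)]
        simp
      have := this self_mem_Ici h h
      simp only at this
      linarith [nn (2 * ε)]

theorem IsTrunc.continuous_deriv {ε : ℝ} {φ : ℝ → ℝ} (h : IsTrunc ε φ) : Continuous (deriv φ) :=
  (contDiff_deriv_infty h.smooth).continuous

/-- The properties of the family of Green measures `G x y dy` on which the argument relies. -/
structure IsGreen (Ω : Set (Euc N)) (μ : Euc N → Measure (Euc N)) : Prop where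
  compl : ∀ x ∈ Ω, μ x Ωᶜ = 0
  ac : ∀ x ∈ Ω, μ x ≪ volume
  ac' : ∀ x ∈ Ω, volume.restrict Ω ≪ μ x
  fin : ∀ x ∈ Ω, ∀ F, IsCompact F → F ⊆ Ω → μ x F < ⊤
  rep : ∀ x ∈ Ω, ∀ ψ, IsTest Ω ψ → ψ x = ∫ y, -lap ψ y ∂μ x

theorem exists_moll_close {ρ F : Euc N → ℝ} (h : IsKern ρ F) {W : Euc N → ℝ} (hW : Continuous W)
    (hc : HasCompactSupport W) {δ : ℝ} (hδ : 0 < δ) :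
    ∃ τ₀ > 0, ∀ τ, 0 < τ → τ < τ₀ → ∀ x, |moll ρ τ W x - W x| ≤ δ := by
  have hu := hc.uniformContinuous_of_continuous hW
  obtain ⟨τ₀, hτ₀, H⟩ := Metric.uniformContinuous_iff.1 hu δ hδ
  refine ⟨τ₀, hτ₀, fun τ hτ hlt x => h.moll_sub_le hτ hW x fun y hy => ?_⟩
  have := H (a := y) (b := x) (by rw [dist_comm]; exact hy.trans_lt hlt)
  rw [Real.dist_eq] at this
  exact this.le

theorem WeakPair.exists_smooth_approx [NeZero N] {Ω : Set (Euc N)} (hΩ : IsOpen Ω)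
    {w g : Euc N → ℝ} (h : WeakPair Ω w g) (hw : ContinuousOn w Ω) (hg : ContinuousOn g Ω)
    {T : Set (Euc N)} (hT : IsCompact T) (hTΩ : T ⊆ Ω) {δ : ℝ} (hδ : 0 < δ) :
    ∃ w' g' : Euc N → ℝ, ContDiff ℝ ∞ w' ∧ Continuous g' ∧
      ∀ x ∈ T, -lap w' x = g' x ∧ |w' x - w x| ≤ δ ∧ |g' x - g x| ≤ δ := by
  obtain ⟨ρ, F, hk⟩ := exists_kern (N := N)
  obtain ⟨χ, hχ, hχ1, -⟩ := exists_cutoff hΩ hT hTΩ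
  have cW := continuous_mul_of_tsupport hΩ hw hχ.continuous hχ.sub
  have cG := continuous_mul_of_tsupport hΩ hg hχ.continuous hχ.sub
  obtain ⟨τ₁, hτ₁, H₁⟩ := exists_moll_close hk cW hχ.compact.mul_left hδ
  obtain ⟨τ₂, hτ₂, H₂⟩ := exists_moll_close hk cG hχ.compact.mul_left hδ
  rw [eventually_nhdsSet_iff_exists] at hχ1
  obtain ⟨U, hU, hTU, hU1⟩ := hχ1
  obtain ⟨τ₃, hτ₃, H₃⟩ := hT.exists_cthickening_subset_open (hU.inter hΩ) (subset_inter hTU hTΩ)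
  set τ := min (min τ₁ τ₂ / 2) τ₃ with hτd
  have hm : 0 < min τ₁ τ₂ := lt_min hτ₁ hτ₂
  have hτ : 0 < τ := lt_min (by linarith) hτ₃
  have hlt : τ < min τ₁ τ₂ := (min_le_left _ _).trans_lt (by linarith)
  refine ⟨_, _, hk.moll_smooth hτ cW.locallyIntegrable,
    (hk.moll_smooth hτ cG.locallyIntegrable).continuous, fun x hx => ⟨?_, ?_, ?_⟩⟩
  · have hball : closedBall x τ ⊆ U ∩ Ω := (closedBall_subset_cthickening hx τ).trans
      ((cthickening_mono (min_le_right _ _) T).trans H₃)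
    have htest : IsTest Ω fun y => mkern ρ τ (x - y) := by
      have hsm : ContDiff ℝ ∞ fun y => mkern ρ τ (x - y) :=
        (hk.mkern_smooth τ).comp (by fun_prop)
      have hsup : tsupport (fun y => mkern ρ τ (x - y)) ⊆ closedBall x τ := by
        refine closure_minimal (fun y hy => ?_) isClosed_closedBall
        by_contra hn
        refine hy (hk.mkern_supp hτ ?_)
        rw [mem_closedBall, dist_comm, dist_eq_norm, not_le] at hn
        exact hn.le
      exact ⟨hsm, (isCompact_closedBall x τ).of_isClosed_subset (isClosed_tsupport _) hsup,
        hsup.trans (hball.trans inter_subset_right)⟩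
    have key := h _ htest
    rw [hk.lap_moll hτ cW.locallyIntegrable, ← integral_neg, moll]
    have hz : ∀ y, y ∉ closedBall x τ → mkern ρ τ (x - y) = 0 := fun y hy => by
      refine hk.mkern_supp hτ ?_
      rw [mem_closedBall, dist_comm, dist_eq_norm, not_le] at hy
      exact hy.le
    have hz2 : ∀ y, y ∉ closedBall x τ → lap (mkern ρ τ) (x - y) = 0 := fun y hy => by
      refine lap_eq_zero_of_notMem_tsupport fun hn => hy ?_
      have := hk.mkern_tsupport hτ hn
      rwa [mem_closedBall, dist_zero_right, ← dist_eq_norm, dist_comm, ← mem_closedBall] at this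
    convert key using 1
    · refine integral_congr_ae (ae_of_all _ fun y => ?_)
      simp only
      rw [lap_comp_sub ((hk.mkern_smooth τ).of_le two_le_infty)]
      by_cases hy : y ∈ closedBall x τ
      · rw [hU1 y (hball hy).1]; ring
      · rw [hz2 y hy]; ring
    · refine integral_congr_ae (ae_of_all _ fun y => ?_)
      simp only
      by_cases hy : y ∈ closedBall x τ
      · rw [hU1 y (hball hy).1]; ring
      · rw [hz y hy]; ring
  · have := H₁ τ hτ (hlt.trans_le (min_le_left _ _)) x
    rwa [hU1 x (hTU hx), mul_one] at this
  · have := H₂ τ hτ (hlt.trans_le (min_le_right _ _)) x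
    rwa [hU1 x (hTU hx), mul_one] at this

end

section

variable {N : ℕ}

theorem IsGreen.trunc_le [NeZero N] {Ω : Set (Euc N)} (hΩ : IsOpen Ω) {μ : Euc N → Measure (Euc N)}
    (hG : IsGreen Ω μ) {ε : ℝ} {φ : ℝ → ℝ} (hφ : IsTrunc ε φ) {w g : Euc N → ℝ}
    (h : WeakPair Ω w g) (hw : ContinuousOn w Ω) (hg : ContinuousOn g Ω)
    {F : Set (Euc N)} (hF : IsCompact F) (hFΩ : F ⊆ Ω) (hwF : ∀ x ∈ Ω, x ∉ F → w x ≤ ε / 2)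
    {x : Euc N} (hx : x ∈ Ω) :
    φ (w x) ≤ ∫ y in F, deriv φ (w y) * g y ∂μ x := by
  have hε := hφ.pos
  obtain ⟨χ, hχ, hχ1, hχI⟩ := exists_cutoff hΩ hF hFΩ
  have hδ : ∀ n : ℕ, 0 < min (ε / 2) (1 / ((n:ℝ) + 1)) := fun n => by positivity
  choose W G cW cG hWG using fun n => h.exists_smooth_approx hΩ hw hg
    (T := tsupport χ) hχ.compact hχ.sub (hδ n)
  have hFT : F ⊆ tsupport χ := fun y hy => subset_tsupport _ (by
    have := hχ1.self_of_nhdsSet y hy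
    simp [this])
  have hlim : Tendsto (fun n : ℕ => (1 / ((n:ℝ) + 1))) atTop (𝓝 0) :=
    tendsto_one_div_add_atTop_nhds_zero_nat
  have hWt : ∀ y ∈ F, Tendsto (fun n => W n y) atTop (𝓝 (w y)) := fun y hy => by
    rw [tendsto_iff_dist_tendsto_zero]
    refine squeeze_zero (fun _ => dist_nonneg) (fun n => ?_) hlim
    rw [Real.dist_eq]
    exact (hWG n y (hFT hy)).2.1.trans (min_le_right _ _)
  have hGt : ∀ y ∈ F, Tendsto (fun n => G n y) atTop (𝓝 (g y)) := fun y hy => by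
    rw [tendsto_iff_dist_tendsto_zero]
    refine squeeze_zero (fun _ => dist_nonneg) (fun n => ?_) hlim
    rw [Real.dist_eq]
    exact (hWG n y (hFT hy)).2.2.trans (min_le_right _ _)
  have hψ : ∀ n, IsTest Ω fun y => χ y * φ (W n y) := fun n =>
    hχ.mul_smooth (hφ.smooth.comp (cW n))
  have hzero : ∀ n, ∀ y ∉ F, χ y * φ (W n y) = 0 := fun n y hy => by
    by_cases hyT : y ∈ tsupport χ
    · have h1 := (hWG n y hyT).2.1.trans (min_le_left _ _)
      have h2 := hwF y (hχ.sub hyT) hy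
      rw [hφ.zero, mul_zero]
      linarith [le_abs_self (W n y - w y)]
    · rw [image_eq_zero_of_notMem_tsupport hyT, zero_mul]
  have hlapz : ∀ n, ∀ y ∉ F, lap (fun y => χ y * φ (W n y)) y = 0 := fun n y hy => by
    rw [lap_congr (g := fun _ => 0), lap_const]
    filter_upwards [hF.isClosed.isOpen_compl.mem_nhds hy] with z hz using hzero n z hz
  have hle : ∀ n, ∀ y ∈ F, -lap (fun y => χ y * φ (W n y)) y ≤ deriv φ (W n y) * G n y := by
    intro n y hy
    have he : (fun y => χ y * φ (W n y)) =ᶠ[𝓝 y] fun y => φ (W n y) := by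
      filter_upwards [hχ1.filter_mono (nhds_le_nhdsSet hy)] with z hz
      rw [hz, one_mul]
    rw [lap_congr he, lap_comp hφ.smooth ((cW n).of_le two_le_infty).contDiffAt,
      ← (hWG n y (hFT hy)).1]
    have : 0 ≤ deriv (deriv φ) (W n y) * ∑ i, pd i (W n) y ^ 2 :=
      mul_nonneg (hφ.deriv2_nonneg _) (Finset.sum_nonneg fun i _ => sq_nonneg _)
    linarith
  have : IsFiniteMeasure ((μ x).restrict F) :=
    ⟨by rw [Measure.restrict_apply_univ]; exact hG.fin x hx F hF hFΩ⟩
  obtain ⟨M, hM⟩ := hF.exists_bound_of_continuousOn (hg.mono hFΩ)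
  have cD : ∀ n, Continuous fun y => deriv φ (W n y) * G n y := fun n =>
    (hφ.continuous_deriv.comp (cW n).continuous).mul (cG n)
  have hbd : ∀ n, ∀ y ∈ F, ‖deriv φ (W n y) * G n y‖ ≤ M + 1 := fun n y hy => by
    rw [norm_mul, Real.norm_of_nonneg (hφ.deriv_nonneg _)]
    have h1 := (hWG n y (hFT hy)).2.2.trans (min_le_right _ _)
    have h2 : 1 / ((n:ℝ) + 1) ≤ 1 := by
      rw [div_le_one (by positivity)]; linarith [(Nat.cast_nonneg n : (0:ℝ) ≤ n)]
    have h3 : ‖G n y‖ ≤ M + 1 := by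
      have h4 := hM y hy
      rw [Real.norm_eq_abs] at *
      have := abs_sub_abs_le_abs_sub (G n y) (g y)
      linarith
    exact (mul_le_of_le_one_left (norm_nonneg _) (hφ.deriv_le_one _)).trans h3
  have hInt : ∀ n, IntegrableOn (fun y => deriv φ (W n y) * G n y) F (μ x) := fun n =>
    Integrable.of_bound (cD n).aestronglyMeasurable (M + 1)
      ((ae_restrict_iff' hF.measurableSet).2 (ae_of_all _ (hbd n)))
  have hineq : ∀ n, χ x * φ (W n x) ≤ ∫ y in F, deriv φ (W n y) * G n y ∂μ x := fun n => by
    rw [hG.rep x hx _ (hψ n)]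
    rw [← setIntegral_eq_integral_of_forall_compl_eq_zero (s := F)
      (fun y hy => by rw [hlapz n y hy, neg_zero])]
    refine setIntegral_mono_on ?_ (hInt n) hF.measurableSet (hle n)
    obtain ⟨C, -, hC⟩ := (hψ n).lap.bounded
    exact Integrable.of_bound (hψ n).lap.continuous.neg.aestronglyMeasurable C
      (ae_of_all _ fun y => by rw [norm_neg]; exact hC y)
  have hT : Tendsto (fun n => ∫ y in F, deriv φ (W n y) * G n y ∂μ x) atTop
      (𝓝 (∫ y in F, deriv φ (w y) * g y ∂μ x)) := by
    refine tendsto_integral_of_dominated_convergence (fun _ => M + 1)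
      (fun n => (hInt n).aestronglyMeasurable) (integrable_const _) (fun n =>
      (ae_restrict_iff' hF.measurableSet).2 (ae_of_all _ (hbd n))) ?_
    refine (ae_restrict_iff' hF.measurableSet).2 (ae_of_all _ fun y hy => ?_)
    exact ((hφ.continuous_deriv.tendsto _).comp (hWt y hy)).mul (hGt y hy)
  by_cases hxF : x ∈ F
  · refine le_of_tendsto_of_tendsto' ?_ hT hineq
    rw [hχ1.self_of_nhdsSet x hxF]
    simp only [one_mul]
    exact (hφ.smooth.continuous.tendsto _).comp (hWt x hxF)
  · refine ge_of_tendsto' hT fun n => le_trans (le_of_eq ?_) (hineq n)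
    rw [hzero n x hxF]
    refine hφ.zero _ ((hwF x hx hxF).trans ?_)
    linarith

end

section

variable {N : ℕ}

theorem isCompact_superlevel {Ω : Set (Euc N)} (hΩ : IsOpen Ω) (hb : Bornology.IsBounded Ω)
    {w : Euc N → ℝ} (hw : ContinuousOn w (closure Ω)) (h0 : ∀ x ∈ frontier Ω, w x ≤ 0) {c : ℝ}
    (hc : 0 < c) :
    IsCompact {x | x ∈ closure Ω ∧ c ≤ w x} ∧ {x | x ∈ closure Ω ∧ c ≤ w x} ⊆ Ω := by
  constructor
  · refine hb.isCompact_closure.of_isClosed_subset ?_ fun x hx => hx.1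
    exact hw.preimage_isClosed_of_isClosed isClosed_closure isClosed_Ici
  · intro x hx
    by_contra hn
    have : x ∈ frontier Ω := by
      rw [hΩ.frontier_eq]
      exact ⟨hx.1, hn⟩
    linarith [h0 x this, hx.2]

/-- `w ≤ c` off a compact subset of `Ω`, for every `c > 0`. -/
def VanishesAtBdry (Ω : Set (Euc N)) (w : Euc N → ℝ) : Prop :=
  ∀ c > 0, ∃ F, IsCompact F ∧ F ⊆ Ω ∧ ∀ x ∈ Ω, x ∉ F → w x ≤ c

theorem vanishesAtBdry {Ω : Set (Euc N)} (hΩ : IsOpen Ω) (hb : Bornology.IsBounded Ω)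
    {w : Euc N → ℝ} (hw : ContinuousOn w (closure Ω)) (h0 : ∀ x ∈ frontier Ω, w x ≤ 0) :
    VanishesAtBdry Ω w := fun c hc => by
  obtain ⟨h1, h2⟩ := isCompact_superlevel hΩ hb hw h0 hc
  refine ⟨_, h1, h2, fun x hx hn => ?_⟩
  by_contra hlt
  exact hn ⟨subset_closure hx, (not_le.1 hlt).le⟩

namespace IsGreen

variable {Ω : Set (Euc N)} {μ : Euc N → Measure (Euc N)}

theorem ae_mem (hG : IsGreen Ω μ) {x : Euc N} (hx : x ∈ Ω) : ∀ᵐ y ∂μ x, y ∈ Ω := by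
  rw [ae_iff]
  exact hG.compl x hx

theorem integrableOn (hG : IsGreen Ω μ) {x : Euc N} (hx : x ∈ Ω) {F : Set (Euc N)}
    (hF : IsCompact F) (hFΩ : F ⊆ Ω) {f : Euc N → ℝ} (hf : ContinuousOn f F) :
    IntegrableOn f F (μ x) := by
  have : IsFiniteMeasure ((μ x).restrict F) :=
    ⟨by rw [Measure.restrict_apply_univ]; exact hG.fin x hx F hF hFΩ⟩
  obtain ⟨M, hM⟩ := hF.exists_bound_of_continuousOn hf
  exact Integrable.of_bound (hf.aestronglyMeasurable hF.measurableSet) M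
    ((ae_restrict_iff' hF.measurableSet).2 (ae_of_all _ hM))

theorem integrable_of_tsupport (hG : IsGreen Ω μ) {x : Euc N} (hx : x ∈ Ω) {f : Euc N → ℝ}
    (hf : Continuous f) (hc : HasCompactSupport f) (hs : tsupport f ⊆ Ω) :
    Integrable f (μ x) := by
  rw [← integrableOn_iff_integrable_of_support_subset (subset_tsupport f)]
  exact hG.integrableOn hx hc hs hf.continuousOn

theorem integrable_test (hG : IsGreen Ω μ) {x : Euc N} (hx : x ∈ Ω) {f : Euc N → ℝ}
    (hf : IsTest Ω f) : Integrable f (μ x) :=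
  hG.integrable_of_tsupport hx hf.continuous hf.compact hf.sub

variable [NeZero N]

/-- Comparison principle. -/
theorem le_integral (hΩ : IsOpen Ω) (hG : IsGreen Ω μ) {w g k : Euc N → ℝ} (h : WeakPair Ω w g)
    (hw : ContinuousOn w Ω) (hg : ContinuousOn g Ω) (hv : VanishesAtBdry Ω w) {x : Euc N}
    (hx : x ∈ Ω) (hgk : ∀ y ∈ Ω, g y ≤ k y) (hk0 : ∀ y ∈ Ω, 0 ≤ k y)
    (hk : Integrable k (μ x)) : w x ≤ ∫ y, k y ∂μ x := by
  refine le_of_forall_pos_le_add fun ε hε => ?_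
  obtain ⟨φ, hφ⟩ := exists_trunc (show 0 < ε / 2 by linarith)
  obtain ⟨F, hF, hFΩ, hwF⟩ := hv (ε / 2 / 2) (by linarith)
  have h1 := hG.trunc_le hΩ hφ h hw hg hF hFΩ hwF hx
  have h2 : ∫ y in F, deriv φ (w y) * g y ∂μ x ≤ ∫ y in F, k y ∂μ x := by
    refine setIntegral_mono_on (hG.integrableOn hx hF hFΩ ?_) hk.integrableOn hF.measurableSet
      fun y hy => ?_
    · exact (hφ.continuous_deriv.comp_continuousOn (hw.mono hFΩ)).mul (hg.mono hFΩ)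
    · have := hφ.deriv_nonneg (w y)
      have := hφ.deriv_le_one (w y)
      nlinarith [hgk y (hFΩ hy), hk0 y (hFΩ hy)]
  have h3 : ∫ y in F, k y ∂μ x ≤ ∫ y, k y ∂μ x :=
    setIntegral_le_integral hk ((hG.ae_mem hx).mono fun y hy => hk0 y hy)
  linarith [hφ.sub_le (w x)]

end IsGreen

/-- A positive potential which is continuous up to the boundary and vanishes there. -/
structure IsBar (Ω : Set (Euc N)) (μ : Euc N → Measure (Euc N)) (u v : Euc N → ℝ) : Prop where
  cont : ContinuousOn u (closure Ω)
  zero : ∀ x ∈ frontier Ω, u x = 0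
  pos : ∀ x ∈ Ω, 0 < u x
  cont' : ContinuousOn v Ω
  weak : WeakPair Ω u v
  integrable : ∀ x ∈ Ω, Integrable v (μ x)
  rep : ∀ x ∈ Ω, u x = ∫ y, v y ∂μ x

namespace IsBar

variable {Ω : Set (Euc N)} {μ : Euc N → Measure (Euc N)} {u v : Euc N → ℝ}

theorem const_mul (h : IsBar Ω μ u v) {c : ℝ} (hc : 0 < c) :
    IsBar Ω μ (fun x => c * u x) (fun x => c * v x) where
  cont := continuousOn_const.mul h.cont
  zero x hx := by rw [h.zero x hx, mul_zero]
  pos x hx := mul_pos hc (h.pos x hx)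
  cont' := continuousOn_const.mul h.cont'
  weak := h.weak.const_mul c
  integrable x hx := (h.integrable x hx).const_mul c
  rep x hx := by rw [integral_const_mul, h.rep x hx]

theorem contOn (h : IsBar Ω μ u v) : ContinuousOn u Ω := h.cont.mono subset_closure

theorem vanishes (h : IsBar Ω μ u v) (hΩ : IsOpen Ω) (hb : Bornology.IsBounded Ω) :
    VanishesAtBdry Ω u := vanishesAtBdry hΩ hb h.cont fun x hx => (h.zero x hx).le

theorem lintegral_le [NeZero N] (h : IsBar Ω μ u v) (hΩ : IsOpen Ω) (hb : Bornology.IsBounded Ω)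
    (hG : IsGreen Ω μ) (hv : ∀ x ∈ Ω, 0 ≤ v x) {w g : Euc N → ℝ} (hwg : WeakPair Ω w g)
    (hw : ContinuousOn w Ω) (hg : ContinuousOn g Ω) (hw0 : ∀ x ∈ Ω, 0 ≤ w x)
    (hg0 : ∀ x ∈ Ω, 0 ≤ g x) {x : Euc N} (hx : x ∈ Ω) :
    ∫⁻ y, ENNReal.ofReal (g y) ∂μ x ≤ ENNReal.ofReal (w x) := by
  have hεp : ∀ n : ℕ, 0 < 1 / ((n:ℝ) + 1) := fun n => by positivity
  choose φ hφ using fun n => exists_trunc (hεp n)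
  have hcp : ∀ n : ℕ, 0 < 1 / ((n:ℝ) + 1) / 2 / ((n:ℝ) + 1) := fun n => by positivity
  set F : ℕ → Set (Euc N) := fun n =>
    {x | x ∈ closure Ω ∧ 1 / ((n:ℝ) + 1) / 2 / ((n:ℝ) + 1) ≤ u x} with hFdef
  have hF : ∀ n, IsCompact (F n) ∧ F n ⊆ Ω := fun n =>
    isCompact_superlevel hΩ hb h.cont (fun x hx => (h.zero x hx).le) (hcp n)
  set W : ℕ → Euc N → ℝ := fun n y => ((n:ℝ) + 1) * u y - w y with hWdef
  have cW : ∀ n, ContinuousOn (W n) Ω := fun n => (continuousOn_const.mul h.contOn).sub hw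
  have hD : ∀ n y, 0 ≤ deriv (φ n) (W n y) := fun n y => (hφ n).deriv_nonneg _
  have key : ∀ n, ∫⁻ y in F n, ENNReal.ofReal (deriv (φ n) (W n y) * g y) ∂μ x ≤
      ENNReal.ofReal (w x + 2 * (1 / ((n:ℝ) + 1))) := fun n => by
    have hn : (0:ℝ) < (n:ℝ) + 1 := by positivity
    have cD : ContinuousOn (fun y => deriv (φ n) (W n y)) (F n) :=
      (hφ n).continuous_deriv.comp_continuousOn ((cW n).mono (hF n).2)
    have h1 := hG.trunc_le hΩ (hφ n)
      (WeakPair.sub hΩ (h.weak.const_mul ((n:ℝ) + 1)) hwg (continuousOn_const.mul h.contOn)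
        (continuousOn_const.mul h.cont') hw hg) (cW n)
      ((continuousOn_const.mul h.cont').sub hg) (hF n).1 (hF n).2 (fun y hy hn' => by
        have : u y < 1 / ((n:ℝ) + 1) / 2 / ((n:ℝ) + 1) := by
          by_contra hlt
          exact hn' ⟨subset_closure hy, not_lt.1 hlt⟩
        rw [lt_div_iff₀ hn] at this
        have := hw0 y hy
        linarith) hx
    have i1 : IntegrableOn (fun y => deriv (φ n) (W n y) * (((n:ℝ) + 1) * v y)) (F n) (μ x) :=
      hG.integrableOn hx (hF n).1 (hF n).2
        (cD.mul (continuousOn_const.mul (h.cont'.mono (hF n).2)))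
    have i2 : IntegrableOn (fun y => deriv (φ n) (W n y) * g y) (F n) (μ x) :=
      hG.integrableOn hx (hF n).1 (hF n).2 (cD.mul (hg.mono (hF n).2))
    have h2 : ∫ y in F n, deriv (φ n) (W n y) * (((n:ℝ) + 1) * v y - g y) ∂μ x =
        ∫ y in F n, deriv (φ n) (W n y) * (((n:ℝ) + 1) * v y) ∂μ x -
          ∫ y in F n, deriv (φ n) (W n y) * g y ∂μ x := by
      rw [← integral_sub i1 i2]
      simp only [mul_sub]
    have h3 : ∫ y in F n, deriv (φ n) (W n y) * (((n:ℝ) + 1) * v y) ∂μ x ≤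
        ((n:ℝ) + 1) * u x := by
      have hi := (h.integrable x hx).const_mul ((n:ℝ) + 1)
      calc _ ≤ ∫ y in F n, ((n:ℝ) + 1) * v y ∂μ x := by
            refine setIntegral_mono_on i1 hi.integrableOn (hF n).1.measurableSet fun y hy => ?_
            exact mul_le_of_le_one_left (mul_nonneg hn.le (hv y ((hF n).2 hy)))
              ((hφ n).deriv_le_one _)
        _ ≤ ∫ y, ((n:ℝ) + 1) * v y ∂μ x :=
            setIntegral_le_integral hi
              ((hG.ae_mem hx).mono fun y hy => mul_nonneg hn.le (hv y hy))
        _ = _ := by rw [integral_const_mul, h.rep x hx]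
    have h4 := (hφ n).sub_le (W n x)
    have h5 : ∫ y in F n, deriv (φ n) (W n y) * g y ∂μ x ≤ w x + 2 * (1 / ((n:ℝ) + 1)) := by
      have h6 : φ n (W n x) ≤ _ := h1
      rw [h2] at h6
      simp only [hWdef] at h3 h4 h6 ⊢
      linarith
    rw [← ofReal_integral_eq_lintegral_ofReal i2 ((ae_restrict_iff' (hF n).1.measurableSet).2
      (ae_of_all _ fun y hy => mul_nonneg (hD n y) (hg0 y ((hF n).2 hy))))]
    exact ENNReal.ofReal_le_ofReal h5
  have hlim : Tendsto (fun n : ℕ => (1 / ((n:ℝ) + 1))) atTop (𝓝 0) :=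
    tendsto_one_div_add_atTop_nhds_zero_nat
  set H : ℕ → Euc N → ℝ≥0∞ := fun n =>
    (F n).indicator fun y => ENNReal.ofReal (deriv (φ n) (W n y) * g y) with hH
  have hHm : ∀ n, AEMeasurable (H n) (μ x) := fun n => by
    rw [aemeasurable_indicator_iff (hF n).1.measurableSet]
    exact (((hφ n).continuous_deriv.comp_continuousOn ((cW n).mono (hF n).2)).mul
      (hg.mono (hF n).2)).aemeasurable (hF n).1.measurableSet |>.ennreal_ofReal
  have hHl : ∀ y ∈ Ω, ∀ᶠ n in atTop, H n y = ENNReal.ofReal (g y) := fun y hy => by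
    have hu := h.pos y hy
    have e1 : ∀ᶠ n : ℕ in atTop, 1 / ((n:ℝ) + 1) < u y := hlim.eventually_lt_const hu
    have t2 : Tendsto (fun n : ℕ => W n y) atTop atTop := by
      refine tendsto_atTop_add_const_right _ _ (Tendsto.atTop_mul_const hu ?_)
      exact tendsto_atTop_add_const_right _ _ tendsto_natCast_atTop_atTop
    filter_upwards [e1, t2.eventually_ge_atTop 2] with n hn1 hn2
    have hle1 : 1 / ((n:ℝ) + 1) ≤ 1 := by
      rw [div_le_one (by positivity)]; linarith [(Nat.cast_nonneg n : (0:ℝ) ≤ n)]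
    have hmem : y ∈ F n := by
      refine ⟨subset_closure hy, le_trans ?_ hn1.le⟩
      have hp := hεp n
      rw [div_div]
      refine div_le_self hp.le ?_
      linarith [(Nat.cast_nonneg n : (0:ℝ) ≤ n)]
    rw [hH]
    simp only
    rw [indicator_of_mem hmem, (hφ n).deriv_one _ (by linarith), one_mul]
  calc ∫⁻ y, ENNReal.ofReal (g y) ∂μ x = ∫⁻ y, liminf (fun n => H n y) atTop ∂μ x := by
        refine lintegral_congr_ae ((hG.ae_mem hx).mono fun y hy => ?_)
        exact ((tendsto_nhds_of_eventually_eq (hHl y hy)).liminf_eq).symm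
    _ ≤ liminf (fun n => ∫⁻ y, H n y ∂μ x) atTop := lintegral_liminf_le' hHm
    _ ≤ liminf (fun n : ℕ => ENNReal.ofReal (w x + 2 * (1 / ((n:ℝ) + 1)))) atTop := by
        refine liminf_le_liminf (Eventually.of_forall fun n => ?_)
        rw [hH]
        simp only
        rw [lintegral_indicator (hF n).1.measurableSet]
        exact key n
    _ = ENNReal.ofReal (w x) := by
        refine Tendsto.liminf_eq (ENNReal.tendsto_ofReal ?_)
        simpa using (hlim.const_mul 2).const_add (w x)

end IsBar

end

section

variable {N : ℕ}

/-- `ψ n` is a maximizing sequence for `∫ ψ` among nonnegative test functions with `-Δψ ≤ g`. -/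
structure IsMaximizing (Ω : Set (Euc N)) (g : Euc N → ℝ) (ψ : ℕ → Euc N → ℝ) : Prop where
  test : ∀ n, IsTest Ω (ψ n)
  nonneg : ∀ n x, 0 ≤ ψ n x
  le : ∀ n x, -lap (ψ n) x ≤ g x
  max : ∀ n q, IsTest Ω q → (∀ x, 0 ≤ q x) → (∀ x, -lap (ψ n) x + -lap q x ≤ g x) →
    ∫ x, q x ≤ (1 / 2) ^ n

section

variable {Ω : Set (Euc N)} {μ : Euc N → Measure (Euc N)} {u v g : Euc N → ℝ}

theorem IsGreen.test_le (hG : IsGreen Ω μ) (hg : IsTest Ω g) {ψ : Euc N → ℝ} (hψ : IsTest Ω ψ)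
    (hle : ∀ x, -lap ψ x ≤ g x) {x : Euc N} (hx : x ∈ Ω) : ψ x ≤ ∫ y, g y ∂μ x := by
  rw [hG.rep x hx ψ hψ]
  exact integral_mono (hG.integrable_test hx hψ.lap).neg (hG.integrable_test hx hg) hle

theorem IsBar.integrableOn (h : IsBar Ω μ u v) (hb : Bornology.IsBounded Ω) :
    IntegrableOn u Ω :=
  (h.cont.integrableOn_compact hb.isCompact_closure).mono_set subset_closure

theorem IsBar.exists_maximizing (h : IsBar Ω μ u v) (hΩ : IsOpen Ω) (hb : Bornology.IsBounded Ω)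
    (hG : IsGreen Ω μ) (hg : IsTest Ω g) (hg0 : ∀ x, 0 ≤ g x)
    (hp : ∀ x ∈ Ω, ∫ y, g y ∂μ x ≤ u x) : ∃ ψ, IsMaximizing Ω g ψ := by
  set S : Set (Euc N → ℝ) := {ψ | IsTest Ω ψ ∧ (∀ x, 0 ≤ ψ x) ∧ ∀ x, -lap ψ x ≤ g x} with hS
  set I : Set ℝ := (fun ψ : Euc N → ℝ => ∫ x, ψ x) '' S with hI
  have hne : I.Nonempty := ⟨_, fun _ => 0, ⟨IsTest.zero, fun _ => le_rfl, fun x => by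
    rw [lap_const, neg_zero]; exact hg0 x⟩, rfl⟩
  have hbd : BddAbove I := by
    refine ⟨∫ x in Ω, u x, ?_⟩
    rintro _ ⟨ψ, ⟨hψ, -, hψg⟩, rfl⟩
    simp only
    rw [← setIntegral_eq_integral_of_forall_compl_eq_zero (s := Ω) fun x hx => hψ.eq_zero hx]
    exact setIntegral_mono_on hψ.integrable.integrableOn (h.integrableOn hb) hΩ.measurableSet
      fun x hx => (hG.test_le hg hψ hψg hx).trans (hp x hx)
  have hex : ∀ n : ℕ, ∃ ψ ∈ S, sSup I - (1 / 2) ^ n < ∫ x, ψ x := fun n => by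
    obtain ⟨_, ⟨ψ, hψ, rfl⟩, hlt⟩ := exists_lt_of_lt_csSup hne
      (show sSup I - (1 / 2) ^ n < sSup I by simp)
    exact ⟨ψ, hψ, hlt⟩
  choose ψ hψ hlt using hex
  refine ⟨ψ, fun n => (hψ n).1, fun n => (hψ n).2.1, fun n => (hψ n).2.2, fun n q hq hq0 hle => ?_⟩
  have hmem : (fun x => ψ n x + q x) ∈ S :=
    ⟨(hψ n).1.add hq, fun x => add_nonneg ((hψ n).2.1 x) (hq0 x), fun x => by
      rw [lap_add ((hψ n).1.contDiffAt x) (hq.contDiffAt x)]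
      linarith [hle x]⟩
  have hle' : ∫ x, ψ n x + q x ≤ sSup I := le_csSup hbd ⟨_, hmem, rfl⟩
  rw [integral_add (hψ n).1.integrable hq.integrable] at hle'
  linarith [hlt n]

theorem ae_tendsto_zero_of_integral_le {q : ℕ → Euc N → ℝ} (hq : ∀ n, Integrable (q n))
    (hq0 : ∀ n x, 0 ≤ q n x) (hle : ∀ n, ∫ x, q n x ≤ (1 / 2) ^ n) :
    ∀ᵐ x, Tendsto (fun n => q n x) atTop (𝓝 0) := by
  have h1 : ∀ n, ∫⁻ x, ENNReal.ofReal (q n x) ≤ ENNReal.ofReal ((1 / 2) ^ n) := fun n => by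
    rw [← ofReal_integral_eq_lintegral_ofReal (hq n) (ae_of_all _ (hq0 n))]
    exact ENNReal.ofReal_le_ofReal (hle n)
  have hm : ∀ n, AEMeasurable fun x => ENNReal.ofReal (q n x) := fun n =>
    (hq n).aestronglyMeasurable.aemeasurable.ennreal_ofReal
  have h2 : ∫⁻ x, ∑' n, ENNReal.ofReal (q n x) ≠ ⊤ := by
    rw [lintegral_tsum hm]
    refine ne_top_of_le_ne_top ?_ (ENNReal.tsum_le_tsum h1)
    exact (summable_geometric_two).tsum_ofReal_ne_top
  filter_upwards [ae_lt_top' (AEMeasurable.tsum hm) h2] with x hx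
  have := ENNReal.tendsto_atTop_zero_of_tsum_ne_top hx.ne
  rw [← ENNReal.toReal_zero]
  refine ((ENNReal.tendsto_toReal ENNReal.zero_ne_top).comp this).congr fun n => ?_
  simp [ENNReal.toReal_ofReal (hq0 n x)]

theorem IsMaximizing.tendsto_zero [NeZero N] (hG : IsGreen Ω μ) (hΩ : IsOpen Ω) {ψ : ℕ → Euc N → ℝ}
    (hψ : IsMaximizing Ω g ψ) (hg : IsTest Ω g) {χ : Euc N → ℝ} (hχ : IsTest Ω χ)
    (hχI : ∀ x, χ x ∈ Icc (0:ℝ) 1) :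
    Tendsto (fun n => ∫ x, χ x * (g x + lap (ψ n) x)) atTop (𝓝 0) ∧
    ∀ᵐ x ∂volume.restrict Ω,
      Tendsto (fun n => ∫ y, χ y * (g y + lap (ψ n) y) ∂μ x) atTop (𝓝 0) := by
  obtain ⟨ρ, K, hk⟩ := exists_kern (N := N)
  obtain ⟨η, hη, hηΩ⟩ := hχ.compact.exists_cthickening_subset_open hΩ hχ.sub
  obtain ⟨m, P, hm, hP⟩ := hk.exists_inverse hη
  obtain ⟨C, hC0, hC⟩ := hk.moll_le hη
  set Λ : ℕ → Euc N → ℝ := fun n x => χ x * (g x + lap (ψ n) x) with hΛ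
  have hl0 : ∀ n x, 0 ≤ g x + lap (ψ n) x := fun n x => by linarith [hψ.le n x]
  have hΛ0 : ∀ n x, 0 ≤ Λ n x := fun n x => mul_nonneg (hχI x).1 (hl0 n x)
  have hΛt : ∀ n, IsTest Ω (Λ n) := fun n =>
    hχ.mul_smooth (hg.smooth.add (hψ.test n).smooth.lap)
  have hΛs : ∀ n, tsupport (Λ n) ⊆ tsupport χ := fun n => tsupport_mul_subset_left
  have hΛz : ∀ n, ∀ x ∉ tsupport χ, Λ n x = 0 := fun n x hx =>
    image_eq_zero_of_notMem_tsupport fun h => hx (hΛs n h)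
  have hq := fun n => hP (hΛt n) ((cthickening_subset_of_subset η (hΛs n)).trans hηΩ)
  have hM0 : ∀ n x, 0 ≤ moll ρ η (Λ n) x := fun n => hk.moll_nonneg hη (hΛ0 n)
  have hqle : ∀ n, ∫ x, P (Λ n) x ≤ (1 / 2) ^ n := fun n => by
    refine hψ.max n _ (hq n).1 ((hq n).2.2.1 (hΛ0 n)) fun x => ?_
    rw [(hq n).2.1]
    have h1 := hM0 n x
    have h2 : Λ n x ≤ g x + lap (ψ n) x := mul_le_of_le_one_left (hl0 n x) (hχI x).2
    linarith
  have hIle : ∀ n, ∫ x, Λ n x ≤ (1 / 2) ^ n / m := fun n => by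
    rw [le_div_iff₀ hm, mul_comm, ← (hq n).2.2.2]
    exact hqle n
  have hgeo : Tendsto (fun n : ℕ => ((1:ℝ) / 2) ^ n / m) atTop (𝓝 0) := by
    simpa using (tendsto_pow_atTop_nhds_zero_of_lt_one (r := (1:ℝ) / 2) (by norm_num)
      (by norm_num)).div_const m
  have hI0 : Tendsto (fun n => ∫ x, Λ n x) atTop (𝓝 0) :=
    squeeze_zero (fun n => integral_nonneg (hΛ0 n)) hIle hgeo
  refine ⟨hI0, ?_⟩
  have hae := ae_tendsto_zero_of_integral_le (fun n => (hq n).1.integrable)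
    (fun n => (hq n).2.2.1 (hΛ0 n)) hqle
  filter_upwards [ae_restrict_of_ae hae, ae_restrict_mem hΩ.measurableSet] with x hx hxΩ
  set T := cthickening η (tsupport χ) with hT
  have hTc : IsCompact T := hχ.compact.cthickening
  have hMt : ∀ n, IsTest Ω (moll ρ η (Λ n)) := fun n =>
    hk.moll_test hη hχ.compact (hΛz n) (hΛt n).continuous.locallyIntegrable hηΩ
  have heq : ∀ n, ∫ y, Λ n y ∂μ x = P (Λ n) x + ∫ y, moll ρ η (Λ n) y ∂μ x := fun n => by
    rw [hG.rep x hxΩ _ (hq n).1]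
    simp only [(hq n).2.1]
    rw [integral_sub (hG.integrable_test hxΩ (hΛt n)) (hG.integrable_test hxΩ (hMt n))]
    ring
  have hM : Tendsto (fun n => ∫ y, moll ρ η (Λ n) y ∂μ x) atTop (𝓝 0) := by
    refine squeeze_zero (g := fun n => (C * ∫ y, Λ n y) * (μ x).real T)
      (fun n => integral_nonneg (hM0 n)) (fun n => ?_) ?_
    · rw [← setIntegral_eq_integral_of_forall_compl_eq_zero (s := T)
        fun y hy => hk.moll_eq_zero hη (hΛz n) hy]
      have hc : IntegrableOn (fun _ : Euc N => C * ∫ y, Λ n y) T (μ x) :=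
        hG.integrableOn hxΩ hTc hηΩ continuousOn_const
      refine (setIntegral_mono_on (hG.integrable_test hxΩ (hMt n)).integrableOn hc
        hTc.measurableSet fun y _ => hC (Λ n) (hΛ0 n) (hΛt n).integrable y).trans ?_
      rw [setIntegral_const, smul_eq_mul, mul_comm]
    · simpa using (hI0.const_mul C).mul_const ((μ x).real T)
  have := hx.add hM
  rw [add_zero] at this
  exact this.congr fun n => (heq n).symm

theorem IsBar.integral_le_of_maximizing [NeZero N] (h : IsBar Ω μ u v) (hΩ : IsOpen Ω)
    (hb : Bornology.IsBounded Ω) (hG : IsGreen Ω μ) (hg : IsTest Ω g)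
    (hp : ∀ x ∈ Ω, ∫ y, g y ∂μ x ≤ u x) {ψ : ℕ → Euc N → ℝ} (hψ : IsMaximizing Ω g ψ)
    {ε : ℝ} (hε : 0 < ε) {χ : Euc N → ℝ} (hχ : IsTest Ω χ) (hχ0 : ∀ x, 0 ≤ χ x)
    (hχ1 : ∀ x ∈ Ω, ε / 4 ≤ u x → χ x = 1) (n : ℕ) {x : Euc N} (hx : x ∈ Ω) :
    ∫ y, g y ∂μ x ≤ ψ n x + 2 * ε +
      ∫ y, {y | y ∈ closure Ω ∧ 2 * ε ≤ u y}ᶜ.indicator (fun y => |2 * v y - g y|) y ∂μ x +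
      ∫ y, χ y * (g y + lap (ψ n) y) ∂μ x := by
  obtain ⟨φ, hφ⟩ := exists_trunc hε
  set F : Set (Euc N) := {y | y ∈ closure Ω ∧ ε / 4 ≤ u y} with hFd
  set F' : Set (Euc N) := {y | y ∈ closure Ω ∧ 2 * ε ≤ u y} with hFd'
  obtain ⟨hF, hFΩ⟩ : IsCompact F ∧ F ⊆ Ω :=
    isCompact_superlevel hΩ hb h.cont (fun x hx => (h.zero x hx).le) (by linarith)
  obtain ⟨hF', hFΩ'⟩ : IsCompact F' ∧ F' ⊆ Ω :=
    isCompact_superlevel hΩ hb h.cont (fun x hx => (h.zero x hx).le) (by linarith)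
  have hFF : F' ⊆ F := fun y hy => ⟨hy.1, by linarith [hy.2]⟩
  have hψu : ∀ y ∈ Ω, ψ n y ≤ u y := fun y hy =>
    (hG.test_le hg (hψ.test n) (hψ.le n) hy).trans (hp y hy)
  have hwp : WeakPair Ω (fun y => 2 * u y - ψ n y) (fun y => 2 * v y - -lap (ψ n) y) := by
    refine WeakPair.sub hΩ (h.weak.const_mul 2)
      (ContDiffOn.weakPair hΩ ((hψ.test n).smooth.of_le two_le_infty).contDiffOn)
      (continuousOn_const.mul h.contOn) (continuousOn_const.mul h.cont')
      (hψ.test n).continuous.continuousOn (hψ.test n).lap.continuous.neg.continuousOn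
  set w : Euc N → ℝ := fun y => 2 * u y - ψ n y with hw
  have cw : ContinuousOn w Ω :=
    (continuousOn_const.mul h.contOn).sub (hψ.test n).continuous.continuousOn
  have key := hG.trunc_le hΩ hφ hwp cw
    ((continuousOn_const.mul h.cont').sub (hψ.test n).lap.continuous.neg.continuousOn) hF hFΩ
    (fun y hy hn => by
      have : u y < ε / 4 := by
        by_contra hlt
        exact hn ⟨subset_closure hy, not_lt.1 hlt⟩
      have := hψ.nonneg n y
      simp only [hw]
      linarith) hx
  have i2 : Integrable (fun y => 2 * v y - g y) (μ x) :=
    ((h.integrable x hx).const_mul 2).sub (hG.integrable_test hx hg)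
  have i3 : Integrable (F'ᶜ.indicator fun y => |2 * v y - g y|) (μ x) :=
    i2.abs.indicator hF'.measurableSet.compl
  have ht : IsTest Ω fun y => χ y * (g y + lap (ψ n) y) :=
    hχ.mul_smooth (hg.smooth.add (hψ.test n).smooth.lap)
  have i4 := hG.integrable_test hx ht
  have cD : ContinuousOn (fun y => deriv φ (w y) * (2 * v y - -lap (ψ n) y)) F :=
    (hφ.continuous_deriv.comp_continuousOn (cw.mono hFΩ)).mul
      ((continuousOn_const.mul (h.cont'.mono hFΩ)).sub
        (hψ.test n).lap.continuous.neg.continuousOn)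
  have i5 := hG.integrableOn hx hF hFΩ cD
  rw [← integrable_indicator_iff hF.measurableSet] at i5
  have hle : ∫ y in F, deriv φ (w y) * (2 * v y - -lap (ψ n) y) ∂μ x ≤
      ∫ y, ((2 * v y - g y) + F'ᶜ.indicator (fun y => |2 * v y - g y|) y) +
        χ y * (g y + lap (ψ n) y) ∂μ x := by
    rw [← integral_indicator hF.measurableSet]
    refine integral_mono_ae i5 ((i2.add i3).add i4) ?_
    filter_upwards [hG.ae_mem hx] with y hy
    have hl0 : 0 ≤ g y + lap (ψ n) y := by linarith [hψ.le n y]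
    have hχl := mul_nonneg (hχ0 y) hl0
    have hd0 := hφ.deriv_nonneg (w y)
    have hd1 := hφ.deriv_le_one (w y)
    by_cases hyF : y ∈ F
    · rw [indicator_of_mem hyF, hχ1 y hy hyF.2]
      by_cases hyF' : y ∈ F'
      · rw [indicator_of_notMem (by simpa using hyF')]
        rw [hφ.deriv_one _ (by simp only [hw]; linarith [hψu y hy, hyF'.2])]
        linarith
      · rw [indicator_of_mem (by simpa using hyF')]
        have h1 : deriv φ (w y) * (2 * v y - -lap (ψ n) y) =
          deriv φ (w y) * (2 * v y - g y) + deriv φ (w y) * (g y + lap (ψ n) y) := by ring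
        have h2 : deriv φ (w y) * (g y + lap (ψ n) y) ≤ g y + lap (ψ n) y :=
          mul_le_of_le_one_left hl0 hd1
        have h3 : deriv φ (w y) * (2 * v y - g y) ≤ (2 * v y - g y) + |2 * v y - g y| := by
          have := neg_abs_le (2 * v y - g y)
          have := le_abs_self (2 * v y - g y)
          rcases le_total 0 (2 * v y - g y) with h | h <;> nlinarith
        linarith
    · rw [indicator_of_notMem hyF, indicator_of_mem (show y ∈ F'ᶜ from fun h => hyF (hFF h))]
      have := neg_abs_le (2 * v y - g y)
      linarith
  rw [integral_add (by exact i2.add i3) i4, integral_add i2 i3,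
    integral_sub ((h.integrable x hx).const_mul 2) (hG.integrable_test hx hg),
    integral_const_mul, ← h.rep x hx] at hle
  have := hφ.sub_le (w x)
  simp only [hw] at this key hle
  linarith

end

end

section

variable {N : ℕ} {Ω : Set (Euc N)} {μ : Euc N → Measure (Euc N)} {u v g g' : Euc N → ℝ}

theorem IsBar.exists_approx [NeZero N] (h : IsBar Ω μ u v) (hΩ : IsOpen Ω)
    (hb : Bornology.IsBounded Ω) (hG : IsGreen Ω μ) (hg : IsTest Ω g) (hg0 : ∀ x, 0 ≤ g x)
    (hp : ∀ x ∈ Ω, ∫ y, g y ∂μ x ≤ u x) :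
    ∃ ψ, IsMaximizing Ω g ψ ∧ ∀ᵐ x ∂volume.restrict Ω,
      Tendsto (fun n => ψ n x) atTop (𝓝 (∫ y, g y ∂μ x)) := by
  obtain ⟨ψ, hψ⟩ := h.exists_maximizing hΩ hb hG hg hg0 hp
  refine ⟨ψ, hψ, ?_⟩
  have hεp : ∀ k : ℕ, 0 < 1 / ((k:ℝ) + 1) := fun k => by positivity
  have hlim : Tendsto (fun n : ℕ => (1 / ((n:ℝ) + 1))) atTop (𝓝 0) :=
    tendsto_one_div_add_atTop_nhds_zero_nat
  have hF : ∀ c : ℝ, 0 < c → _ := fun c hc =>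
    isCompact_superlevel (c := c) hΩ hb h.cont (fun x hx => (h.zero x hx).le) hc
  have hex : ∀ k : ℕ, ∃ χ : Euc N → ℝ, IsTest Ω χ ∧ (∀ x, χ x ∈ Icc (0:ℝ) 1) ∧
      ∀ x ∈ Ω, 1 / ((k:ℝ) + 1) / 4 ≤ u x → χ x = 1 := fun k => by
    obtain ⟨h1, h2⟩ := hF (1 / ((k:ℝ) + 1) / 4) (by linarith [hεp k])
    obtain ⟨χ, hχ, hχ1, hχI⟩ := exists_cutoff hΩ h1 h2
    exact ⟨χ, hχ, hχI, fun x hx hle => hχ1.self_of_nhdsSet x ⟨subset_closure hx, hle⟩⟩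
  choose χ hχ hχI hχ1 using hex
  have hae : ∀ᵐ x ∂volume.restrict Ω, ∀ k, Tendsto
      (fun n => ∫ y, χ k y * (g y + lap (ψ n) y) ∂μ x) atTop (𝓝 0) :=
    ae_all_iff.2 fun k => (hψ.tendsto_zero hG hΩ hg (hχ k) (hχI k)).2
  filter_upwards [hae, ae_restrict_mem hΩ.measurableSet] with x hx hxΩ
  have i2 : Integrable (fun y => 2 * v y - g y) (μ x) :=
    ((h.integrable x hxΩ).const_mul 2).sub (hG.integrable_test hxΩ hg)
  have hr : Tendsto (fun k : ℕ => ∫ y, {y | y ∈ closure Ω ∧ 2 * (1 / ((k:ℝ) + 1)) ≤ u y}ᶜ.indicator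
      (fun y => |2 * v y - g y|) y ∂μ x) atTop (𝓝 0) := by
    rw [← integral_zero (Euc N) ℝ (μ := μ x)]
    refine tendsto_integral_of_dominated_convergence (fun y => |2 * v y - g y|) (fun k => ?_)
      i2.abs (fun k => ae_of_all _ fun y => ?_) ((hG.ae_mem hxΩ).mono fun y hy => ?_)
    · exact i2.abs.aestronglyMeasurable.indicator
        (hF (2 * (1 / ((k:ℝ) + 1))) (by linarith [hεp k])).1.measurableSet.compl
    · refine (norm_indicator_le_norm_self _ _).trans ?_
      simp
    · refine tendsto_nhds_of_eventually_eq ?_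
      have h2 : Tendsto (fun k : ℕ => 2 * (1 / ((k:ℝ) + 1))) atTop (𝓝 0) := by
        simpa using hlim.const_mul 2
      filter_upwards [h2.eventually_lt_const (h.pos y hy)] with k hk
      rw [indicator_of_notMem]
      exact fun hn => hn ⟨subset_closure hy, hk.le⟩
  rw [Metric.tendsto_atTop]
  intro δ hδ
  have hs : Tendsto (fun k : ℕ => 2 * (1 / ((k:ℝ) + 1)) +
      ∫ y, {y | y ∈ closure Ω ∧ 2 * (1 / ((k:ℝ) + 1)) ≤ u y}ᶜ.indicator
      (fun y => |2 * v y - g y|) y ∂μ x) atTop (𝓝 0) := by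
    simpa using (hlim.const_mul 2).add hr
  obtain ⟨k, hk⟩ := (hs.eventually_lt_const (show 0 < δ / 2 by linarith)).exists
  obtain ⟨n₀, hn₀⟩ := eventually_atTop.1
    ((hx k).eventually_lt_const (show 0 < δ / 2 by linarith))
  refine ⟨n₀, fun n hn => ?_⟩
  have h1 := h.integral_le_of_maximizing hΩ hb hG hg hp hψ (hεp k) (hχ k) (fun x => (hχI k x).1)
    (hχ1 k) n hxΩ
  have h2 := hG.test_le hg (hψ.test n) (hψ.le n) hxΩ
  rw [Real.dist_eq, abs_sub_lt_iff]
  constructor <;> linarith [hn₀ n hn]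

/-- Bounded nonnegative densities with compact support in `Ω` whose potential is at most `u`. -/
structure IsAdm (Ω : Set (Euc N)) (μ : Euc N → Measure (Euc N)) (u g : Euc N → ℝ) : Prop where
  meas : AEStronglyMeasurable g volume
  nonneg : ∀ x, 0 ≤ g x
  bdd : ∃ M, ∀ x, g x ≤ M
  supp : ∃ F, IsCompact F ∧ F ⊆ Ω ∧ ∀ x ∉ F, g x = 0
  le : ∀ x ∈ Ω, ∫ y, g y ∂μ x ≤ u x

theorem IsTest.isAdm (hg : IsTest Ω g) (hg0 : ∀ x, 0 ≤ g x)
    (hp : ∀ x ∈ Ω, ∫ y, g y ∂μ x ≤ u x) : IsAdm Ω μ u g where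
  meas := hg.continuous.aestronglyMeasurable
  nonneg := hg0
  bdd := by
    obtain ⟨C, -, hC⟩ := hg.bounded
    exact ⟨C, fun x => (le_abs_self _).trans (hC x)⟩
  supp := ⟨tsupport g, hg.compact, hg.sub, fun _ => image_eq_zero_of_notMem_tsupport⟩
  le := hp

theorem integrable_of_bdd_of_supp {ν : Measure (Euc N)} {F : Set (Euc N)}
    (hν : ν F < ⊤) {g : Euc N → ℝ} (hm : AEStronglyMeasurable g ν) {M : ℝ}
    (hM : ∀ x, |g x| ≤ M) (hz : ∀ x ∉ F, g x = 0) : Integrable g ν := by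
  have : IsFiniteMeasure (ν.restrict F) := ⟨by rwa [Measure.restrict_apply_univ]⟩
  have h1 : IntegrableOn g F ν := Integrable.of_bound hm.restrict M (ae_of_all _ hM)
  rwa [integrableOn_iff_integrable_of_support_subset] at h1
  intro x hx
  by_contra hn
  exact hx (hz x hn)

theorem IsGreen.tendsto_integral (hG : IsGreen Ω μ) {F : Set (Euc N)} (hF : IsCompact F)
    (hFΩ : F ⊆ Ω) {g : ℕ → Euc N → ℝ} {g₀ : Euc N → ℝ}
    (hm : ∀ n, AEStronglyMeasurable (g n) volume) {M : ℝ} (hM : ∀ n x, |g n x| ≤ M)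
    (hz : ∀ n, ∀ x ∉ F, g n x = 0)
    (hae : ∀ᵐ x, Tendsto (fun n => g n x) atTop (𝓝 (g₀ x))) {x : Euc N} (hx : x ∈ Ω) :
    Tendsto (fun n => ∫ y, g n y ∂μ x) atTop (𝓝 (∫ y, g₀ y ∂μ x)) := by
  have hM0 : 0 ≤ M := (abs_nonneg _).trans (hM 0 x)
  refine tendsto_integral_of_dominated_convergence (F.indicator fun _ => M)
    (fun n => (hm n).mono_ac (hG.ac x hx)) ?_ (fun n => ae_of_all _ fun y => ?_)
    ((hG.ac x hx).ae_le hae)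
  · rw [integrable_indicator_iff hF.measurableSet]
    exact hG.integrableOn hx hF hFΩ continuousOn_const
  · by_cases hy : y ∈ F
    · rw [indicator_of_mem hy]; exact hM n y
    · rw [indicator_of_notMem hy, hz n y hy, norm_zero]

namespace IsAdm

theorem exists_bound (h : IsAdm Ω μ u g) : ∃ M, ∀ x, |g x| ≤ M := by
  obtain ⟨M, hM⟩ := h.bdd
  exact ⟨M, fun x => by rw [abs_of_nonneg (h.nonneg x)]; exact hM x⟩

theorem integrable (h : IsAdm Ω μ u g) : Integrable g := by
  obtain ⟨M, hM⟩ := h.exists_bound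
  obtain ⟨F, hF, -, hz⟩ := h.supp
  exact integrable_of_bdd_of_supp hF.measure_lt_top h.meas hM hz

theorem integrable_green (h : IsAdm Ω μ u g) (hG : IsGreen Ω μ) {x : Euc N} (hx : x ∈ Ω) :
    Integrable g (μ x) := by
  obtain ⟨M, hM⟩ := h.exists_bound
  obtain ⟨F, hF, hFΩ, hz⟩ := h.supp
  exact integrable_of_bdd_of_supp (hG.fin x hx F hF hFΩ)
    (h.meas.mono_ac (hG.ac x hx)) hM hz

theorem exists_smooth [NeZero N] (h : IsAdm Ω μ u g) (hΩ : IsOpen Ω) (hG : IsGreen Ω μ) :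
    ∃ (G : ℕ → Euc N → ℝ) (M : ℝ) (F : Set (Euc N)), IsCompact F ∧ F ⊆ Ω ∧
      (∀ n, IsTest Ω (G n)) ∧ (∀ n x, 0 ≤ G n x) ∧ (∀ n x, |G n x| ≤ M) ∧
      (∀ n, ∀ x ∉ F, G n x = 0) ∧ (∀ n, IsAdm Ω μ u (G n)) ∧
      ∀ᵐ x, Tendsto (fun n => G n x) atTop (𝓝 (g x)) := by
  obtain ⟨ρ, K, hk⟩ := exists_kern (N := N)
  obtain ⟨M, hM⟩ := h.exists_bound
  obtain ⟨F, hF, hFΩ, hz⟩ := h.supp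
  obtain ⟨η, hη, hηΩ⟩ := hF.exists_cthickening_subset_open hΩ hFΩ
  have hli := h.integrable.locallyIntegrable
  set τ : ℕ → ℝ := fun n => η / 2 * (1 / ((n:ℝ) + 1)) with hτ
  have hτp : ∀ n, 0 < τ n := fun n => by positivity
  have hτl : ∀ n, τ n ≤ η / 2 := fun n => by
    refine mul_le_of_le_one_right (by linarith) ?_
    rw [div_le_one (by positivity)]; linarith [(Nat.cast_nonneg n : (0:ℝ) ≤ n)]
  have hτt : Tendsto τ atTop (𝓝[>] 0) := by
    refine tendsto_nhdsWithin_iff.2 ⟨?_, Eventually.of_forall fun n => hτp n⟩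
    rw [← mul_zero (η / 2)]
    exact tendsto_one_div_add_atTop_nhds_zero_nat.const_mul (η / 2)
  set F₁ := cthickening (η / 2) F with hF₁
  have hF₁c : IsCompact F₁ := hF.cthickening
  have hF₂Ω : cthickening (η / 2) F₁ ⊆ Ω := by
    refine (cthickening_cthickening_subset (by linarith) (by linarith) F).trans ?_
    rwa [add_halves]
  have hF₁Ω : F₁ ⊆ Ω := (self_subset_cthickening _).trans hF₂Ω
  set G : ℕ → Euc N → ℝ := fun n => moll ρ (τ n) g with hGd
  have hsub : ∀ n, cthickening (τ n) F ⊆ F₁ := fun n => cthickening_mono (hτl n) F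
  have hGt : ∀ n, IsTest Ω (G n) := fun n =>
    hk.moll_test (hτp n) hF hz hli ((hsub n).trans hF₁Ω)
  have hG0 : ∀ n x, 0 ≤ G n x := fun n => hk.moll_nonneg (hτp n) h.nonneg
  have hGM : ∀ n x, |G n x| ≤ M := fun n => hk.moll_abs_le (hτp n) hM
  have hGz : ∀ n, ∀ x ∉ F₁, G n x = 0 := fun n x hx =>
    hk.moll_eq_zero (hτp n) hz fun hn => hx (hsub n hn)
  have hGae : ∀ᵐ x, Tendsto (fun n => G n x) atTop (𝓝 (g x)) :=
    (hk.moll_tendsto_ae hli).mono fun x hx => hx.comp hτt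
  refine ⟨G, M, F₁, hF₁c, hF₁Ω, hGt, hG0, hGM, hGz, fun n => ?_, hGae⟩
  refine (hGt n).isAdm (hG0 n) fun x hx => le_trans ?_ (h.le x hx)
  have t1 := hG.tendsto_integral hF₁c hF₁Ω (fun j => (hGt j).continuous.aestronglyMeasurable)
    hGM hGz hGae hx
  have hsub2 : ∀ j, cthickening (τ n) (tsupport (G j)) ⊆ cthickening (η / 2) F₁ := fun j =>
    (cthickening_mono (hτl n) _).trans (cthickening_subset_of_subset _
      (closure_minimal (fun y hy => by
        by_contra hn
        exact hy (hGz j y hn)) hF₁c.isClosed))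
  have hMt : ∀ j, IsTest Ω (moll ρ (τ n) (G j)) := fun j =>
    hk.moll_test (hτp n) (hGt j).compact (fun _ => image_eq_zero_of_notMem_tsupport)
      (hGt j).continuous.locallyIntegrable ((hsub2 j).trans hF₂Ω)
  have t2 : Tendsto (fun j => ∫ y, moll ρ (τ n) (G j) y ∂μ x) atTop (𝓝 (∫ y, G n y ∂μ x)) := by
    refine hG.tendsto_integral (hF₁c.cthickening (r := η / 2)) hF₂Ω
      (fun j => (hMt j).continuous.aestronglyMeasurable)
      (fun j => hk.moll_abs_le (hτp n) (hGM j))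
      (fun j y hy => hk.moll_eq_zero (hτp n) (T := tsupport (G j))
        (fun _ => image_eq_zero_of_notMem_tsupport) fun hn => hy (hsub2 j hn))
      (ae_of_all _ fun y => ?_) hx
    obtain ⟨C, hC0, hC⟩ := hk.mkern_bounded (τ n) (hτp n)
    have cm : Continuous fun z => mkern ρ (τ n) (y - z) :=
      (hk.mkern_smooth (τ n)).continuous.comp (by fun_prop)
    refine tendsto_integral_of_dominated_convergence (fun z => M * mkern ρ (τ n) (y - z))
      (fun j => ((hGt j).continuous.mul cm).aestronglyMeasurable) ?_
      (fun j => ae_of_all _ fun z => ?_) (hGae.mono fun z hz => hz.mul_const _)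
    · refine Integrable.const_mul ?_ M
      by_contra hn
      have := hk.mkern_integral (hτp n) y
      rw [integral_undef hn] at this
      exact zero_ne_one this
    · rw [norm_mul, Real.norm_of_nonneg (hk.mkern_nonneg (hτp n) _)]
      exact mul_le_mul_of_nonneg_right (hGM j z) (hk.mkern_nonneg (hτp n) _)
  obtain ⟨m, P, -, hP⟩ := hk.exists_inverse (hτp n)
  refine le_of_tendsto_of_tendsto' t2 t1 fun j => ?_
  obtain ⟨p1, p2, p3, -⟩ := hP (hGt j) ((hsub2 j).trans hF₂Ω)
  have hrep := hG.rep x hx _ p1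
  simp only [p2] at hrep
  rw [integral_sub (hG.integrable_test hx (hGt j)) (hG.integrable_test hx (hMt j))] at hrep
  linarith [p3 (hG0 j) x]

end IsAdm

end

section

variable {N : ℕ} {Ω : Set (Euc N)} {μ : Euc N → Measure (Euc N)} {u v g g' : Euc N → ℝ}

/-- `x ↦ ∫ g dμ_x` is measurable and solves `-Δ p = g` in the sense of distributions. -/
def WeakPot (Ω : Set (Euc N)) (μ : Euc N → Measure (Euc N)) (g : Euc N → ℝ) : Prop :=
  AEStronglyMeasurable (fun x => ∫ y, g y ∂μ x) (volume.restrict Ω) ∧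
    ∀ θ, IsTest Ω θ → ∫ x in Ω, (∫ y, g y ∂μ x) * -lap θ x = ∫ x, g x * θ x

/-- Dominated convergence for functions bounded by a multiple of an integrable one on `Ω`. -/
theorem tendsto_setIntegral_mul {ν : Measure (Euc N)} (hu : Integrable u ν)
    {a b : ℕ → Euc N → ℝ} {a₀ b₀ : Euc N → ℝ}
    (ha : ∀ n, AEStronglyMeasurable (a n) ν) (hb : ∀ n, AEStronglyMeasurable (b n) ν) {C : ℝ}
    (ha0 : ∀ n, ∀ᵐ x ∂ν, 0 ≤ a n x) (hau : ∀ n, ∀ᵐ x ∂ν, a n x ≤ u x)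
    (hbC : ∀ n x, |b n x| ≤ C)
    (hat : ∀ᵐ x ∂ν, Tendsto (fun n => a n x) atTop (𝓝 (a₀ x)))
    (hbt : ∀ᵐ x ∂ν, Tendsto (fun n => b n x) atTop (𝓝 (b₀ x))) :
    Tendsto (fun n => ∫ x, a n x * b n x ∂ν) atTop (𝓝 (∫ x, a₀ x * b₀ x ∂ν)) := by
  refine tendsto_integral_of_dominated_convergence (fun x => u x * C)
    (fun n => (ha n).mul (hb n)) (hu.mul_const C) (fun n => ?_) ?_
  · filter_upwards [ha0 n, hau n] with x h1 h2
    rw [norm_mul, Real.norm_of_nonneg h1]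
    exact mul_le_mul h2 (hbC n x) (norm_nonneg _) (h1.trans h2)
  · filter_upwards [hat, hbt] with x h1 h2 using h1.mul h2

theorem setIntegral_eq_of_test {θ k : Euc N → ℝ} (hθ : IsTest Ω θ) :
    ∫ x in Ω, k x * θ x = ∫ x, k x * θ x :=
  setIntegral_eq_integral_of_forall_compl_eq_zero fun x hx => by rw [hθ.eq_zero hx, mul_zero]

variable [NeZero N]

theorem IsBar.weakPot_of_test (h : IsBar Ω μ u v) (hΩ : IsOpen Ω)
    (hb : Bornology.IsBounded Ω) (hG : IsGreen Ω μ) (hg : IsTest Ω g) (hg0 : ∀ x, 0 ≤ g x)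
    (hp : ∀ x ∈ Ω, ∫ y, g y ∂μ x ≤ u x) : WeakPot Ω μ g := by
  obtain ⟨ψ, hψ, hlim⟩ := h.exists_approx hΩ hb hG hg hg0 hp
  refine ⟨aestronglyMeasurable_of_tendsto_ae atTop
    (fun n => (hψ.test n).continuous.aestronglyMeasurable) hlim, fun θ hθ => ?_⟩
  obtain ⟨C, hC0, hC⟩ := hθ.lap.bounded
  have t1 : Tendsto (fun n => ∫ x in Ω, ψ n x * -lap θ x) atTop
      (𝓝 (∫ x in Ω, (∫ y, g y ∂μ x) * -lap θ x)) := by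
    refine tendsto_setIntegral_mul (h.integrableOn hb)
      (fun n => (hψ.test n).continuous.aestronglyMeasurable)
      (fun n => hθ.lap.continuous.neg.aestronglyMeasurable) (C := C)
      (fun n => ae_of_all _ (hψ.nonneg n)) (fun n => ?_) (fun n x => by rw [abs_neg]; exact hC x)
      hlim (ae_of_all _ fun x => tendsto_const_nhds)
    filter_upwards [ae_restrict_mem hΩ.measurableSet] with x hx
    exact (hG.test_le hg (hψ.test n) (hψ.le n) hx).trans (hp x hx)
  obtain ⟨χ, hχ, hχ1, hχI⟩ := exists_cutoff hΩ hθ.compact hθ.sub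
  obtain ⟨D, hD0, hD⟩ := hθ.bounded
  have heq : ∀ n, ∫ x in Ω, ψ n x * -lap θ x = ∫ x, -lap (ψ n) x * θ x := fun n => by
    rw [setIntegral_eq_of_test hθ.lap.neg]
    simp only [mul_neg, neg_mul, integral_neg]
    rw [integral_mul_lap ((hψ.test n).smooth.of_le two_le_infty)
      (hθ.smooth.of_le two_le_infty) hθ.compact]
  refine tendsto_nhds_unique t1 ?_
  simp only [heq]
  rw [tendsto_iff_norm_sub_tendsto_zero]
  refine squeeze_zero (g := fun n => D * ∫ x, χ x * (g x + lap (ψ n) x))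
    (fun _ => norm_nonneg _) (fun n => ?_) ?_
  · have i1 : Integrable fun x => -lap (ψ n) x * θ x := integrable_mul_test hΩ
      (hψ.test n).lap.continuous.neg.continuousOn hθ
    have i2 : Integrable fun x => g x * θ x := integrable_mul_test hΩ hg.continuous.continuousOn hθ
    rw [← integral_sub i1 i2, ← integral_const_mul]
    refine (norm_integral_le_integral_norm _).trans (integral_mono (i1.sub i2).norm
      ((hχ.mul_smooth (hg.smooth.add (hψ.test n).smooth.lap)).integrable.const_mul D) fun x => ?_)
    have hl0 : 0 ≤ g x + lap (ψ n) x := by linarith [hψ.le n x]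
    have e : -lap (ψ n) x * θ x - g x * θ x = -((g x + lap (ψ n) x) * θ x) := by ring
    simp only
    rw [e, norm_neg, norm_mul, Real.norm_of_nonneg hl0]
    by_cases hx : x ∈ tsupport θ
    · rw [hχ1.self_of_nhdsSet x hx, one_mul, mul_comm]
      exact mul_le_mul_of_nonneg_right (hD x) hl0
    · rw [image_eq_zero_of_notMem_tsupport hx, norm_zero, mul_zero]
      exact mul_nonneg hD0 (mul_nonneg (hχI x).1 hl0)
  · simpa using (hψ.tendsto_zero hG hΩ hg hχ hχI).1.const_mul D

namespace IsAdm

theorem weakPot (ha : IsAdm Ω μ u g) (h : IsBar Ω μ u v) (hΩ : IsOpen Ω)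
    (hb : Bornology.IsBounded Ω) (hG : IsGreen Ω μ) : WeakPot Ω μ g := by
  obtain ⟨G, M, F, hF, hFΩ, hGt, hG0, hGM, hGz, hGa, hGae⟩ := ha.exists_smooth hΩ hG
  have hw := fun n => h.weakPot_of_test hΩ hb hG (hGt n) (hG0 n) (hGa n).le
  have hlim : ∀ᵐ x ∂volume.restrict Ω,
      Tendsto (fun n => ∫ y, G n y ∂μ x) atTop (𝓝 (∫ y, g y ∂μ x)) := by
    filter_upwards [ae_restrict_mem hΩ.measurableSet] with x hx
    exact hG.tendsto_integral hF hFΩ (fun n => (hGt n).continuous.aestronglyMeasurable)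
      hGM hGz hGae hx
  refine ⟨aestronglyMeasurable_of_tendsto_ae atTop (fun n => (hw n).1) hlim, fun θ hθ => ?_⟩
  obtain ⟨C, hC0, hC⟩ := hθ.lap.bounded
  have t1 : Tendsto (fun n => ∫ x in Ω, (∫ y, G n y ∂μ x) * -lap θ x) atTop
      (𝓝 (∫ x in Ω, (∫ y, g y ∂μ x) * -lap θ x)) := by
    refine tendsto_setIntegral_mul (h.integrableOn hb) (fun n => (hw n).1)
      (fun n => hθ.lap.continuous.neg.aestronglyMeasurable) (C := C)
      (fun n => ae_of_all _ fun x => integral_nonneg (hG0 n))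
      (fun n => (ae_restrict_mem hΩ.measurableSet).mono fun x hx => (hGa n).le x hx)
      (fun n x => by rw [abs_neg]; exact hC x)
      hlim (ae_of_all _ fun x => tendsto_const_nhds)
  refine tendsto_nhds_unique t1 ?_
  simp only [(hw _).2 θ hθ]
  refine tendsto_integral_of_dominated_convergence (fun x => M * ‖θ x‖)
    (fun n => ((hGt n).continuous.mul hθ.continuous).aestronglyMeasurable)
    (hθ.integrable.norm.const_mul M) (fun n => ae_of_all _ fun x => ?_)
    (hGae.mono fun x hx => hx.mul_const _)
  rw [norm_mul]
  exact mul_le_mul_of_nonneg_right (hGM n x) (norm_nonneg _)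

theorem integral_mul_le (ha : IsAdm Ω μ u g) (ha' : IsAdm Ω μ u g') (h : IsBar Ω μ u v)
    (hΩ : IsOpen Ω) (hb : Bornology.IsBounded Ω) (hG : IsGreen Ω μ) :
    ∫ x in Ω, (∫ y, g y ∂μ x) * g' x ≤ ∫ x in Ω, (∫ y, g' y ∂μ x) * g x := by
  obtain ⟨M', hM'⟩ := ha'.exists_bound
  have hw' := ha'.weakPot h hΩ hb hG
  have hp'0 : ∀ x, 0 ≤ ∫ y, g' y ∂μ x := fun x => integral_nonneg ha'.nonneg
  have hΩm : ∀ᵐ x ∂volume.restrict Ω, x ∈ Ω := ae_restrict_mem hΩ.measurableSet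
  have smooth_case : ∀ k, IsTest Ω k → IsAdm Ω μ u k →
      ∫ x in Ω, (∫ y, k y ∂μ x) * g' x ≤ ∫ x in Ω, (∫ y, g' y ∂μ x) * k x := by
    intro k hk hka
    obtain ⟨ψ, hψ, hlim⟩ := h.exists_approx hΩ hb hG hk hka.nonneg hka.le
    have t1 : Tendsto (fun n => ∫ x in Ω, ψ n x * g' x) atTop
        (𝓝 (∫ x in Ω, (∫ y, k y ∂μ x) * g' x)) := by
      refine tendsto_setIntegral_mul (h.integrableOn hb)
        (fun n => (hψ.test n).continuous.aestronglyMeasurable)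
        (fun n => ha'.meas.restrict) (C := M')
        (fun n => ae_of_all _ (hψ.nonneg n)) (fun n => ?_) (fun n => hM')
        hlim (ae_of_all _ fun x => tendsto_const_nhds)
      filter_upwards [hΩm] with x hx
      exact (hG.test_le hk (hψ.test n) (hψ.le n) hx).trans (hka.le x hx)
    refine le_of_tendsto' t1 fun n => ?_
    have hInt : ∀ {b : Euc N → ℝ}, IsTest Ω b →
        IntegrableOn (fun x => (∫ y, g' y ∂μ x) * b x) Ω := fun {b} hb' => by
      obtain ⟨C, hC0, hC⟩ := hb'.bounded
      refine Integrable.mono' ((h.integrableOn hb).mul_const C)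
        (hw'.1.mul hb'.continuous.aestronglyMeasurable) ?_
      filter_upwards [hΩm] with x hx
      rw [norm_mul, Real.norm_of_nonneg (hp'0 x)]
      exact mul_le_mul (ha'.le x hx) (hC x) (norm_nonneg _) (h.pos x hx).le
    calc ∫ x in Ω, ψ n x * g' x = ∫ x in Ω, g' x * ψ n x := by simp only [mul_comm]
      _ = ∫ x, g' x * ψ n x := setIntegral_eq_of_test (hψ.test n)
      _ = ∫ x in Ω, (∫ y, g' y ∂μ x) * -lap (ψ n) x := (hw'.2 _ (hψ.test n)).symm
      _ ≤ ∫ x in Ω, (∫ y, g' y ∂μ x) * k x :=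
        integral_mono (hInt (hψ.test n).lap.neg) (hInt hk)
          fun x => mul_le_mul_of_nonneg_left (hψ.le n x) (hp'0 x)
  obtain ⟨G, M, F, hF, hFΩ, hGt, hG0, hGM, hGz, hGa, hGae⟩ := ha.exists_smooth hΩ hG
  have hlim : ∀ᵐ x ∂volume.restrict Ω,
      Tendsto (fun n => ∫ y, G n y ∂μ x) atTop (𝓝 (∫ y, g y ∂μ x)) := by
    filter_upwards [hΩm] with x hx
    exact hG.tendsto_integral hF hFΩ (fun n => (hGt n).continuous.aestronglyMeasurable)
      hGM hGz hGae hx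
  refine le_of_tendsto_of_tendsto' (b := atTop) ?_ ?_ fun n => smooth_case _ (hGt n) (hGa n)
  · exact tendsto_setIntegral_mul (h.integrableOn hb)
      (fun n => ((hGa n).weakPot h hΩ hb hG).1) (fun n => ha'.meas.restrict) (C := M')
      (fun n => ae_of_all _ fun x => integral_nonneg (hG0 n))
      (fun n => hΩm.mono fun x hx => (hGa n).le x hx) (fun n => hM')
      hlim (ae_of_all _ fun x => tendsto_const_nhds)
  · exact tendsto_setIntegral_mul (h.integrableOn hb) (fun n => hw'.1)
      (fun n => (hGt n).continuous.aestronglyMeasurable) (C := M)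
      (fun n => ae_of_all _ hp'0)
      (fun n => hΩm.mono fun x hx => ha'.le x hx) hGM
      (ae_of_all _ fun x => tendsto_const_nhds) (ae_restrict_of_ae hGae)

/-- Symmetry of the Green kernel. -/
theorem integral_mul_comm (ha : IsAdm Ω μ u g) (ha' : IsAdm Ω μ u g') (h : IsBar Ω μ u v)
    (hΩ : IsOpen Ω) (hb : Bornology.IsBounded Ω) (hG : IsGreen Ω μ) :
    ∫ x in Ω, (∫ y, g y ∂μ x) * g' x = ∫ x in Ω, (∫ y, g' y ∂μ x) * g x :=
  le_antisymm (ha.integral_mul_le ha' h hΩ hb hG) (ha'.integral_mul_le ha h hΩ hb hG)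

end IsAdm

end

section

variable {N : ℕ} {Ω : Set (Euc N)} {μ : Euc N → Measure (Euc N)} {u v : Euc N → ℝ}

/-- Truncation of `a` at height `k` and to the region where `u` is not small. -/
def cut (Ω : Set (Euc N)) (u a : Euc N → ℝ) (k : ℕ) : Euc N → ℝ :=
  {y | y ∈ closure Ω ∧ 1 / ((k:ℝ) + 1) ≤ u y}.indicator fun y => min (a y) k

namespace IsBar

theorem cut_supp (h : IsBar Ω μ u v) (hΩ : IsOpen Ω) (hb : Bornology.IsBounded Ω) (k : ℕ) :
    IsCompact {y | y ∈ closure Ω ∧ 1 / ((k:ℝ) + 1) ≤ u y} ∧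
      {y | y ∈ closure Ω ∧ 1 / ((k:ℝ) + 1) ≤ u y} ⊆ Ω :=
  isCompact_superlevel hΩ hb h.cont (fun x hx => (h.zero x hx).le) (by positivity)

variable {a : Euc N → ℝ}

theorem cut_nonneg (h : IsBar Ω μ u v) (hΩ : IsOpen Ω) (hb : Bornology.IsBounded Ω)
    (ha : ∀ x ∈ Ω, 0 ≤ a x) (k : ℕ) (x : Euc N) : 0 ≤ cut Ω u a k x :=
  indicator_nonneg (fun y hy => le_min (ha y ((h.cut_supp hΩ hb k).2 hy)) (Nat.cast_nonneg k)) x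

theorem cut_le (ha : ∀ x ∈ Ω, 0 ≤ a x) (k : ℕ) {x : Euc N} (hx : x ∈ Ω) : cut Ω u a k x ≤ a x :=
  indicator_apply_le' (fun _ => min_le_left _ _) fun _ => ha x hx

theorem cut_monotone (h : IsBar Ω μ u v) (hΩ : IsOpen Ω) (hb : Bornology.IsBounded Ω)
    (ha : ∀ x ∈ Ω, 0 ≤ a x) (x : Euc N) : Monotone fun k => cut Ω u a k x := by
  intro j k hjk
  simp only
  by_cases hx : x ∈ {y | y ∈ closure Ω ∧ 1 / ((j:ℝ) + 1) ≤ u y}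
  · have hx' : x ∈ {y | y ∈ closure Ω ∧ 1 / ((k:ℝ) + 1) ≤ u y} := by
      refine ⟨hx.1, le_trans ?_ hx.2⟩
      have : (j:ℝ) ≤ k := by exact_mod_cast hjk
      exact one_div_le_one_div_of_le (by positivity) (by linarith)
    rw [cut, cut, indicator_of_mem hx, indicator_of_mem hx']
    exact min_le_min le_rfl (by exact_mod_cast hjk)
  · rw [cut, indicator_of_notMem hx]
    exact h.cut_nonneg hΩ hb ha k x

theorem cut_eventually (h : IsBar Ω μ u v) {x : Euc N} (hx : x ∈ Ω) :
    ∀ᶠ k in atTop, cut Ω u a k x = a x := by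
  have hlim : Tendsto (fun n : ℕ => (1 / ((n:ℝ) + 1))) atTop (𝓝 0) :=
    tendsto_one_div_add_atTop_nhds_zero_nat
  filter_upwards [hlim.eventually_lt_const (h.pos x hx),
    tendsto_natCast_atTop_atTop.eventually_ge_atTop (a x)] with k h1 h2
  rw [cut, indicator_of_mem (show x ∈ {y | y ∈ closure Ω ∧ 1 / ((k:ℝ) + 1) ≤ u y} from
    ⟨subset_closure hx, h1.le⟩), min_eq_left h2]

theorem cut_meas (h : IsBar Ω μ u v) (hΩ : IsOpen Ω) (hb : Bornology.IsBounded Ω)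
    (ha : AEStronglyMeasurable a (volume.restrict Ω)) (k : ℕ) :
    AEStronglyMeasurable (cut Ω u a k) volume := by
  have hF := h.cut_supp hΩ hb k
  rw [cut, aestronglyMeasurable_indicator_iff hF.1.measurableSet]
  exact ((ha.mono_measure (Measure.restrict_mono hF.2 le_rfl)).inf
    aestronglyMeasurable_const)

theorem cut_isAdm (h : IsBar Ω μ u v) (hΩ : IsOpen Ω) (hb : Bornology.IsBounded Ω)
    (ha : ∀ x ∈ Ω, 0 ≤ a x) (ham : AEStronglyMeasurable a (volume.restrict Ω)) (k : ℕ)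
    {u' : Euc N → ℝ} (hle : ∀ x ∈ Ω, ∫ y, cut Ω u a k y ∂μ x ≤ u' x) :
    IsAdm Ω μ u' (cut Ω u a k) where
  meas := h.cut_meas hΩ hb ham k
  nonneg := h.cut_nonneg hΩ hb ha k
  bdd := ⟨k, fun _ => indicator_apply_le' (fun _ => min_le_right _ _) fun _ => Nat.cast_nonneg k⟩
  supp := ⟨_, (h.cut_supp hΩ hb k).1, (h.cut_supp hΩ hb k).2, fun _ hx => indicator_of_notMem hx _⟩
  le := hle

theorem lintegral_cut_tendsto (h : IsBar Ω μ u v) (hΩ : IsOpen Ω) (hb : Bornology.IsBounded Ω)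
    (hG : IsGreen Ω μ) (ha : ∀ x ∈ Ω, 0 ≤ a x) (ham : AEStronglyMeasurable a (volume.restrict Ω))
    {x : Euc N} (hx : x ∈ Ω) :
    Tendsto (fun k => ∫⁻ y, ENNReal.ofReal (cut Ω u a k y) ∂μ x) atTop
      (𝓝 (∫⁻ y, ENNReal.ofReal (a y) ∂μ x)) := by
  refine lintegral_tendsto_of_tendsto_of_monotone (fun k =>
    ((h.cut_meas hΩ hb ham k).mono_ac (hG.ac x hx)).aemeasurable.ennreal_ofReal)
    (ae_of_all _ fun y j k hjk => ENNReal.ofReal_le_ofReal (h.cut_monotone hΩ hb ha y hjk))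
    ((hG.ae_mem hx).mono fun y hy => tendsto_nhds_of_eventually_eq ?_)
  filter_upwards [h.cut_eventually (a := a) hy] with k hk
  rw [hk]

variable [NeZero N]

/-- A nonnegative density with potential `u` coincides with `-Δu`. -/
theorem ae_eq_of_rep (h : IsBar Ω μ u v) (hΩ : IsOpen Ω) (hb : Bornology.IsBounded Ω)
    (hne : Ω.Nonempty) (hG : IsGreen Ω μ) {V : Euc N → ℝ} (hV0 : ∀ x ∈ Ω, 0 ≤ V x)
    (hVi : ∀ x ∈ Ω, Integrable V (μ x)) (hVu : ∀ x ∈ Ω, u x = ∫ y, V y ∂μ x) :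
    ∀ᵐ x, x ∈ Ω → V x = v x := by
  obtain ⟨x₀, hx₀⟩ := hne
  have hVm : AEStronglyMeasurable V (volume.restrict Ω) :=
    (hVi x₀ hx₀).aestronglyMeasurable.mono_ac (hG.ac' x₀ hx₀)
  have hadm : ∀ k, IsAdm Ω μ u (cut Ω u V k) := fun k => by
    refine h.cut_isAdm hΩ hb hV0 hVm k fun x hx => ?_
    rw [hVu x hx]
    refine integral_mono_of_nonneg (ae_of_all _ (h.cut_nonneg hΩ hb hV0 k)) (hVi x hx) ?_
    exact (hG.ae_mem hx).mono fun y hy => cut_le hV0 k hy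
  have hcutlim : ∀ x ∈ Ω, Tendsto (fun k => cut Ω u V k x) atTop (𝓝 (V x)) := fun x hx =>
    tendsto_nhds_of_eventually_eq (h.cut_eventually hx)
  have hplim : ∀ x ∈ Ω, Tendsto (fun k => ∫ y, cut Ω u V k y ∂μ x) atTop (𝓝 (u x)) := by
    intro x hx
    rw [hVu x hx]
    refine tendsto_integral_of_dominated_convergence V
      (fun k => (hadm k).meas.mono_ac (hG.ac x hx)) (hVi x hx) (fun k => ?_)
      ((hG.ae_mem hx).mono hcutlim)
    filter_upwards [hG.ae_mem hx] with y hy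
    rw [Real.norm_of_nonneg ((hadm k).nonneg y)]
    exact cut_le hV0 k hy
  have hΩm : ∀ᵐ x ∂volume.restrict Ω, x ∈ Ω := ae_restrict_mem hΩ.measurableSet
  have key : ∀ θ, IsTest Ω θ →
      Tendsto (fun k => ∫ x, cut Ω u V k x * θ x) atTop (𝓝 (∫ x, v x * θ x)) := by
    intro θ hθ
    obtain ⟨C, -, hC⟩ := hθ.lap.bounded
    have hw := fun k => (hadm k).weakPot h hΩ hb hG
    rw [← h.weak θ hθ, ← setIntegral_eq_of_test hθ.lap.neg]
    refine (tendsto_setIntegral_mul (h.integrableOn hb) (fun k => (hw k).1)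
      (fun k => hθ.lap.continuous.neg.aestronglyMeasurable) (C := C)
      (fun k => ae_of_all _ fun x => integral_nonneg (hadm k).nonneg)
      (fun k => hΩm.mono (hadm k).le) (fun k x => (abs_neg (lap θ x)).trans_le (hC x))
      (hΩm.mono hplim) (ae_of_all _ fun x => tendsto_const_nhds)).congr fun k => ?_
    exact (hw k).2 θ hθ
  have hInt : ∀ χ, IsTest Ω χ → (∀ x, 0 ≤ χ x) → IntegrableOn (fun x => V x * χ x) Ω := by
    intro χ hχ hχ0
    have hm : AEStronglyMeasurable (fun x => V x * χ x) (volume.restrict Ω) :=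
      hVm.mul hχ.continuous.aestronglyMeasurable
    have t : Tendsto (fun k => ∫⁻ x in Ω, ENNReal.ofReal (cut Ω u V k x * χ x)) atTop
        (𝓝 (∫⁻ x in Ω, ENNReal.ofReal (V x * χ x))) := by
      refine lintegral_tendsto_of_tendsto_of_monotone (fun k =>
        ((hadm k).meas.restrict.mul
          hχ.continuous.aestronglyMeasurable).aemeasurable.ennreal_ofReal)
        (ae_of_all _ fun y j k hjk => ENNReal.ofReal_le_ofReal
          (mul_le_mul_of_nonneg_right (h.cut_monotone hΩ hb hV0 y hjk) (hχ0 y)))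
        (hΩm.mono fun y hy => ENNReal.tendsto_ofReal ((hcutlim y hy).mul_const _))
    have t' : Tendsto (fun k => ∫⁻ x in Ω, ENNReal.ofReal (cut Ω u V k x * χ x)) atTop
        (𝓝 (ENNReal.ofReal (∫ x, v x * χ x))) := by
      refine (ENNReal.tendsto_ofReal (key χ hχ)).congr fun k => ?_
      rw [← setIntegral_eq_of_test hχ]
      obtain ⟨M, hM⟩ := (hadm k).bdd
      refine ofReal_integral_eq_lintegral_ofReal ?_
        (ae_of_all _ fun x => mul_nonneg ((hadm k).nonneg x) (hχ0 x))
      refine Integrable.mono' (hχ.integrable.const_mul M).integrableOn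
        ((hadm k).meas.restrict.mul hχ.continuous.aestronglyMeasurable) (ae_of_all _ fun x => ?_)
      rw [norm_mul, Real.norm_of_nonneg ((hadm k).nonneg x), Real.norm_of_nonneg (hχ0 x)]
      exact mul_le_mul_of_nonneg_right (hM x) (hχ0 x)
    refine ⟨hm, ?_⟩
    rw [hasFiniteIntegral_iff_ofReal (hΩm.mono fun x hx => mul_nonneg (hV0 x hx) (hχ0 x)),
      tendsto_nhds_unique t t']
    exact ENNReal.ofReal_lt_top
  have hloc : LocallyIntegrableOn V Ω := by
    rw [locallyIntegrableOn_iff hΩ.isLocallyClosed]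
    intro F hFΩ hF
    obtain ⟨χ, hχ, hχ1, hχI⟩ := exists_cutoff hΩ hF hFΩ
    refine ((hInt χ hχ fun x => (hχI x).1).mono_set hFΩ).congr_fun (fun x hx => ?_)
      hF.measurableSet
    simp only
    rw [hχ1.self_of_nhdsSet x hx, mul_one]
  have hvloc : LocallyIntegrableOn v Ω := h.cont'.locallyIntegrableOn hΩ.measurableSet
  have := hΩ.ae_eq_zero_of_integral_contDiff_smul_eq_zero (hloc.sub hvloc) fun θ h1 h2 h3 => by
    have hθ : IsTest Ω θ := ⟨h1, h2, h3⟩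
    obtain ⟨χ, hχ, hχ1, hχI⟩ := exists_cutoff hΩ hθ.compact hθ.sub
    obtain ⟨D, hD0, hD⟩ := hθ.bounded
    have hdom := (hInt χ hχ fun x => (hχI x).1).mul_const D
    have hbound : ∀ x ∈ Ω, ‖V x * θ x‖ ≤ V x * χ x * D := fun x hx => by
      rw [norm_mul, Real.norm_of_nonneg (hV0 x hx)]
      by_cases hxt : x ∈ tsupport θ
      · rw [hχ1.self_of_nhdsSet x hxt, mul_one]
        exact mul_le_mul_of_nonneg_left (hD x) (hV0 x hx)
      · rw [image_eq_zero_of_notMem_tsupport hxt, norm_zero, mul_zero]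
        exact mul_nonneg (mul_nonneg (hV0 x hx) (hχI x).1) hD0
    have hi : IntegrableOn (fun x => V x * θ x) Ω :=
      Integrable.mono' hdom (hVm.mul hθ.continuous.aestronglyMeasurable) (hΩm.mono hbound)
    have t : Tendsto (fun k => ∫ x in Ω, cut Ω u V k x * θ x) atTop
        (𝓝 (∫ x in Ω, V x * θ x)) := by
      refine tendsto_integral_of_dominated_convergence _
        (fun k => (hadm k).meas.restrict.mul hθ.continuous.aestronglyMeasurable) hdom
        (fun k => hΩm.mono fun x hx => le_trans ?_ (hbound x hx))
        (hΩm.mono fun x hx => (hcutlim x hx).mul_const _)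
      rw [norm_mul, norm_mul]
      refine mul_le_mul_of_nonneg_right ?_ (norm_nonneg _)
      rw [Real.norm_of_nonneg ((hadm k).nonneg x), Real.norm_of_nonneg (hV0 x hx)]
      exact cut_le hV0 k hx
    have e : ∫ x in Ω, V x * θ x = ∫ x in Ω, v x * θ x := by
      rw [setIntegral_eq_of_test hθ (k := v)]
      refine tendsto_nhds_unique t ((key θ hθ).congr fun k => ?_)
      rw [setIntegral_eq_of_test hθ]
    have hi' : IntegrableOn (fun x => v x * θ x) Ω := (integrable_mul_test hΩ h.cont' hθ).integrableOn
    have : ∫ x, θ x • (V - v) x = ∫ x in Ω, (V x * θ x - v x * θ x) := by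
      rw [← setIntegral_eq_integral_of_forall_compl_eq_zero (s := Ω)
        fun x hx => by rw [hθ.eq_zero hx, zero_smul]]
      refine integral_congr_ae (ae_of_all _ fun x => ?_)
      simp only [smul_eq_mul, Pi.sub_apply]
      ring
    rw [this, integral_sub hi hi', e, sub_self]
  filter_upwards [this] with x hx hxΩ
  have := hx hxΩ
  simpa [sub_eq_zero] using this

end IsBar

end

section

variable {N : ℕ} {Ω : Set (Euc N)} {μ : Euc N → Measure (Euc N)} {u v a b : Euc N → ℝ}

namespace IsBar

theorem exists_integral_cut_le (h : IsBar Ω μ u v) (hΩ : IsOpen Ω) (hb : Bornology.IsBounded Ω)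
    (hG : IsGreen Ω μ) (hv : ∀ x ∈ Ω, 0 < v x) (ha : ∀ x ∈ Ω, 0 ≤ a x) (k : ℕ) :
    ∃ C > 0, ∀ x ∈ Ω, ∫ y, cut Ω u a k y ∂μ x ≤ C * u x := by
  have hF := h.cut_supp hΩ hb k
  obtain ⟨m, hm, hmv⟩ := hF.1.exists_forall_le' (h.cont'.mono hF.2) fun y hy => hv y (hF.2 hy)
  refine ⟨k / m + 1, by positivity, fun x hx => ?_⟩
  rw [h.rep x hx, ← integral_const_mul]
  refine integral_mono_of_nonneg (ae_of_all _ (h.cut_nonneg hΩ hb ha k))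
    ((h.integrable x hx).const_mul _) ((hG.ae_mem hx).mono fun y hy => ?_)
  have hC : (0:ℝ) ≤ k / m + 1 := by positivity
  refine indicator_apply_le' (fun hy' => ?_) fun _ => mul_nonneg hC (hv y hy).le
  calc min (a y) k ≤ k := min_le_right _ _
    _ = k / m * m := by field_simp
    _ ≤ (k / m + 1) * v y := mul_le_mul (by linarith) (hmv y hy') hm.le hC

theorem cut_isAdm_max (h : IsBar Ω μ u v) (hΩ : IsOpen Ω) (hb : Bornology.IsBounded Ω)
    (ha : ∀ x ∈ Ω, 0 ≤ a x) (ham : AEStronglyMeasurable a (volume.restrict Ω)) (k : ℕ)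
    {C D : ℝ} (hCD : C ≤ D) (hle : ∀ x ∈ Ω, ∫ y, cut Ω u a k y ∂μ x ≤ C * u x) :
    IsAdm Ω μ (fun x => D * u x) (cut Ω u a k) :=
  h.cut_isAdm hΩ hb ha ham k fun x hx =>
    (hle x hx).trans (mul_le_mul_of_nonneg_right hCD (h.pos x hx).le)

end IsBar

variable [NeZero N]

theorem IsAdm.lintegral_mul {g g' : Euc N → ℝ} (ha : IsAdm Ω μ u g) (ha' : IsAdm Ω μ u g')
    (h : IsBar Ω μ u v) (hΩ : IsOpen Ω) (hb : Bornology.IsBounded Ω) (hG : IsGreen Ω μ) :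
    ∫⁻ x in Ω, (∫⁻ y, ENNReal.ofReal (g y) ∂μ x) * ENNReal.ofReal (g' x) =
      ENNReal.ofReal (∫ x in Ω, (∫ y, g y ∂μ x) * g' x) := by
  have hΩm : ∀ᵐ x ∂volume.restrict Ω, x ∈ Ω := ae_restrict_mem hΩ.measurableSet
  have hm := (ha.weakPot h hΩ hb hG).1
  have hnn : ∀ x, 0 ≤ ∫ y, g y ∂μ x := fun x => integral_nonneg ha.nonneg
  obtain ⟨M, hM⟩ := ha'.bdd
  rw [ofReal_integral_eq_lintegral_ofReal]
  · refine lintegral_congr_ae (hΩm.mono fun x hx => ?_)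
    simp only
    rw [ENNReal.ofReal_mul (hnn x), ofReal_integral_eq_lintegral_ofReal (ha.integrable_green hG hx)
      (ae_of_all _ ha.nonneg)]
  · refine Integrable.mono' ((h.integrableOn hb).mul_const M) (hm.mul ha'.meas.restrict)
      (hΩm.mono fun x hx => ?_)
    rw [norm_mul, Real.norm_of_nonneg (hnn x), Real.norm_of_nonneg (ha'.nonneg x)]
    exact mul_le_mul (ha.le x hx) (hM x) (ha'.nonneg x) (h.pos x hx).le
  · exact ae_of_all _ fun x => mul_nonneg (hnn x) (ha'.nonneg x)

theorem IsAdm.aemeasurable_lintegral {g : Euc N → ℝ} (ha : IsAdm Ω μ u g)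
    (h : IsBar Ω μ u v) (hΩ : IsOpen Ω) (hb : Bornology.IsBounded Ω) (hG : IsGreen Ω μ) :
    AEMeasurable (fun x => ∫⁻ y, ENNReal.ofReal (g y) ∂μ x) (volume.restrict Ω) := by
  refine (ha.weakPot h hΩ hb hG).1.aemeasurable.ennreal_ofReal.congr ?_
  filter_upwards [ae_restrict_mem hΩ.measurableSet] with x hx
  rw [ofReal_integral_eq_lintegral_ofReal (ha.integrable_green hG hx) (ae_of_all _ ha.nonneg)]

/-- Symmetry of the Green operator on nonnegative densities. -/
theorem IsBar.lintegral_comm (h : IsBar Ω μ u v) (hΩ : IsOpen Ω) (hb : Bornology.IsBounded Ω)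
    (hG : IsGreen Ω μ) (hv : ∀ x ∈ Ω, 0 < v x)
    (ha : ∀ x ∈ Ω, 0 ≤ a x) (ham : AEStronglyMeasurable a (volume.restrict Ω))
    (hb0 : ∀ x ∈ Ω, 0 ≤ b x) (hbm : AEStronglyMeasurable b (volume.restrict Ω)) :
    ∫⁻ x in Ω, (∫⁻ y, ENNReal.ofReal (a y) ∂μ x) * ENNReal.ofReal (b x) =
      ∫⁻ x in Ω, (∫⁻ y, ENNReal.ofReal (b y) ∂μ x) * ENNReal.ofReal (a x) := by
  have hΩm : ∀ᵐ x ∂volume.restrict Ω, x ∈ Ω := ae_restrict_mem hΩ.measurableSet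
  have hadm : ∀ k, ∃ D > 0, IsAdm Ω μ (fun x => D * u x) (cut Ω u a k) ∧
      IsAdm Ω μ (fun x => D * u x) (cut Ω u b k) := fun k => by
    obtain ⟨C, hC, hCu⟩ := h.exists_integral_cut_le hΩ hb hG hv ha k
    obtain ⟨D, hD, hDu⟩ := h.exists_integral_cut_le hΩ hb hG hv hb0 k
    exact ⟨max C D, lt_max_of_lt_left hC, h.cut_isAdm_max hΩ hb ha ham k (le_max_left _ _) hCu,
      h.cut_isAdm_max hΩ hb hb0 hbm k (le_max_right _ _) hDu⟩
  have lim : ∀ {c d : Euc N → ℝ}, (∀ x ∈ Ω, 0 ≤ c x) →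
      AEStronglyMeasurable c (volume.restrict Ω) → (∀ x ∈ Ω, 0 ≤ d x) →
      (∀ k, ∃ D > 0, IsAdm Ω μ (fun x => D * u x) (cut Ω u c k) ∧
        IsAdm Ω μ (fun x => D * u x) (cut Ω u d k)) →
      Tendsto (fun k => ∫⁻ x in Ω, (∫⁻ y, ENNReal.ofReal (cut Ω u c k y) ∂μ x) *
        ENNReal.ofReal (cut Ω u d k x)) atTop
        (𝓝 (∫⁻ x in Ω, (∫⁻ y, ENNReal.ofReal (c y) ∂μ x) * ENNReal.ofReal (d x))) := by
    intro c d hc hcm hd hcd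
    refine lintegral_tendsto_of_tendsto_of_monotone (fun k => ?_)
      (ae_of_all _ fun x j k hjk => ?_) (hΩm.mono fun x hx => ?_)
    · obtain ⟨D, hD, h1, h2⟩ := hcd k
      exact (h1.aemeasurable_lintegral (h.const_mul hD) hΩ hb hG).mul
        h2.meas.restrict.aemeasurable.ennreal_ofReal
    · exact mul_le_mul' (lintegral_mono fun y => ENNReal.ofReal_le_ofReal
        (h.cut_monotone hΩ hb hc y hjk)) (ENNReal.ofReal_le_ofReal (h.cut_monotone hΩ hb hd x hjk))
    · refine (ENNReal.Tendsto.mul_const (h.lintegral_cut_tendsto hΩ hb hG hc hcm hx)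
        (Or.inr ENNReal.ofReal_ne_top)).congr' ?_
      filter_upwards [h.cut_eventually (a := d) hx] with k hk
      rw [hk]
  refine tendsto_nhds_unique (lim ha ham hb0 hadm) ((lim hb0 hbm ha fun k => ?_).congr fun k => ?_)
  · obtain ⟨D, hD, h1, h2⟩ := hadm k
    exact ⟨D, hD, h2, h1⟩
  · obtain ⟨D, hD, h1, h2⟩ := hadm k
    rw [h1.lintegral_mul h2 (h.const_mul hD) hΩ hb hG, h2.lintegral_mul h1 (h.const_mul hD) hΩ hb hG,
      h1.integral_mul_comm h2 (h.const_mul hD) hΩ hb hG]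

end

section

variable {N : ℕ}

theorem pd_norm_sq (i : Fin N) (p x : Euc N) : pd i (fun z => ‖z - p‖ ^ 2) x = 2 * (x i - p i) := by
  have h : HasFDerivAt (fun z : Euc N => ‖z - p‖ ^ 2) _ x :=
    ((hasFDerivAt_id x).sub_const p).norm_sq
  rw [pd, h.fderiv]
  simp [EuclideanSpace.inner_single_right]

theorem lap_norm_sq (p x : Euc N) : lap (fun z => ‖z - p‖ ^ 2) x = 2 * N := by
  have h (i : Fin N) : pd i (pd i fun z : Euc N => ‖z - p‖ ^ 2) x = 2 := by
    have e : pd i (fun z : Euc N => ‖z - p‖ ^ 2) = fun z => 2 * (z i - p i) :=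
      funext fun z => pd_norm_sq i p z
    have h : HasFDerivAt (fun z : Euc N => 2 * (z i - p i)) _ x :=
      ((EuclideanSpace.proj (𝕜 := ℝ) i).hasFDerivAt.sub_const (p i)).const_mul 2
    rw [e, pd, h.fderiv]
    simp
  rw [lap, Finset.sum_congr rfl fun i _ => h i]
  simp [mul_comm]

theorem contDiff_norm_sub_sq (p : Euc N) : ContDiff ℝ ∞ fun z : Euc N => ‖z - p‖ ^ 2 :=
  (contDiff_id.sub contDiff_const).norm_sq ℝ

/-- The class of functions in `C²(closure Ω)` that vanish on `∂Ω`. -/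
structure IsC2Zero (Ω : Set (Euc N)) (ψ : Euc N → ℝ) : Prop where
  smooth : ContDiffOn ℝ 2 ψ (closure Ω)
  zero : ∀ x ∈ frontier Ω, ψ x = 0

theorem IsTest.isC2Zero {Ω : Set (Euc N)} {ψ : Euc N → ℝ} (h : IsTest Ω ψ) (hΩ : IsOpen Ω) :
    IsC2Zero Ω ψ where
  smooth := (h.smooth.of_le two_le_infty).contDiffOn
  zero x hx := h.eq_zero fun hx' => (hΩ.inter_frontier_eq.subset ⟨hx', hx⟩ : x ∈ (∅ : Set (Euc N)))

/-- The measure with density `G x` on `Ω`. -/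
def greenMeasure (Ω : Set (Euc N)) (G : Euc N → Euc N → ℝ) (x : Euc N) : Measure (Euc N) :=
  (volume.restrict Ω).withDensity fun y => ENNReal.ofReal (G x y)

/-- `G` is positive and represents all functions of `C²(closure Ω)` vanishing on `∂Ω`. -/
structure Represents (Ω : Set (Euc N)) (G : Euc N → Euc N → ℝ) : Prop where
  pos : ∀ x ∈ Ω, ∀ y ∈ Ω, 0 < G x y
  rep : ∀ ψ, IsC2Zero Ω ψ → ∀ x ∈ Ω, ψ x = ∫ y in Ω, G x y * -lapOn Ω ψ y

variable {Ω : Set (Euc N)} {G : Euc N → Euc N → ℝ} {u : Euc N → ℝ}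

theorem lapOn_add (hΩ : IsOpen Ω) (hΩd : UniqueDiffOn ℝ (closure Ω)) {ψ θ : Euc N → ℝ}
    (hψ : ContDiffOn ℝ 2 ψ (closure Ω)) (hθ : ContDiffOn ℝ 2 θ (closure Ω)) {x : Euc N}
    (hx : x ∈ Ω) : lapOn Ω (fun y => ψ y + θ y) x = lapOn Ω ψ x + lapOn Ω θ x := by
  have hn : closure Ω ∈ 𝓝 x := mem_of_superset (hΩ.mem_nhds hx) subset_closure
  rw [lapOn_eq_lap hΩ hΩd (hψ.add hθ) hx, lapOn_eq_lap hΩ hΩd hψ hx, lapOn_eq_lap hΩ hΩd hθ hx,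
    lap_add (hψ.contDiffAt hn) (hθ.contDiffAt hn)]

theorem WeakPair.congr_right {w g g' : Euc N → ℝ} (h : WeakPair Ω w g)
    (hgg' : ∀ x ∈ Ω, g x = g' x) : WeakPair Ω w g' := fun ψ hψ => by
  rw [h ψ hψ]
  refine integral_congr_ae (ae_of_all _ fun x => ?_)
  by_cases hx : x ∈ Ω
  · simp only [hgg' x hx]
  · simp only [hψ.eq_zero hx, mul_zero]

namespace Represents

theorem integrableOn (hR : Represents Ω G) (hΩ : IsOpen Ω) (hΩd : UniqueDiffOn ℝ (closure Ω))
    (hu : IsC2Zero Ω u) (hupos : ∀ x ∈ Ω, 0 < u x) {ψ : Euc N → ℝ} (hψ : IsC2Zero Ω ψ)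
    {x : Euc N} (hx : x ∈ Ω) : IntegrableOn (fun y => G x y * -lapOn Ω ψ y) Ω := by
  have hne : ∀ {θ}, IsC2Zero Ω θ → θ x ≠ 0 → IntegrableOn (fun y => G x y * -lapOn Ω θ y) Ω := by
    intro θ hθ hθx
    by_contra hc
    exact hθx ((hR.rep θ hθ x hx).trans (integral_undef hc))
  by_cases h0 : ψ x = 0
  · have hs : IsC2Zero Ω fun y => ψ y + u y :=
      ⟨hψ.smooth.add hu.smooth, fun y hy => by rw [hψ.zero y hy, hu.zero y hy, add_zero]⟩
    have h1 := hne hs (by rw [h0, zero_add]; exact (hupos x hx).ne')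
    refine IntegrableOn.congr_fun (Integrable.sub h1 (hne hu (hupos x hx).ne')) (fun y hy => ?_)
      hΩ.measurableSet
    simp only [Pi.sub_apply]
    rw [lapOn_add hΩ hΩd hψ.smooth hu.smooth hy]
    ring
  · exact hne hψ h0

theorem locallyIntegrableOn [NeZero N] (hR : Represents Ω G) (hΩ : IsOpen Ω)
    (hΩd : UniqueDiffOn ℝ (closure Ω)) (hu : IsC2Zero Ω u) (hupos : ∀ x ∈ Ω, 0 < u x)
    {x : Euc N} (hx : x ∈ Ω) : LocallyIntegrableOn (G x) Ω := by
  intro y hy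
  obtain ⟨χ, hχ, hχ1, -⟩ := exists_cutoff hΩ isCompact_singleton (singleton_subset_iff.2 hy)
  rw [nhdsSet_singleton] at hχ1
  have hψ := hχ.mul_smooth (contDiff_norm_sub_sq y)
  obtain ⟨U, hU, hUo, hyU⟩ := _root_.eventually_nhds_iff.1 hχ1
  have hi := hR.integrableOn hΩ hΩd hu hupos (hψ.isC2Zero hΩ) hx
  refine ⟨U ∩ Ω, mem_nhdsWithin_of_mem_nhds ((hUo.inter hΩ).mem_nhds ⟨hyU, hy⟩), ?_⟩
  refine IntegrableOn.congr_fun ((hi.mono_set inter_subset_right).mul_const (-(2 * N : ℝ)⁻¹))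
    (fun z hz => ?_) (hUo.inter hΩ).measurableSet
  have hN : (N : ℝ) ≠ 0 := Nat.cast_ne_zero.2 (NeZero.ne N)
  have e : (fun w => χ w * ‖w - y‖ ^ 2) =ᶠ[𝓝 z] fun w => ‖w - y‖ ^ 2 := by
    filter_upwards [hUo.mem_nhds hz.1] with w hw
    rw [hU w hw, one_mul]
  rw [lapOn_eq_lap hΩ hΩd (hψ.isC2Zero hΩ).smooth hz.2, lap_congr e, lap_norm_sq]
  field_simp

theorem integral_greenMeasure (hR : Represents Ω G) (hΩ : IsOpen Ω) {x : Euc N} (hx : x ∈ Ω)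
    (hl : LocallyIntegrableOn (G x) Ω) (f : Euc N → ℝ) :
    ∫ y, f y ∂greenMeasure Ω G x = ∫ y in Ω, G x y * f y := by
  rw [greenMeasure, integral_withDensity_eq_integral_toReal_smul₀
    hl.aestronglyMeasurable.aemeasurable.ennreal_ofReal (ae_of_all _ fun y => ENNReal.ofReal_lt_top)]
  refine setIntegral_congr_fun hΩ.measurableSet fun y hy => ?_
  simp only [smul_eq_mul]
  rw [ENNReal.toReal_ofReal (hR.pos x hx y hy).le]

theorem integrable_greenMeasure_iff (hR : Represents Ω G) (hΩ : IsOpen Ω) {x : Euc N} (hx : x ∈ Ω)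
    (hl : LocallyIntegrableOn (G x) Ω) (f : Euc N → ℝ) :
    Integrable f (greenMeasure Ω G x) ↔ IntegrableOn (fun y => G x y * f y) Ω := by
  rw [greenMeasure, integrable_withDensity_iff_integrable_smul₀'
    hl.aestronglyMeasurable.aemeasurable.ennreal_ofReal (ae_of_all _ fun y => ENNReal.ofReal_lt_top)]
  refine integrableOn_congr_fun (fun y hy => ?_) hΩ.measurableSet
  simp only [smul_eq_mul]
  rw [ENNReal.toReal_ofReal (hR.pos x hx y hy).le]

theorem isGreen (hR : Represents Ω G) (hΩ : IsOpen Ω) (hΩd : UniqueDiffOn ℝ (closure Ω))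
    (hl : ∀ x ∈ Ω, LocallyIntegrableOn (G x) Ω) : IsGreen Ω (greenMeasure Ω G) where
  compl x hx := withDensity_absolutelyContinuous _ _ (by
    rw [Measure.restrict_apply hΩ.measurableSet.compl, compl_inter_self, measure_empty])
  ac x hx := (withDensity_absolutelyContinuous _ _).trans Measure.restrict_le_self.absolutelyContinuous
  ac' x hx := withDensity_absolutelyContinuous'
    (hl x hx).aestronglyMeasurable.aemeasurable.ennreal_ofReal
    ((ae_restrict_mem hΩ.measurableSet).mono fun y hy =>
      (ENNReal.ofReal_pos.2 (hR.pos x hx y hy)).ne')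
  fin x hx F hF hFΩ := by
    rw [greenMeasure, withDensity_apply _ hF.measurableSet,
      Measure.restrict_restrict_of_subset hFΩ]
    have := ((hl x hx).integrableOn_compact_subset hFΩ hF).lintegral_lt_top
    exact this
  rep x hx ψ hψ := by
    rw [hR.integral_greenMeasure hΩ hx (hl x hx), hR.rep ψ (hψ.isC2Zero hΩ) x hx]
    refine setIntegral_congr_fun hΩ.measurableSet fun y hy => ?_
    rw [lapOn_eq_lap hΩ hΩd (hψ.isC2Zero hΩ).smooth hy]

theorem isBar (hR : Represents Ω G) (hΩ : IsOpen Ω) (hΩd : UniqueDiffOn ℝ (closure Ω))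
    (hl : ∀ x ∈ Ω, LocallyIntegrableOn (G x) Ω) (hu : IsC2Zero Ω u) (hupos : ∀ x ∈ Ω, 0 < u x) :
    IsBar Ω (greenMeasure Ω G) u (fun x => -lapOn Ω u x) where
  cont := hu.smooth.continuousOn
  zero := hu.zero
  pos := hupos
  cont' := ((continuousOn_lapOn hΩd hu.smooth).mono subset_closure).neg
  weak := ((hu.smooth.mono subset_closure).weakPair hΩ).congr_right fun x hx => by
    rw [lapOn_eq_lap hΩ hΩd hu.smooth hx]
  integrable x hx := (hR.integrable_greenMeasure_iff hΩ hx (hl x hx) _).2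
    (hR.integrableOn hΩ hΩd hu hupos hu hx)
  rep x hx := (hR.rep u hu x hx).trans (hR.integral_greenMeasure hΩ hx (hl x hx) _).symm

end Represents

end

section

variable {N : ℕ} {Ω : Set (Euc N)} {μ : Euc N → Measure (Euc N)} {u v f : Euc N → ℝ}

theorem IsGreen.ac_restrict (hG : IsGreen Ω μ) {x : Euc N} (hx : x ∈ Ω) :
    μ x ≪ volume.restrict Ω := by
  rw [← Measure.restrict_eq_self_of_ae_mem (hG.ae_mem hx)]
  exact (hG.ac x hx).restrict Ω

theorem IsGreen.aestronglyMeasurable (hG : IsGreen Ω μ) (hΩ : IsOpen Ω) {x : Euc N} (hx : x ∈ Ω)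
    (hf : ContinuousOn f Ω) : AEStronglyMeasurable f (μ x) :=
  (hf.aestronglyMeasurable hΩ.measurableSet).mono_ac (hG.ac_restrict hx)

theorem isTest_indicator {D : Set (Euc N)} (hD : IsOpen D) (hD' : IsOpen (Ω \ D))
    {ψ : Euc N → ℝ} (hψ : IsTest Ω ψ) : IsTest Ω (D.indicator ψ) where
  smooth := by
    refine contDiff_iff_contDiffAt.2 fun x => ?_
    by_cases hxD : x ∈ D
    · refine hψ.smooth.contDiffAt.congr_of_eventuallyEq ?_
      filter_upwards [hD.mem_nhds hxD] with y hy
      rw [indicator_of_mem hy]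
    · refine (contDiffAt_const (c := (0:ℝ))).congr_of_eventuallyEq ?_
      by_cases hxΩ : x ∈ Ω
      · filter_upwards [hD'.mem_nhds ⟨hxΩ, hxD⟩] with y hy
        rw [indicator_of_notMem hy.2]
      · filter_upwards [notMem_tsupport_iff_eventuallyEq.1 fun hx => hxΩ (hψ.sub hx)] with y hy
        rw [indicator_apply_eq_zero]
        exact fun _ => hy
  compact := hψ.compact.of_isClosed_subset (isClosed_tsupport _)
    (closure_mono (by rw [support_indicator]; exact inter_subset_right))
  sub := (closure_mono (by rw [support_indicator]; exact inter_subset_right)).trans hψ.sub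

theorem IsGreen.exists_div_le (hG : IsGreen Ω μ) (hf : ContinuousOn f Ω)
    (hf0 : ∀ x ∈ Ω, 0 < f x) {ψ : Euc N → ℝ} (hψ : IsTest Ω ψ) :
    ∃ C > 0, ∀ y ∈ Ω, Integrable f (μ y) → ψ y ≤ C * ∫ z, f z ∂μ y := by
  obtain ⟨M, hM0, hM⟩ := hψ.lap.bounded
  obtain ⟨m, hm, hmf⟩ := IsCompact.exists_forall_le' hψ.compact (hf.mono hψ.sub)
    fun y hy => hf0 y (hψ.sub hy)
  have hC : 0 < M / m + 1 := by positivity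
  refine ⟨M / m + 1, hC, fun y hy hi => ?_⟩
  rw [hG.rep y hy ψ hψ, ← integral_const_mul]
  refine integral_mono_ae (hG.integrable_test hy hψ.lap.neg) (hi.const_mul _)
    ((hG.ae_mem hy).mono fun z hz => ?_)
  simp only
  by_cases hzt : z ∈ tsupport ψ
  · calc -lap ψ z ≤ M := (neg_le_abs _).trans (hM z)
      _ = M / m * m := by field_simp
      _ ≤ (M / m + 1) * f z := mul_le_mul (by linarith) (hmf z hzt) hm.le hC.le
  · rw [lap_eq_zero_of_notMem_tsupport hzt, neg_zero]
    exact mul_nonneg hC.le (hf0 z hz).le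

variable [NeZero N]

/-- Representation of a continuous weak solution with zero boundary values. -/
theorem IsBar.integral_eq_of_weakPair (h : IsBar Ω μ u v) (hΩ : IsOpen Ω)
    (hb : Bornology.IsBounded Ω) (hG : IsGreen Ω μ) (hvc : ContinuousOn v (closure Ω))
    (hv0 : ∀ x ∈ frontier Ω, v x = 0) (hvf : WeakPair Ω v f) (hf : ContinuousOn f Ω)
    (hf0 : ∀ x ∈ Ω, 0 ≤ f x) {x : Euc N} (hx : x ∈ Ω) : ∫ y, f y ∂μ x = v x := by
  have hvnn : ∀ x ∈ Ω, 0 ≤ v x := fun x hx => by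
    have := IsGreen.le_integral hΩ hG (hvf.const_mul (-1)) (continuousOn_const.mul h.cont')
      (continuousOn_const.mul hf)
      (vanishesAtBdry hΩ hb (continuousOn_const.mul hvc) fun y hy => by rw [hv0 y hy, mul_zero]) hx
      (k := fun _ => 0) (fun y hy => by linarith [hf0 y hy]) (fun _ _ => le_rfl)
      (integrable_zero _ _ _)
    rw [integral_zero] at this
    linarith
  have hle := h.lintegral_le hΩ hb hG hvnn hvf h.cont' hf hvnn hf0 hx
  have hf0' : 0 ≤ᵐ[μ x] f := (hG.ae_mem hx).mono hf0
  have hi : Integrable f (μ x) := by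
    refine ⟨hG.aestronglyMeasurable hΩ hx hf, ?_⟩
    rw [hasFiniteIntegral_iff_ofReal hf0']
    exact hle.trans_lt ENNReal.ofReal_lt_top
  refine le_antisymm ?_ (IsGreen.le_integral hΩ hG hvf h.cont' hf
    (vanishesAtBdry hΩ hb hvc fun y hy => (hv0 y hy).le) hx (fun _ _ => le_rfl) hf0 hi)
  rwa [← ofReal_integral_eq_lintegral_ofReal hi hf0', ENNReal.ofReal_le_ofReal_iff (hvnn x hx)] at hle

theorem IsBar.eq_empty_of_clopen (h : IsBar Ω μ u v) (hΩ : IsOpen Ω) (hb : Bornology.IsBounded Ω)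
    (hG : IsGreen Ω μ) {D : Set (Euc N)} (hDΩ : D ⊆ Ω) (hD : IsOpen D) (hD' : IsOpen (Ω \ D))
    (hv : ∀ x ∈ D, v x = 0) : D = ∅ := by
  rw [eq_empty_iff_forall_notMem]
  intro x hx
  have hw : WeakPair Ω (D.indicator u) fun _ => 0 := fun ψ hψ => by
    have h1 := h.weak _ (isTest_indicator hD hD' hψ)
    have e1 : ∀ y, D.indicator u y * -lap ψ y = u y * -lap (D.indicator ψ) y := fun y => by
      by_cases hyD : y ∈ D
      · rw [indicator_of_mem hyD, lap_congr (f := D.indicator ψ) (g := ψ)]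
        filter_upwards [hD.mem_nhds hyD] with z hz
        rw [indicator_of_mem hz]
      · rw [indicator_of_notMem hyD, zero_mul]
        by_cases hyΩ : y ∈ Ω
        · rw [lap_congr (f := D.indicator ψ) (g := fun _ => 0), lap_const, neg_zero, mul_zero]
          filter_upwards [hD'.mem_nhds ⟨hyΩ, hyD⟩] with z hz
          rw [indicator_of_notMem hz.2]
        · rw [(isTest_indicator hD hD' hψ).lap.eq_zero hyΩ, neg_zero, mul_zero]
    have e2 : ∀ y, v y * D.indicator ψ y = 0 * ψ y := fun y => by
      by_cases hyD : y ∈ D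
      · rw [hv y hyD, zero_mul, zero_mul]
      · rw [indicator_of_notMem hyD, mul_zero, zero_mul]
    simp only [e1, ← e2]
    exact h1
  have hc : ContinuousOn (D.indicator u) Ω := fun y hy => by
    refine ContinuousAt.continuousWithinAt ?_
    by_cases hyD : y ∈ D
    · refine ((h.contOn.continuousAt (hΩ.mem_nhds hy))).congr ?_
      filter_upwards [hD.mem_nhds hyD] with z hz
      rw [indicator_of_mem hz]
    · refine (continuousAt_const (y := (0:ℝ))).congr ?_
      filter_upwards [hD'.mem_nhds ⟨hy, hyD⟩] with z hz
      rw [indicator_of_notMem hz.2]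
  have hvan : VanishesAtBdry Ω (D.indicator u) := fun c hc => by
    obtain ⟨F, hF, hFΩ, hle⟩ := h.vanishes hΩ hb c hc
    exact ⟨F, hF, hFΩ, fun y hy hyF =>
      indicator_apply_le' (fun _ => hle y hy hyF) fun _ => hc.le⟩
  have := IsGreen.le_integral hΩ hG hw hc continuousOn_const hvan (hDΩ hx) (k := fun _ => 0)
    (fun _ _ => le_rfl) (fun _ _ => le_rfl) (integrable_zero _ _ _)
  rw [integral_zero, indicator_of_mem hx] at this
  exact absurd (h.pos x (hDΩ hx)) this.not_gt

/-- If the iterated potential of `f > 0` is `u`, then `-Δu` is positive. -/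
theorem IsBar.pos_of_rep (h : IsBar Ω μ u v) (hΩ : IsOpen Ω) (hb : Bornology.IsBounded Ω)
    (hG : IsGreen Ω μ) (hf : ContinuousOn f Ω) (hf0 : ∀ x ∈ Ω, 0 < f x)
    (hV : ∀ᵐ x, x ∈ Ω → ∫ y, f y ∂μ x = v x) {x : Euc N} (hx : x ∈ Ω) : 0 < v x := by
  have alt : ∀ x₁ ∈ Ω, ∃ δ > 0, ∀ᶠ y in 𝓝 x₁, y ∈ Ω ∧ (v y = 0 ∨ δ ≤ v y) := by
    intro x₁ hx₁
    obtain ⟨χ, hχ, hχ1, -⟩ := exists_cutoff hΩ isCompact_singleton (singleton_subset_iff.2 hx₁)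
    rw [nhdsSet_singleton] at hχ1
    obtain ⟨C, hC, hle⟩ := hG.exists_div_le hf hf0 hχ
    have hae : ∀ᵐ y, y ∈ Ω → v y = 0 ∨ χ y ≤ C * v y := by
      filter_upwards [hV] with y hy hyΩ
      by_cases hi : Integrable f (μ y)
      · right
        rw [← hy hyΩ]
        exact hle y hyΩ hi
      · left
        rw [← hy hyΩ, integral_undef hi]
    have hopen : IsOpen {y | y ∈ Ω ∧ v y ≠ 0 ∧ C * v y < χ y} := by
      have h1 : ContinuousOn (fun y => (v y, C * v y - χ y)) Ω :=
        h.cont'.prodMk ((continuousOn_const.mul h.cont').sub hχ.continuous.continuousOn)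
      have h2 := h1.isOpen_inter_preimage hΩ
        ((isOpen_compl_singleton (x := (0:ℝ))).prod (isOpen_Iio (a := (0:ℝ))))
      convert h2 using 1
      ext y
      simp only [mem_ofPred_eq, mem_inter_iff, mem_preimage, mem_prod, mem_compl_iff,
        mem_singleton_iff, mem_Iio, sub_neg, ne_eq]
    have hemp := hopen.eq_empty_of_measure_zero (μ := volume) (by
      refine measure_mono_null (fun y hy => ?_) (ae_iff.1 hae)
      simp only [mem_ofPred_eq, Classical.not_imp, not_or, not_le]
      exact hy)
    refine ⟨C⁻¹, inv_pos.2 hC, ?_⟩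
    filter_upwards [hχ1, hΩ.mem_nhds hx₁] with y hy hyΩ
    refine ⟨hyΩ, ?_⟩
    by_contra! hc
    refine (eq_empty_iff_forall_notMem.1 hemp y) ⟨hyΩ, hc.1, ?_⟩
    rw [hy, mul_comm, ← lt_div_iff₀ hC, one_div]
    exact hc.2
  have hD := h.eq_empty_of_clopen hΩ hb hG (D := {y | y ∈ Ω ∧ v y = 0}) (fun y hy => hy.1)
    (isOpen_iff_mem_nhds.2 fun y hy => by
      obtain ⟨δ, hδ, hev⟩ := alt y hy.1
      have hlt : ∀ᶠ z in 𝓝 y, v z < δ :=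
        (h.cont'.continuousAt (hΩ.mem_nhds hy.1)).eventually_lt_const (by rw [hy.2]; exact hδ)
      filter_upwards [hev, hlt] with z hz hz'
      exact ⟨hz.1, hz.2.resolve_right hz'.not_ge⟩)
    (by
      have := h.cont'.isOpen_inter_preimage hΩ (isOpen_compl_singleton (x := (0:ℝ)))
      convert this using 1
      ext y
      simp only [Set.mem_sdiff, mem_ofPred_eq, mem_inter_iff, mem_preimage, mem_compl_iff,
        mem_singleton_iff]
      tauto)
    (fun y hy => hy.2)
  obtain ⟨δ, hδ, hev⟩ := alt x hx
  rcases hev.self_of_nhds.2 with h0 | hle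
  · exact absurd (show x ∈ {y | y ∈ Ω ∧ v y = 0} from ⟨hx, h0⟩) (by rw [hD]; exact id)
  · exact hδ.trans_le hle

end

section

variable {N : ℕ} {Ω : Set (Euc N)} {μ : Euc N → Measure (Euc N)} {u v f g : Euc N → ℝ} [NeZero N]

theorem IsBar.aemeasurable_lintegral (h : IsBar Ω μ u v) (hΩ : IsOpen Ω)
    (hb : Bornology.IsBounded Ω) (hG : IsGreen Ω μ) (hv : ∀ x ∈ Ω, 0 < v x)
    (hg : ∀ x ∈ Ω, 0 ≤ g x) (hgm : AEStronglyMeasurable g (volume.restrict Ω)) :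
    AEMeasurable (fun x => ∫⁻ y, ENNReal.ofReal (g y) ∂μ x) (volume.restrict Ω) := by
  refine aemeasurable_of_tendsto_metrizable_ae atTop (fun k => ?_)
    ((ae_restrict_mem hΩ.measurableSet).mono fun x hx =>
      h.lintegral_cut_tendsto hΩ hb hG hg hgm hx)
  obtain ⟨C, hC, hle⟩ := h.exists_integral_cut_le hΩ hb hG hv hg k
  exact (h.cut_isAdm hΩ hb hg hgm k hle).aemeasurable_lintegral (h.const_mul hC) hΩ hb hG

theorem IsBar.integral_mul_of_nonneg (h : IsBar Ω μ u v) (hΩ : IsOpen Ω)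
    (hb : Bornology.IsBounded Ω) (hG : IsGreen Ω μ) (hv : ∀ x ∈ Ω, 0 < v x)
    (hf : ContinuousOn f Ω) (hf0 : ∀ x ∈ Ω, 0 < f x)
    (hV : ∀ᵐ x, x ∈ Ω → ∫ y, f y ∂μ x = v x)
    (hg : ∀ x ∈ Ω, 0 ≤ g x) (hgm : AEStronglyMeasurable g (volume.restrict Ω))
    (hgi : ∀ x ∈ Ω, Integrable g (μ x)) (hvg : IntegrableOn (fun x => v x * g x) Ω) :
    IntegrableOn (fun x => f x * ∫ y, g y ∂μ x) Ω ∧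
      ∫ x in Ω, f x * ∫ y, g y ∂μ x = ∫ x in Ω, v x * g x := by
  have hΩm : ∀ᵐ x ∂volume.restrict Ω, x ∈ Ω := ae_restrict_mem hΩ.measurableSet
  have hfm : AEStronglyMeasurable f (volume.restrict Ω) := hf.aestronglyMeasurable hΩ.measurableSet
  have hpnn : ∀ x ∈ Ω, 0 ≤ ∫ y, g y ∂μ x := fun x hx =>
    integral_nonneg_of_ae ((hG.ae_mem hx).mono hg)
  have hp : ∀ x ∈ Ω, ∫⁻ y, ENNReal.ofReal (g y) ∂μ x = ENNReal.ofReal (∫ y, g y ∂μ x) :=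
    fun x hx => (ofReal_integral_eq_lintegral_ofReal (hgi x hx) ((hG.ae_mem hx).mono hg)).symm
  have hpm : AEStronglyMeasurable (fun x => ∫ y, g y ∂μ x) (volume.restrict Ω) := by
    refine ((h.aemeasurable_lintegral hΩ hb hG hv hg hgm).ennreal_toReal.congr
      (hΩm.mono fun x hx => ?_)).aestronglyMeasurable
    simp only
    rw [hp x hx, ENNReal.toReal_ofReal (hpnn x hx)]
  have key : ∫⁻ x in Ω, ENNReal.ofReal (f x * ∫ y, g y ∂μ x) =
      ENNReal.ofReal (∫ x in Ω, v x * g x) := by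
    rw [ofReal_integral_eq_lintegral_ofReal hvg
      (hΩm.mono fun x hx => mul_nonneg (hv x hx).le (hg x hx))]
    have e := h.lintegral_comm hΩ hb hG hv (fun x hx => (hf0 x hx).le) hfm hg hgm
    have e1 : ∫⁻ x in Ω, ENNReal.ofReal (v x * g x) =
        ∫⁻ x in Ω, (∫⁻ y, ENNReal.ofReal (f y) ∂μ x) * ENNReal.ofReal (g x) := by
      refine lintegral_congr_ae ?_
      filter_upwards [hΩm, ae_restrict_of_ae hV] with x hx hVx
      have hi : Integrable f (μ x) := by
        by_contra hc
        have := hVx hx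
        rw [integral_undef hc] at this
        exact (hv x hx).ne this
      rw [← ofReal_integral_eq_lintegral_ofReal hi ((hG.ae_mem hx).mono fun y hy => (hf0 y hy).le),
        hVx hx, ENNReal.ofReal_mul (hv x hx).le]
    rw [e1, e]
    refine lintegral_congr_ae (hΩm.mono fun x hx => ?_)
    simp only
    rw [hp x hx, ENNReal.ofReal_mul (hf0 x hx).le, mul_comm]
  have hnn : 0 ≤ᵐ[volume.restrict Ω] fun x => f x * ∫ y, g y ∂μ x :=
    hΩm.mono fun x hx => mul_nonneg (hf0 x hx).le (hpnn x hx)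
  have hi : IntegrableOn (fun x => f x * ∫ y, g y ∂μ x) Ω := by
    refine ⟨hfm.mul hpm, ?_⟩
    rw [hasFiniteIntegral_iff_ofReal hnn, key]
    exact ENNReal.ofReal_lt_top
  refine ⟨hi, ?_⟩
  rw [← ofReal_integral_eq_lintegral_ofReal hi hnn] at key
  exact (ENNReal.ofReal_eq_ofReal_iff (integral_nonneg_of_ae hnn) (integral_nonneg_of_ae
    (hΩm.mono fun x hx => mul_nonneg (hv x hx).le (hg x hx)))).1 key

/-- Symmetry of the Green operator, for densities of arbitrary sign. -/
theorem IsBar.integral_mul_eq (h : IsBar Ω μ u v) (hΩ : IsOpen Ω)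
    (hb : Bornology.IsBounded Ω) (hG : IsGreen Ω μ) (hv : ∀ x ∈ Ω, 0 < v x)
    (hf : ContinuousOn f Ω) (hf0 : ∀ x ∈ Ω, 0 < f x)
    (hV : ∀ᵐ x, x ∈ Ω → ∫ y, f y ∂μ x = v x) (hgm : AEStronglyMeasurable g (volume.restrict Ω))
    (hgi : ∀ x ∈ Ω, Integrable g (μ x)) (hvg : IntegrableOn (fun x => v x * g x) Ω) :
    ∫ x in Ω, f x * ∫ y, g y ∂μ x = ∫ x in Ω, v x * g x := by
  have hmul : ∀ x ∈ Ω, ∀ t, v x * max t 0 = max (v x * t) 0 := fun x hx t => by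
    rw [mul_max_of_nonneg _ _ (hv x hx).le, mul_zero]
  have h1 : IntegrableOn (fun x => v x * max (g x) 0) Ω :=
    IntegrableOn.congr_fun (Integrable.pos_part hvg) (fun x hx => (hmul x hx _).symm)
      hΩ.measurableSet
  have h2 : IntegrableOn (fun x => v x * max (-g x) 0) Ω :=
    IntegrableOn.congr_fun (Integrable.neg_part hvg) (fun x hx => by
      rw [hmul x hx, mul_neg]) hΩ.measurableSet
  obtain ⟨i1, e1⟩ := h.integral_mul_of_nonneg hΩ hb hG hv hf hf0 hV
    (fun x _ => le_max_right (g x) 0) (hgm.sup aestronglyMeasurable_const)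
    (fun x hx => (hgi x hx).pos_part) h1
  obtain ⟨i2, e2⟩ := h.integral_mul_of_nonneg hΩ hb hG hv hf hf0 hV
    (fun x _ => le_max_right (-g x) 0) (hgm.neg.sup aestronglyMeasurable_const)
    (fun x hx => (hgi x hx).neg_part) h2
  have hsub : ∀ t : ℝ, max t 0 - max (-t) 0 = t := max_zero_sub_max_neg_zero_eq_self
  calc ∫ x in Ω, f x * ∫ y, g y ∂μ x
      = ∫ x in Ω, (f x * ∫ y, max (g y) 0 ∂μ x - f x * ∫ y, max (-g y) 0 ∂μ x) := by
        refine setIntegral_congr_fun hΩ.measurableSet fun x hx => ?_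
        rw [← mul_sub, ← integral_sub (hgi x hx).pos_part (hgi x hx).neg_part]
        simp only [hsub]
    _ = ∫ x in Ω, (v x * max (g x) 0 - v x * max (-g x) 0) := by
        rw [integral_sub i1 i2, e1, e2, integral_sub h1 h2]
    _ = ∫ x in Ω, v x * g x := by simp only [← mul_sub, hsub]

/-- If `v` is the potential of `f` almost everywhere, then `v` vanishes on the boundary. -/
theorem IsBar.boundary_zero (h : IsBar Ω μ u v) (hΩ : IsOpen Ω)
    (hb : Bornology.IsBounded Ω) (hG : IsGreen Ω μ) (hv : ∀ x ∈ Ω, 0 < v x)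
    (hu2 : ContDiffOn ℝ 2 u Ω) (huv : ∀ x ∈ Ω, -lap u x = v x)
    (hvc : ContinuousOn v (closure Ω)) (hf : ContinuousOn f Ω) (hf0 : ∀ x ∈ Ω, 0 < f x)
    (hvf : WeakPair Ω v f) (hV : ∀ᵐ x, x ∈ Ω → ∫ y, f y ∂μ x = v x) {p : Euc N}
    (hp : p ∈ frontier Ω) : v p = 0 := by
  have hpc : p ∈ closure Ω := frontier_subset_closure hp
  have hvp : 0 ≤ v p := by
    have : MapsTo v (closure Ω) (closure (Ici 0)) :=
      MapsTo.closure_of_continuousOn (fun x hx => (hv x hx).le) hvc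
    rw [closure_Ici] at this
    exact this hpc
  by_contra hne
  obtain ⟨a, ha, hap⟩ : ∃ a, 0 < a ∧ a < v p := exists_between (lt_of_le_of_ne hvp (Ne.symm hne))
  obtain ⟨r, hr, hra⟩ : ∃ r > 0, ∀ x ∈ Ω, dist x p < r → a < v x := by
    obtain ⟨r, hr, hsub⟩ := Metric.mem_nhdsWithin_iff.1 ((hvc p hpc).eventually_const_lt hap)
    exact ⟨r, hr, fun x hx hxp => hsub ⟨hxp, subset_closure hx⟩⟩
  obtain ⟨φ, hφ⟩ := exists_trunc (ε := a / 8) (by positivity)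
  set l : ℝ := 2 * N / r ^ 2 with hl
  have hl0 : 0 ≤ l := by positivity
  set b : Euc N → ℝ := fun x => a - (a / r ^ 2 * ‖x - p‖ ^ 2 + l * u x) with hbdef
  have hn2 : ContDiff ℝ 2 fun x : Euc N => ‖x - p‖ ^ 2 := (contDiff_norm_sub_sq p).of_le two_le_infty
  have hbC : ContDiffOn ℝ 2 b Ω :=
    contDiffOn_const.sub ((contDiffOn_const.mul hn2.contDiffOn).add (contDiffOn_const.mul hu2))
  have hbc : ContinuousOn b (closure Ω) :=
    continuousOn_const.sub ((continuousOn_const.mul hn2.continuous.continuousOn).add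
      (continuousOn_const.mul h.cont))
  have hlapb : ∀ x ∈ Ω, lap b x = -(l * (a - v x)) := fun x hx => by
    have hux := hu2.contDiffAt (hΩ.mem_nhds hx)
    have h1 : ContDiffAt ℝ 2 (fun x : Euc N => a / r ^ 2 * ‖x - p‖ ^ 2) x :=
      contDiffAt_const.mul hn2.contDiffAt
    have h2 : ContDiffAt ℝ 2 (fun x : Euc N => l * u x) x := contDiffAt_const.mul hux
    rw [hbdef, lap_sub contDiffAt_const (h1.add h2), lap_const, lap_add h1 h2,
      lap_const_mul _ hn2.contDiffAt, lap_const_mul _ hux, lap_norm_sq, ← huv x hx, hl]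
    field_simp
    ring
  have hbpos : ∀ x ∈ Ω, a / 8 < b x → b x ≤ a ∧ a < v x := fun x hx hbx => by
    have hux : 0 ≤ l * u x := mul_nonneg hl0 (h.pos x hx).le
    have hsq : 0 ≤ a / r ^ 2 * ‖x - p‖ ^ 2 := by positivity
    simp only [hbdef] at hbx ⊢
    refine ⟨by linarith, hra x hx ?_⟩
    rw [dist_eq_norm]
    by_contra! hc
    have : a / r ^ 2 * r ^ 2 ≤ a / r ^ 2 * ‖x - p‖ ^ 2 := by gcongr
    rw [div_mul_cancel₀ _ (by positivity)] at this
    linarith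
  set B : Euc N → ℝ := fun x => φ (b x) with hB
  have hBC : ContDiffOn ℝ 2 B Ω := (hφ.smooth.of_le two_le_infty).comp_contDiffOn hbC
  have hlapB : ∀ x ∈ Ω, 0 ≤ lap B x := fun x hx => by
    rw [hB, lap_comp hφ.smooth (hbC.contDiffAt (hΩ.mem_nhds hx)), hlapb x hx]
    refine add_nonneg ?_ (mul_nonneg (hφ.deriv2_nonneg _)
      (Finset.sum_nonneg fun i _ => sq_nonneg _))
    by_cases hbx : b x ≤ a / 8
    · rw [hφ.deriv_zero _ hbx, zero_mul]
    · have := hbpos x hx (not_le.1 hbx)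
      refine mul_nonneg (hφ.deriv_nonneg _) ?_
      rw [← mul_neg]
      exact mul_nonneg hl0 (by linarith)
  have hBv : ∀ x ∈ Ω, B x ≤ v x := fun x hx => by
    by_cases hbx : b x ≤ a / 8
    · rw [hB]
      simp only
      rw [hφ.zero _ hbx]
      exact (hv x hx).le
    · have := hbpos x hx (not_le.1 hbx)
      exact (hφ.le_self _ (by linarith)).trans (this.1.trans this.2.le)
  have hlapBc : ContinuousOn (fun x => -lap B x) Ω := fun x hx =>
    (hBC.contDiffAt (hΩ.mem_nhds hx)).continuousAt_lap.neg.continuousWithinAt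
  have hle : ∀ x ∈ Ω, ∫⁻ y, ENNReal.ofReal (f y) ∂μ x ≤ ENNReal.ofReal (v x - B x) := by
    intro x hx
    refine le_trans (lintegral_mono_ae ((hG.ae_mem hx).mono fun y hy => ?_))
      (h.lintegral_le hΩ hb hG (fun x hx => (hv x hx).le)
        (hvf.sub hΩ (hBC.weakPair hΩ) h.cont' hf hBC.continuousOn hlapBc)
        (h.cont'.sub hBC.continuousOn) (hf.sub hlapBc) (fun y hy => sub_nonneg.2 (hBv y hy))
        (fun y hy => by linarith [hlapB y hy, hf0 y hy]) hx)
    exact ENNReal.ofReal_le_ofReal (by linarith [hlapB y hy])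
  have hBae : ∀ᵐ x, x ∈ Ω → B x ≤ 0 := by
    filter_upwards [hV] with x hVx hx
    have hi : Integrable f (μ x) := by
      by_contra hc
      have := hVx hx
      rw [integral_undef hc] at this
      exact (hv x hx).ne this
    have := hle x hx
    rw [← ofReal_integral_eq_lintegral_ofReal hi ((hG.ae_mem hx).mono fun y hy => (hf0 y hy).le),
      hVx hx, ENNReal.ofReal_le_ofReal_iff (sub_nonneg.2 (hBv x hx))] at this
    linarith
  have hopen : IsOpen (Ω ∩ b ⁻¹' Ioi (a / 2)) :=
    hbC.continuousOn.isOpen_inter_preimage hΩ isOpen_Ioi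
  have hemp := hopen.eq_empty_of_measure_zero (μ := volume) (by
    refine measure_mono_null (fun y hy => ?_) (ae_iff.1 hBae)
    simp only [mem_ofPred_eq, Classical.not_imp, not_le]
    refine ⟨hy.1, ?_⟩
    have h1 := hφ.sub_le (b y)
    have h2 : a / 2 < b y := hy.2
    simp only [hB]
    linarith)
  have hbp : a / 2 < b p := by
    simp only [hbdef, sub_self, norm_zero, h.zero p hp]
    norm_num
    linarith
  obtain ⟨U, hU, hpU, hsub⟩ := mem_nhdsWithin.1 ((hbc p hpc).eventually_const_lt hbp)
  obtain ⟨x, hxU, hx⟩ := mem_closure_iff.1 hpc U hU hpU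
  exact eq_empty_iff_forall_notMem.1 hemp x ⟨hx, hsub ⟨hxU, subset_closure hx⟩⟩

end

section

variable {N : ℕ} {Ω : Set (Euc N)} {G : Euc N → Euc N → ℝ} {u f : Euc N → ℝ}

theorem LocHolder.continuousOn {ν : ℝ} (hν : 0 < ν) {K : Euc N → ℝ} (hK : LocHolder Ω ν K) :
    ContinuousOn K Ω := fun x hx => by
  obtain ⟨s, hs, C, hC⟩ := hK x hx
  exact ((hC.continuousOn (Real.toNNReal_pos.2 hν)) x (mem_of_mem_nhdsWithin hx hs)).mono_of_mem_nhdsWithin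
    hs

/-- The integral identity on test functions is the weak equation for `-Δu`. -/
theorem weakPair_of_forall_test (hΩ : IsOpen Ω) (hΩd : UniqueDiffOn ℝ (closure Ω))
    (h : ∀ ψ, IsC2Zero Ω ψ → ∫ x in Ω, lapOn Ω u x * lapOn Ω ψ x = ∫ x in Ω, f x * ψ x) :
    WeakPair Ω (fun x => -lapOn Ω u x) f := fun ψ hψ => by
  rw [← setIntegral_eq_of_test hψ.lap.neg, ← setIntegral_eq_of_test hψ, ← h ψ (hψ.isC2Zero hΩ)]
  refine setIntegral_congr_fun hΩ.measurableSet fun x hx => ?_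
  rw [lapOn_eq_lap hΩ hΩd (hψ.isC2Zero hΩ).smooth hx, neg_mul_neg]

namespace Represents

variable [NeZero N]

/-- Solutions of the Navier problem are iterated Green potentials. -/
theorem eq_iterated_of_isNavierSol (hR : Represents Ω G) (hΩ : IsOpen Ω)
    (hb : Bornology.IsBounded Ω) (hΩd : UniqueDiffOn ℝ (closure Ω)) (hu : IsC2Zero Ω u)
    (hupos : ∀ x ∈ Ω, 0 < u x) (hf : ContinuousOn f Ω) (hf0 : ∀ x ∈ Ω, 0 < f x)
    (hsol : IsNavierSol Ω f u) {x : Euc N} (hx : x ∈ Ω) :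
    u x = ∫ y in Ω, G x y * ∫ z in Ω, G y z * f z := by
  have hl : ∀ x ∈ Ω, LocallyIntegrableOn (G x) Ω := fun x hx =>
    hR.locallyIntegrableOn hΩ hΩd hu hupos hx
  rw [hR.rep u hu x hx]
  refine setIntegral_congr_fun hΩ.measurableSet fun y hy => ?_
  rw [← hR.integral_greenMeasure hΩ hy (hl y hy),
    (hR.isBar hΩ hΩd hl hu hupos).integral_eq_of_weakPair hΩ hb (hR.isGreen hΩ hΩd hl)
      (continuousOn_lapOn hΩd hu.smooth).neg (fun p hp => by rw [hsol.2.2.1 p hp, neg_zero])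
      (weakPair_of_forall_test hΩ hΩd fun ψ hψ => hsol.2.2.2 ψ hψ.smooth hψ.zero)
      hf (fun z hz => (hf0 z hz).le) hy]

/-- Iterated Green potentials are solutions of the Navier problem. -/
theorem isNavierSol_of_eq_iterated (hR : Represents Ω G) (hΩ : IsOpen Ω)
    (hb : Bornology.IsBounded Ω) (hne : Ω.Nonempty) (hΩd : UniqueDiffOn ℝ (closure Ω))
    (hu : IsC2Zero Ω u) (hupos : ∀ x ∈ Ω, 0 < u x) (hf : ContinuousOn f Ω)
    (hf0 : ∀ x ∈ Ω, 0 < f x)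
    (hrep : ∀ x ∈ Ω, u x = ∫ y in Ω, G x y * ∫ z in Ω, G y z * f z) : IsNavierSol Ω f u := by
  have hl : ∀ x ∈ Ω, LocallyIntegrableOn (G x) Ω := fun x hx =>
    hR.locallyIntegrableOn hΩ hΩd hu hupos hx
  have hG := hR.isGreen hΩ hΩd hl
  have hB := hR.isBar hΩ hΩd hl hu hupos
  have hcont {ψ : Euc N → ℝ} (hψ : IsC2Zero Ω ψ) := continuousOn_lapOn hΩd hψ.smooth
  have hVu : ∀ x ∈ Ω, u x = ∫ y, ∫ z, f z ∂greenMeasure Ω G y ∂greenMeasure Ω G x :=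
    fun x hx => by
      rw [hR.integral_greenMeasure hΩ hx (hl x hx), hrep x hx]
      refine setIntegral_congr_fun hΩ.measurableSet fun y hy => ?_
      rw [hR.integral_greenMeasure hΩ hy (hl y hy)]
  have hV : ∀ᵐ x, x ∈ Ω → ∫ y, f y ∂greenMeasure Ω G x = -lapOn Ω u x := by
    refine hB.ae_eq_of_rep hΩ hb hne hG (fun x hx => ?_) (fun x hx => ?_) hVu
    · rw [hR.integral_greenMeasure hΩ hx (hl x hx)]
      exact setIntegral_nonneg hΩ.measurableSet fun y hy =>
        mul_nonneg (hR.pos x hx y hy).le (hf0 y hy).le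
    · by_contra hni
      exact (hupos x hx).ne' ((hVu x hx).trans (integral_undef hni))
  have hv : ∀ x ∈ Ω, 0 < -lapOn Ω u x := fun x hx => hB.pos_of_rep hΩ hb hG hf hf0 hV hx
  have hid : ∀ ψ, IsC2Zero Ω ψ → ∫ x in Ω, lapOn Ω u x * lapOn Ω ψ x = ∫ x in Ω, f x * ψ x :=
    fun ψ hψ => by
      have key := hB.integral_mul_eq hΩ hb hG hv hf hf0 hV (g := fun x => -lapOn Ω ψ x)
        (((hcont hψ).mono subset_closure).neg.aestronglyMeasurable hΩ.measurableSet)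
        (fun x hx => (hR.integrable_greenMeasure_iff hΩ hx (hl x hx) _).2
          (hR.integrableOn hΩ hΩd hu hupos hψ hx))
        ((((hcont hu).neg.mul (hcont hψ).neg).integrableOn_compact
          hb.isCompact_closure).mono_set subset_closure)
      simp only [neg_mul_neg] at key
      rw [← key]
      refine setIntegral_congr_fun hΩ.measurableSet fun x hx => ?_
      rw [hR.integral_greenMeasure hΩ hx (hl x hx), ← hR.rep ψ hψ x hx]
  refine ⟨hu.smooth, hu.zero, fun p hp => neg_eq_zero.1 ?_, fun ψ h1 h2 => hid ψ ⟨h1, h2⟩⟩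
  exact hB.boundary_zero hΩ hb hG hv (hu.smooth.mono subset_closure)
    (fun x hx => by rw [lapOn_eq_lap hΩ hΩd hu.smooth hx]) (hcont hu).neg hf hf0
    (weakPair_of_forall_test hΩ hΩd hid) hV hp

end Represents

end

theorem statement_8
    {N : ℕ} (hN : 2 ≤ N)
    (Ω : Set (Euc N)) (hΩo : IsOpen Ω) (hΩb : Bornology.IsBounded Ω)
    (hΩne : Ω.Nonempty) (hΩd : UniqueDiffOn ℝ (closure Ω))
    (K : Euc N → ℝ) (ν : ℝ) (hν : ν ∈ Ioo (0:ℝ) 1) (hK : LocHolder Ω ν K)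
    (hKinf : ∃ k > 0, ∀ x ∈ Ω, k ≤ K x)
    (α β : ℝ) (hα : 0 < α) (hβ : 0 ≤ β)
    (hKup : ∃ C > 0, ∀ x ∈ Ω, K x ≤ C * bdist Ω x ^ (-β))
    -- `G` is the (positive) Green function of `-Δ` in `Ω` with Dirichlet condition:
    (G : Euc N → Euc N → ℝ)
    (hGpos : ∀ x ∈ Ω, ∀ y ∈ Ω, 0 < G x y)
    (hGrep : ∀ g w : Euc N → ℝ, ContinuousOn g (closure Ω) →
      ContDiffOn ℝ 2 w (closure Ω) → (∀ x ∈ Ω, -lapOn Ω w x = g x) →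
      (∀ x ∈ frontier Ω, w x = 0) →
      ∀ x ∈ Ω, w x = ∫ y in Ω, G x y * g y)
    (u : Euc N → ℝ) (hureg : ContDiffOn ℝ 2 u (closure Ω))
    (hubd : ∀ x ∈ frontier Ω, u x = 0) (hupos : ∀ x ∈ Ω, 0 < u x) :
    IsSolP Ω K α u ↔
      ∀ x ∈ Ω, u x = ∫ y in Ω, G x y * ∫ z in Ω, G y z * (K z * u z ^ (-α)) := by
  have : NeZero N := ⟨by lia⟩
  have hR : Represents Ω G := ⟨hGpos, fun ψ hψ x hx =>
    hGrep _ ψ (continuousOn_lapOn hΩd hψ.smooth).neg hψ.smooth (fun _ _ => rfl) hψ.zero x hx⟩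
  have hu : IsC2Zero Ω u := ⟨hureg, hubd⟩
  have hf : ContinuousOn (fun z => K z * u z ^ (-α)) Ω := (hK.continuousOn hν.1).mul
    ((hureg.continuousOn.mono subset_closure).rpow_const fun z hz => Or.inl (hupos z hz).ne')
  obtain ⟨k, hk, hkK⟩ := hKinf
  have hf0 : ∀ z ∈ Ω, 0 < K z * u z ^ (-α) := fun z hz =>
    mul_pos (hk.trans_le (hkK z hz)) (Real.rpow_pos_of_pos (hupos z hz) _)
  exact ⟨fun h x hx => hR.eq_iterated_of_isNavierSol hΩo hΩb hΩd hu hupos hf hf0 h.2 hx,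
    fun h => ⟨hupos, hR.isNavierSol_of_eq_iterated hΩo hΩb hΩne hΩd hu hupos hf hf0 h⟩⟩
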